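/- Let G be a planar graph in which every vertex has degree at least 3 and every vertex of degree 3 has all neighbors of degree at least 12. Then G contains either a vertex v of degree 4 with two neighbors of degrees at most 7 and at most 9 respectively, or a vertex v of degree 5 with three neighbors of degrees at most 6, at most 7 and at most 8 respectively (neighbors ordered by increasing degree). -/

import Mathlib

open SimpleGraph Finset

universe u

variable {V : Type u}

/-- A proper edge coloring with `k` colors: distinct edges sharing a vertex get
different colors. -/
def ProperEC (G : SimpleGraph V) {k : ℕ} (φ : Sym2 V → Fin k) : Prop :=
  ∀ e₁ ∈ G.edgeSet, ∀ e₂ ∈ G.edgeSet, e₁ ≠ e₂ → (∃ x, x ∈ e₁ ∧ x ∈ e₂) → φ e₁ ≠ φ e₂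

/-- An acyclic edge coloring: proper, and no cycle of `G` uses only two colors. -/
def AcyclicEC (G : SimpleGraph V) {k : ℕ} (φ : Sym2 V → Fin k) : Prop :=
  ProperEC G φ ∧
    ∀ (v : V) (w : G.Walk v v), w.IsCycle → 2 < (w.edges.map φ).toFinset.card

/-- `G` has an acyclic edge coloring with `k` colors, i.e. `χ'_a(G) ≤ k`. -/
def HasAEC (G : SimpleGraph V) (k : ℕ) : Prop :=
  ∃ φ : Sym2 V → Fin k, AcyclicEC G φ

/-- `G` is acyclically edge `k`-critical: `χ'_a(G) > k` but every proper subgraph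
admits an acyclic edge `k`-coloring. -/
def AcyclicallyEdgeCritical (G : SimpleGraph V) (k : ℕ) : Prop :=
  ¬ HasAEC G k ∧ ∀ H : SimpleGraph V, H ≤ G → H ≠ G → HasAEC H k

/-- `C_φ(v)`: the set of colors appearing on edges incident with `v`. -/
def Cset (G : SimpleGraph V) {k : ℕ} (φ : Sym2 V → Fin k) (v : V) : Set (Fin k) :=
  {c | ∃ u, G.Adj v u ∧ φ s(v, u) = c}

/-- `H` is a minor of `G`: disjoint connected branch sets realizing the edges of `H`. -/
def HasMinor {W : Type*} (G : SimpleGraph V) (H : SimpleGraph W) : Prop :=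
  ∃ f : W → Set V,
    (∀ w, (f w).Nonempty ∧ (G.induce (f w)).Connected) ∧
    (∀ w₁ w₂, w₁ ≠ w₂ → Disjoint (f w₁) (f w₂)) ∧
    ∀ w₁ w₂, H.Adj w₁ w₂ → ∃ v₁ ∈ f w₁, ∃ v₂ ∈ f w₂, G.Adj v₁ v₂

/-- Planarity via Wagner's theorem: no `K₅` minor and no `K₃,₃` minor. -/
def IsPlanar (G : SimpleGraph V) : Prop :=
  ¬ HasMinor G (completeGraph (Fin 5)) ∧
    ¬ HasMinor G (completeBipartiteGraph (Fin 3) (Fin 3))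

/-! ### The cycle space over `ZMod 2` -/

/-- The boundary of a function on ordered pairs of vertices. -/
def boundary [Fintype V] : (V → V → ZMod 2) →ₗ[ZMod 2] (V → ZMod 2) where
  toFun z := fun u => ∑ v, z u v
  map_add' x y := by ext u; simp [Finset.sum_add_distrib]
  map_smul' a x := by ext u; simp [Finset.mul_sum]

lemma boundary_apply [Fintype V] (z : V → V → ZMod 2) (u : V) :
    boundary z u = ∑ v, z u v := rfl

/-- Sets of edges of `G`, as symmetric functions with values in `ZMod 2`. -/
def chains (G : SimpleGraph V) : Submodule (ZMod 2) (V → V → ZMod 2) where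
  carrier := {z | (∀ u v, z u v = z v u) ∧ ∀ u v, z u v ≠ 0 → G.Adj u v}
  add_mem' := by
    rintro x y ⟨hx, hx'⟩ ⟨hy, hy'⟩
    refine ⟨fun u v => by simp [hx u v, hy u v], fun u v h => ?_⟩
    by_contra hn
    exact h (by simp [not_not.1 (mt (hx' u v) hn), not_not.1 (mt (hy' u v) hn)])
  zero_mem' := by simp
  smul_mem' := by
    rintro a x ⟨hx, hx'⟩
    refine ⟨fun u v => by simp [hx u v], fun u v h => hx' u v fun h0 => h (by simp [h0])⟩

lemma chains_mono {G H : SimpleGraph V} (h : G ≤ H) : chains G ≤ chains H :=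
  fun _ hz => ⟨hz.1, fun u v huv => h (hz.2 u v huv)⟩

/-- The even edge sets of `G`. -/
def cycleSpace [Fintype V] (G : SimpleGraph V) : Submodule (ZMod 2) (V → V → ZMod 2) :=
  chains G ⊓ LinearMap.ker boundary

lemma mem_cycleSpace [Fintype V] {G : SimpleGraph V} {z : V → V → ZMod 2} :
    z ∈ cycleSpace G ↔ z ∈ chains G ∧ ∀ u, ∑ v, z u v = 0 := by
  rw [cycleSpace, Submodule.mem_inf, LinearMap.mem_ker, funext_iff]
  rfl

lemma cycleSpace_mono [Fintype V] {G H : SimpleGraph V} (h : G ≤ H) :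
    cycleSpace G ≤ cycleSpace H :=
  inf_le_inf_right _ (chains_mono h)

/-- An element of the cycle space of `H` supported on `G`. -/
lemma mem_cycleSpace_of_supp [Fintype V] {G H : SimpleGraph V} {z : V → V → ZMod 2}
    (hz : z ∈ cycleSpace H) (h : ∀ u v, z u v ≠ 0 → G.Adj u v) : z ∈ cycleSpace G := by
  rw [mem_cycleSpace] at hz ⊢
  exact ⟨⟨hz.1.1, h⟩, hz.2⟩

lemma zmod2_ne_zero {a : ZMod 2} (h : a ≠ 0) : a = 1 := by
  revert h; revert a; decide

lemma zmod2_add_self (a : ZMod 2) : a + a = 0 := by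
  revert a; decide

lemma chain_add_self (z : V → V → ZMod 2) : z + z = 0 := by
  ext u v; exact zmod2_add_self _

lemma zmod2_sum_eq_card {ι : Type*} (s : Finset ι) (f : ι → ZMod 2) :
    ∑ i ∈ s, f i = ((#{i ∈ s | f i ≠ 0} : ℕ) : ZMod 2) := by
  rw [Finset.card_filter, Nat.cast_sum]
  refine Finset.sum_congr rfl fun i _ => ?_
  generalize f i = a
  revert a; decide

/-- In an even sum, a nonzero term is accompanied by another one. -/
lemma exists_ne_of_sum_eq_zero {ι : Type*} [Fintype ι] {f : ι → ZMod 2}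
    (h : ∑ i, f i = 0) {a : ι} (ha : f a ≠ 0) : ∃ b, b ≠ a ∧ f b ≠ 0 := by
  classical
  by_contra! hn
  rw [Finset.sum_eq_single a (fun b _ hb => hn b hb) (by simp)] at h
  exact ha h

open scoped Classical in
/-- The set consisting of the single edge `uv`. -/
noncomputable def edgeChain (u v : V) : V → V → ZMod 2 :=
  fun p q => if (p = u ∧ q = v) ∨ (p = v ∧ q = u) then 1 else 0

lemma edgeChain_ne_zero {u v p q : V} :
    edgeChain u v p q ≠ 0 ↔ (p = u ∧ q = v) ∨ (p = v ∧ q = u) := by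
  unfold edgeChain
  split_ifs with h <;> simp [h]

lemma edgeChain_mem_chains {G : SimpleGraph V} {u v : V} (h : G.Adj u v) :
    edgeChain u v ∈ chains G := by
  refine ⟨fun p q => ?_, fun p q hpq => ?_⟩
  · unfold edgeChain
    congr 1
    simp only [eq_iff_iff]
    tauto
  · rcases edgeChain_ne_zero.1 hpq with ⟨rfl, rfl⟩ | ⟨rfl, rfl⟩
    · exact h
    · exact h.symm

open scoped Classical in
lemma boundary_edgeChain [Fintype V] {u v : V} (h : u ≠ v) :
    boundary (edgeChain u v) = Pi.single u 1 + Pi.single v 1 := by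
  ext p
  rw [boundary_apply]
  by_cases hpu : p = u
  · subst hpu
    rw [Finset.sum_eq_single v] <;> simp +contextual [edgeChain, h]
  · by_cases hpv : p = v
    · subst hpv
      rw [Finset.sum_eq_single u] <;> simp +contextual [edgeChain, h, hpu]
    · rw [Finset.sum_eq_zero] <;> simp [edgeChain, hpu, hpv]

/-- The even set formed by the edges of the triangle `uvw`. -/
noncomputable def triChain (u v w : V) : V → V → ZMod 2 :=
  edgeChain u v + edgeChain v w + edgeChain w u

lemma triChain_mem [Fintype V] {G : SimpleGraph V} {u v w : V} (h₁ : G.Adj u v) (h₂ : G.Adj v w)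
    (h₃ : G.Adj w u) : triChain u v w ∈ cycleSpace G := by
  classical
  refine ⟨add_mem (add_mem (edgeChain_mem_chains h₁) (edgeChain_mem_chains h₂))
    (edgeChain_mem_chains h₃), ?_⟩
  simp only [SetLike.mem_coe, LinearMap.mem_ker, triChain, map_add, boundary_edgeChain h₁.ne,
    boundary_edgeChain h₂.ne, boundary_edgeChain h₃.ne]
  have key : ∀ a b c : ZMod 2, a + b + (b + c) + (c + a) = 0 := by decide
  ext p
  exact key _ _ _

lemma triChain_ne_zero {u v w p q : V} (h : triChain u v w p q ≠ 0) :
    edgeChain u v p q ≠ 0 ∨ edgeChain v w p q ≠ 0 ∨ edgeChain w u p q ≠ 0 := by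
  by_contra! hn
  exact h (by simp [triChain, hn])

/-! ### Cut formulation of connectedness and paths as chains -/

open scoped Classical in
/-- `S` cannot be split into two nonempty parts without edges of `G` between them. -/
def CutConn (G : SimpleGraph V) (S : Finset V) : Prop :=
  ∀ A ⊆ S, A.Nonempty → (S \ A).Nonempty → ∃ u ∈ A, ∃ w ∈ S \ A, G.Adj u w

open scoped Classical in
/-- A subset closed under adjacency is everything. -/
lemma CutConn.eq_of_closed {G : SimpleGraph V} {S : Finset V} (h : CutConn G S) (P : V → Prop)
    {a : V} (ha : a ∈ S) (hPa : P a) (hP : ∀ u ∈ S, ∀ w ∈ S, P u → G.Adj u w → P w) :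
    ∀ u ∈ S, P u := by
  by_contra! hn
  obtain ⟨b, hb, hPb⟩ := hn
  obtain ⟨u, hu, w, hw, huw⟩ := h (S.filter P) (Finset.filter_subset _ _)
    ⟨a, by simp [ha, hPa]⟩ ⟨b, by simp [hb, hPb]⟩
  simp only [Finset.mem_filter, Finset.mem_sdiff, not_and] at hu hw
  exact hw.2 hw.1 (hP u hu.1 w hw.1 hu.2 huw)

open scoped Classical in
lemma CutConn.exists_chain [Fintype V] {G : SimpleGraph V} {S : Finset V} (h : CutConn G S)
    {a b : V} (ha : a ∈ S) (hb : b ∈ S) :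
    ∃ p ∈ chains G, (∀ u v, p u v ≠ 0 → u ∈ S ∧ v ∈ S) ∧
      boundary p = Pi.single a 1 + Pi.single b 1 := by
  refine h.eq_of_closed (fun b => ∃ p ∈ chains G, (∀ u v, p u v ≠ 0 → u ∈ S ∧ v ∈ S) ∧
      boundary p = Pi.single a 1 + Pi.single b 1) ha ⟨0, zero_mem _, by simp, ?_⟩ ?_ b hb
  · ext p
    simp [zmod2_add_self]
  · rintro u hu w hw ⟨p, hp, hpS, hpb⟩ huw
    refine ⟨p + edgeChain u w, add_mem hp (edgeChain_mem_chains huw), fun s t hst => ?_, ?_⟩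
    · by_cases h0 : p s t = 0
      · rw [Pi.add_apply, Pi.add_apply, h0, zero_add] at hst
        rcases edgeChain_ne_zero.1 hst with ⟨rfl, rfl⟩ | ⟨rfl, rfl⟩
        · exact ⟨hu, hw⟩
        · exact ⟨hw, hu⟩
      · exact hpS s t h0
    · rw [map_add, hpb, boundary_edgeChain huw.ne]
      ext q
      simp only [Pi.add_apply]
      generalize (Pi.single u 1 : V → ZMod 2) q = x
      generalize (Pi.single a 1 : V → ZMod 2) q = y
      generalize (Pi.single w 1 : V → ZMod 2) q = z
      revert x y z; decide

/-! ### Generating families covering every edge at most twice -/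

/-- A family of even sets generating the cycle space and covering every edge at most twice. -/
structure TwoFold [Fintype V] (G : SimpleGraph V) {ι : Type} [Fintype ι]
    (f : ι → V → V → ZMod 2) : Prop where
  mem : ∀ i, f i ∈ cycleSpace G
  span : cycleSpace G ≤ Submodule.span (ZMod 2) (Set.range f)
  le_two : ∀ u v, #{i | f i u v ≠ 0} ≤ 2

/-- The cycle space has a generating family covering every edge at most twice. -/
def HasTwoFold [Fintype V] (G : SimpleGraph V) : Prop :=
  ∃ (ι : Type) (_ : Fintype ι) (f : ι → V → V → ZMod 2), TwoFold G f

lemma TwoFold.exists_coeff [Fintype V] {G : SimpleGraph V} {ι : Type} [Fintype ι]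
    {f : ι → V → V → ZMod 2} (h : TwoFold G f) {z : V → V → ZMod 2} (hz : z ∈ cycleSpace G) :
    ∃ c : ι → ZMod 2, ∑ i, c i • f i = z :=
  (Submodule.mem_span_range_iff_exists_fun _).1 (h.span hz)

/-- The family may be assumed to have sum zero. -/
lemma HasTwoFold.exists_sum_zero [Fintype V] {G : SimpleGraph V} (h : HasTwoFold G) :
    ∃ (ι : Type) (_ : Fintype ι) (f : ι → V → V → ZMod 2), TwoFold G f ∧ ∑ i, f i = 0 := by
  obtain ⟨ι, _, f, hf⟩ := h
  refine ⟨Option ι, inferInstance, fun o => o.elim (∑ i, f i) f, ⟨?_, ?_, ?_⟩, ?_⟩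
  · rintro (_ | i)
    · exact Submodule.sum_mem _ fun i _ => hf.mem i
    · exact hf.mem i
  · refine hf.span.trans (Submodule.span_mono ?_)
    rintro _ ⟨i, rfl⟩
    exact ⟨some i, rfl⟩
  · intro u v
    have h2 := hf.le_two u v
    have hs := zmod2_sum_eq_card Finset.univ (fun i => f i u v)
    have : #{o : Option ι | (o.elim (∑ i, f i) f : V → V → ZMod 2) u v ≠ 0}
        = (if (∑ i, f i u v) ≠ 0 then 1 else 0) + #{i | f i u v ≠ 0} := by
      rw [Finset.card_filter, Finset.card_filter, Fintype.sum_option]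
      congr 1
      simp [Finset.sum_apply]
    rw [this, hs]
    generalize #{i | f i u v ≠ 0} = k at h2
    interval_cases k <;> decide
  · rw [Fintype.sum_option]
    exact chain_add_self _

lemma card_ne_eq_zero_or_two {ι : Type} [Fintype ι] {f : ι → V → V → ZMod 2}
    (h2 : ∀ u v, #{i | f i u v ≠ 0} ≤ 2) (h0 : ∑ i, f i = 0) (u v : V) :
    #{i | f i u v ≠ 0} = 0 ∨ #{i | f i u v ≠ 0} = 2 := by
  have h2 := h2 u v
  have hs := zmod2_sum_eq_card Finset.univ (fun i => f i u v)
  have h0' : ∑ i, f i u v = 0 := by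
    have := congrFun (congrFun h0 u) v
    simpa [Finset.sum_apply] using this
  rw [h0'] at hs
  generalize #{i | f i u v ≠ 0} = k at h2 hs
  interval_cases k <;> first | exact absurd hs (by decide) | simp

/-- A prescribed pair may be assumed to be covered at most once. -/
lemma HasTwoFold.exists_le_one [Fintype V] {G : SimpleGraph V} (h : HasTwoFold G) (a b : V) :
    ∃ (ι : Type) (_ : Fintype ι) (f : ι → V → V → ZMod 2), TwoFold G f ∧
      #{i | f i a b ≠ 0} ≤ 1 := by
  classical
  obtain ⟨ι, _, f, hf, h0⟩ := h.exists_sum_zero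
  rcases card_ne_eq_zero_or_two hf.le_two h0 a b with hc | hc
  · exact ⟨ι, inferInstance, f, hf, by omega⟩
  obtain ⟨j, hj⟩ : Finset.Nonempty ({i | f i a b ≠ 0} : Finset ι) := by
    rw [← Finset.card_pos]; omega
  have key : ∀ u v, #{i : {i // i ≠ j} | f i u v ≠ 0} =
      #(({i | f i u v ≠ 0} : Finset ι).erase j) := by
    intro u v
    rw [← Finset.card_map (Function.Embedding.subtype _)]
    congr 1
    ext i
    simp [and_comm]
  refine ⟨{i // i ≠ j}, inferInstance, fun i => f i, ⟨fun i => hf.mem i, ?_, ?_⟩, ?_⟩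
  · refine hf.span.trans (Submodule.span_le.2 ?_)
    rintro _ ⟨i, rfl⟩
    by_cases hij : i = j
    · subst hij
      have : f i = ∑ k : {k // k ≠ i}, f k := by
        have e := h0
        rw [Fintype.sum_eq_add_sum_subtype_ne _ i] at e
        calc f i = f i + (f i + ∑ k : {k // k ≠ i}, f k) := by rw [e, add_zero]
          _ = _ := by rw [← add_assoc, chain_add_self, zero_add]
      rw [this]
      exact Submodule.sum_mem _ fun k _ => Submodule.subset_span ⟨k, rfl⟩
    · exact Submodule.subset_span ⟨⟨i, hij⟩, rfl⟩
  · intro u v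
    rw [key]
    exact (Finset.card_erase_le).trans (hf.le_two u v)
  · rw [key, Finset.card_erase_of_mem hj, hc]

/-- Deleting the edge `ab` preserves the property. -/
lemma HasTwoFold.of_delete [Fintype V] {G H : SimpleGraph V} (h : HasTwoFold G) (a b : V)
    (hab : ¬ H.Adj a b) (hHG : H ≤ G)
    (hGH : ∀ u v, G.Adj u v → H.Adj u v ∨ (u = a ∧ v = b) ∨ (u = b ∧ v = a)) :
    HasTwoFold H := by
  classical
  obtain ⟨ι, _, f, hf, h1⟩ := h.exists_le_one a b
  refine ⟨{i // f i a b = 0}, inferInstance, fun i => f i, ⟨?_, ?_, ?_⟩⟩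
  · rintro ⟨i, hi⟩
    refine mem_cycleSpace_of_supp (hf.mem i) fun u v huv => ?_
    rcases hGH u v ((mem_cycleSpace.1 (hf.mem i)).1.2 u v huv) with h | ⟨rfl, rfl⟩ | ⟨rfl, rfl⟩
    · exact h
    · exact absurd hi huv
    · exact absurd (((mem_cycleSpace.1 (hf.mem i)).1.1 _ _).trans hi) huv
  · intro z hz
    obtain ⟨c, rfl⟩ := hf.exists_coeff (cycleSpace_mono hHG hz)
    have hzab : ∑ i, c i * f i a b = 0 := by
      by_contra hne
      exact hab ((mem_cycleSpace.1 hz).1.2 a b (by simpa [Finset.sum_apply] using hne))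
    refine Submodule.sum_mem _ fun i _ => ?_
    by_cases hi : f i a b = 0
    · exact Submodule.smul_mem _ _ (Submodule.subset_span ⟨⟨i, hi⟩, rfl⟩)
    · rw [Finset.sum_eq_single i] at hzab
      · rw [(mul_eq_zero.1 hzab).resolve_right hi, zero_smul]
        exact zero_mem _
      · intro k _ hk
        by_contra hne
        have hk' : f k a b ≠ 0 := fun h0 => hne (by simp [h0])
        exact hk (Finset.card_le_one.1 h1 k (by simp [hk']) i (by simp [hi]))
      · simp
  · intro u v
    refine le_trans ?_ (hf.le_two u v)
    rw [← Finset.card_map (Function.Embedding.subtype _)]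
    refine Finset.card_le_card fun i => ?_
    simp
    tauto

lemma HasTwoFold.mono [Fintype V] {G H : SimpleGraph V} (h : HasTwoFold G) (hHG : H ≤ G) :
    HasTwoFold H := by
  classical
  induction hn : #{p : V × V | G.Adj p.1 p.2 ∧ ¬ H.Adj p.1 p.2} using Nat.strong_induction_on
    generalizing G with
  | _ n ih =>
    by_cases hGH : G ≤ H
    · rwa [le_antisymm hHG hGH]
    obtain ⟨a, b, hab, hab'⟩ : ∃ a b, G.Adj a b ∧ ¬ H.Adj a b := by
      by_contra! hn
      exact hGH fun u v huv => hn u v huv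
    have hHD : H ≤ G.deleteEdges {s(a, b)} := by
      intro u v huv
      rw [deleteEdges_adj]
      refine ⟨hHG huv, fun he => hab' ?_⟩
      rw [Set.mem_singleton_iff, Sym2.eq_iff] at he
      rcases he with ⟨rfl, rfl⟩ | ⟨rfl, rfl⟩
      exacts [huv, huv.symm]
    refine ih _ ?_ (h.of_delete (H := G.deleteEdges {s(a, b)}) a b (by simp)
      (deleteEdges_le _) fun u v huv => ?_) hHD rfl
    · rw [← hn]
      refine Finset.card_lt_card (Finset.ssubset_iff_of_subset ?_ |>.2 ⟨(a, b), ?_, ?_⟩)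
      · intro p
        simp only [Finset.mem_filter, Finset.mem_univ, true_and, deleteEdges_adj]
        tauto
      · simp [hab, hab']
      · simp
    · rw [deleteEdges_adj, Set.mem_singleton_iff, Sym2.eq_iff]
      tauto

/-! ### Minors obtained by contracting a connected set -/

lemma induce_connected_iff_closed {G : SimpleGraph V} {S : Set V} {a : V} (ha : a ∈ S) :
    (G.induce S).Connected ↔ ∀ P : V → Prop, P a →
      (∀ u ∈ S, ∀ w ∈ S, P u → G.Adj u w → P w) → ∀ u ∈ S, P u := by
  constructor
  · intro h P hPa hP u hu
    obtain ⟨p⟩ := h.preconnected ⟨a, ha⟩ ⟨u, hu⟩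
    suffices H : ∀ x y : S, (G.induce S).Walk x y → P x → P y from H _ _ p hPa
    intro x y p
    induction p with
    | nil => exact id
    | cons hadj _ ih => exact fun hx => ih (hP _ (Subtype.prop _) _ (Subtype.prop _) hx hadj)
  · intro h
    rw [connected_iff_exists_forall_reachable]
    refine ⟨⟨a, ha⟩, fun ⟨w, hw⟩ => ?_⟩
    obtain ⟨_, h'⟩ := h (fun u => ∃ hu : u ∈ S, (G.induce S).Reachable ⟨a, ha⟩ ⟨u, hu⟩) ⟨ha, .rfl⟩
      (fun u hu w hw ⟨_, hr⟩ huw => ⟨hw, hr.trans (Adj.reachable (by exact huw))⟩) w hw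
    exact h'

lemma HasMinor.of_contract {W : Type*} {K : SimpleGraph W} (hK : ∀ k, ∃ l, K.Adj k l)
    {G G' : SimpleGraph V} (T : Set V) (a : V) (ha : a ∈ T) (hT : (G.induce T).Connected)
    (h₁ : ∀ u w, G'.Adj u w → u ∈ T → u = a)
    (h₂ : ∀ u w, G'.Adj u w → u ≠ a → w ≠ a → G.Adj u w)
    (h₃ : ∀ w, G'.Adj a w → ∃ t ∈ T, G.Adj t w) (h : HasMinor G' K) : HasMinor G K := by
  obtain ⟨f, hf, hd, he⟩ := h
  have hactive : ∀ k, ∀ u ∈ f k, ∃ w, G'.Adj u w := by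
    intro k u hu
    by_contra! hno
    have hsing : ∀ w ∈ f k, w = u :=
      (induce_connected_iff_closed hu).1 (hf k).2 (fun w => w = u) rfl
        (fun x _ w _ hx hxw => absurd (hx ▸ hxw) (hno w))
    obtain ⟨l, hl⟩ := hK k
    obtain ⟨v₁, hv₁, v₂, _, hv⟩ := he k l hl
    exact hno v₂ (hsing v₁ hv₁ ▸ hv)
  have hTf : ∀ k, ∀ u ∈ f k, u ∈ T → u = a := fun k u hu hut =>
    let ⟨w, hw⟩ := hactive k u hu
    h₁ u w hw hut
  refine ⟨fun k => f k ∪ {t | t ∈ T ∧ a ∈ f k}, fun k => ?_, fun k l hkl => ?_, fun k l hkl => ?_⟩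
  · obtain ⟨⟨b, hb⟩, hc⟩ := hf k
    refine ⟨⟨b, Or.inl hb⟩, ?_⟩
    by_cases hak : a ∈ f k
    · rw [induce_connected_iff_closed (a := a) (Or.inl hak)]
      intro P hPa hP
      have hPT : ∀ t ∈ T, P t := (induce_connected_iff_closed ha).1 hT P hPa
        fun u hu w hw => hP u (Or.inr ⟨hu, hak⟩) w (Or.inr ⟨hw, hak⟩)
      have hPf : ∀ t ∈ f k, P t := by
        refine (induce_connected_iff_closed hak).1 hc P hPa fun u hu w hw hPu huw => ?_
        by_cases hwa : w = a
        · exact hwa ▸ hPa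
        by_cases hua : u = a
        · subst hua
          obtain ⟨t, ht, htw⟩ := h₃ w huw
          exact hP t (Or.inr ⟨ht, hak⟩) w (Or.inl hw) (hPT t ht) htw
        · exact hP u (Or.inl hu) w (Or.inl hw) hPu (h₂ u w huw hua hwa)
      rintro u (hu | hu)
      exacts [hPf u hu, hPT u hu.1]
    · rw [induce_connected_iff_closed (a := b) (Or.inl hb)]
      intro P hPb hP
      have hPf : ∀ t ∈ f k, P t := by
        refine (induce_connected_iff_closed hb).1 hc P hPb fun u hu w hw hPu huw => ?_
        exact hP u (Or.inl hu) w (Or.inl hw) hPu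
          (h₂ u w huw (fun h => hak (h ▸ hu)) (fun h => hak (h ▸ hw)))
      rintro u (hu | hu)
      exacts [hPf u hu, absurd hu.2 hak]
  · rw [Set.disjoint_left]
    have hdis := Set.disjoint_left.1 (hd k l hkl)
    rintro u (hu | ⟨hu, hak⟩) (hu' | ⟨hu', hal⟩)
    · exact hdis hu hu'
    · exact hdis hu (hTf k u hu hu' ▸ hal)
    · exact hdis (hTf l u hu' hu ▸ hak) hu'
    · exact hdis hak hal
  · obtain ⟨v₁, hv₁, v₂, hv₂, hv⟩ := he k l hkl
    by_cases h1 : v₁ = a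
    · subst h1
      obtain ⟨t, ht, htw⟩ := h₃ v₂ hv
      exact ⟨t, Or.inr ⟨ht, hv₁⟩, v₂, Or.inl hv₂, htw⟩
    by_cases h2 : v₂ = a
    · subst h2
      obtain ⟨t, ht, htw⟩ := h₃ v₁ hv.symm
      exact ⟨v₁, Or.inl hv₁, t, Or.inr ⟨ht, hv₂⟩, htw.symm⟩
    · exact ⟨v₁, Or.inl hv₁, v₂, Or.inl hv₂, h₂ v₁ v₂ hv h1 h2⟩

lemma IsPlanar.of_contract {G G' : SimpleGraph V} (h : IsPlanar G) (T : Set V) (a : V)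
    (ha : a ∈ T) (hT : (G.induce T).Connected)
    (h₁ : ∀ u w, G'.Adj u w → u ∈ T → u = a)
    (h₂ : ∀ u w, G'.Adj u w → u ≠ a → w ≠ a → G.Adj u w)
    (h₃ : ∀ w, G'.Adj a w → ∃ t ∈ T, G.Adj t w) : IsPlanar G' := by
  refine ⟨fun hm => h.1 (hm.of_contract ?_ T a ha hT h₁ h₂ h₃),
    fun hm => h.2 (hm.of_contract ?_ T a ha hT h₁ h₂ h₃)⟩
  · intro k
    exact ⟨k + 1, by simp⟩
  · rintro (k | k)
    exacts [⟨Sum.inr 0, by simp⟩, ⟨Sum.inl 0, by simp⟩]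

lemma IsPlanar.mono {G G' : SimpleGraph V} (h : IsPlanar G) (hG : G' ≤ G) : IsPlanar G' := by
  by_cases hV : Nonempty V
  · obtain ⟨a⟩ := hV
    refine h.of_contract {a} a rfl ?_ (fun u w _ hu => hu) (fun u w huw _ _ => hG huw)
      (fun w hw => ⟨a, rfl, hG hw⟩)
    rw [induce_connected_iff_closed (Set.mem_singleton a)]
    rintro P hPa - u rfl
    exact hPa
  · have : G' = G := by
      ext u
      exact absurd ⟨u⟩ hV
    exact this ▸ h

/-! ### Separations of order at most two -/

lemma sum_symm_eq_zero {z : V → V → ZMod 2} (hs : ∀ u v, z u v = z v u) (hd : ∀ u, z u u = 0)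
    (S : Finset V) : ∑ u ∈ S, ∑ v ∈ S, z u v = 0 := by
  rw [← Finset.sum_product']
  refine Finset.sum_involution (fun p _ => (p.2, p.1)) ?_ ?_ ?_ ?_
  · intro p _
    rw [hs p.2 p.1]
    exact zmod2_add_self _
  · rintro ⟨p, q⟩ _ h heq
    simp only [Prod.mk.injEq] at heq
    exact h (heq.1 ▸ hd q)
  · intro p hp
    simpa [and_comm] using hp
  · intro p _
    rfl

lemma chain_diag {G : SimpleGraph V} {z : V → V → ZMod 2} (hz : z ∈ chains G) (u : V) :
    z u u = 0 := by
  by_contra h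
  exact G.loopless.irrefl u (hz.2 u u h)

lemma TwoFold.sum_of_decomp [Fintype V] {G G₁ G₂ : SimpleGraph V} {ι κ : Type} [Fintype ι]
    [Fintype κ] {f : ι → V → V → ZMod 2} {g : κ → V → V → ZMod 2} (hf : TwoFold G₁ f)
    (hg : TwoFold G₂ g) (h₁ : G₁ ≤ G) (h₂ : G₂ ≤ G)
    (hdec : ∀ z ∈ cycleSpace G, ∃ z₂ ∈ cycleSpace G₂, z - z₂ ∈ cycleSpace G₁)
    (hcov : ∀ u v, #{i | f i u v ≠ 0} + #{j | g j u v ≠ 0} ≤ 2) : HasTwoFold G := by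
  refine ⟨ι ⊕ κ, inferInstance, Sum.elim f g, ⟨?_, ?_, ?_⟩⟩
  · rintro (i | j)
    exacts [cycleSpace_mono h₁ (hf.mem i), cycleSpace_mono h₂ (hg.mem j)]
  · intro z hz
    obtain ⟨z₂, hz₂, hz₁⟩ := hdec z hz
    rw [← sub_add_cancel z z₂]
    refine add_mem (Submodule.span_mono ?_ (hf.span hz₁)) (Submodule.span_mono ?_ (hg.span hz₂))
    · rintro _ ⟨i, rfl⟩
      exact ⟨Sum.inl i, rfl⟩
    · rintro _ ⟨i, rfl⟩
      exact ⟨Sum.inr i, rfl⟩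
  · intro u v
    refine le_trans (le_of_eq ?_) (hcov u v)
    simp only [Finset.card_filter, Fintype.sum_sum_type, Sum.elim_inl, Sum.elim_inr]
    congr!

lemma TwoFold.card_eq_zero [Fintype V] {G : SimpleGraph V} {ι : Type} [Fintype ι]
    {f : ι → V → V → ZMod 2} (hf : TwoFold G f) {u v : V} (h : ¬ G.Adj u v) :
    #{i | f i u v ≠ 0} = 0 := by
  rw [Finset.card_eq_zero, Finset.filter_eq_empty_iff]
  intro i _ hi
  exact h ((mem_cycleSpace.1 (hf.mem i)).1.2 u v hi)

/-- The edges of `G` that avoid `B`. -/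
def avoidGraph (G : SimpleGraph V) (B : Finset V) : SimpleGraph V where
  Adj u v := G.Adj u v ∧ u ∉ B ∧ v ∉ B
  symm := ⟨fun _ _ h => ⟨h.1.symm, h.2.2, h.2.1⟩⟩
  loopless := ⟨fun u h => G.loopless.irrefl u h.1⟩

/-- The edges of `G` that meet `B`. -/
def meetGraph (G : SimpleGraph V) (B : Finset V) : SimpleGraph V where
  Adj u v := G.Adj u v ∧ (u ∈ B ∨ v ∈ B)
  symm := ⟨fun _ _ h => ⟨h.1.symm, h.2.symm⟩⟩
  loopless := ⟨fun u h => G.loopless.irrefl u h.1⟩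

open scoped Classical in
/-- The part of a chain that meets `B`. -/
noncomputable def meetPart (B : Finset V) (z : V → V → ZMod 2) : V → V → ZMod 2 :=
  fun u v => if u ∈ B ∨ v ∈ B then z u v else 0

lemma meetPart_mem {G : SimpleGraph V} {B : Finset V} {z : V → V → ZMod 2} (hz : z ∈ chains G) :
    meetPart B z ∈ chains (meetGraph G B) := by
  refine ⟨fun u v => ?_, fun u v h => ?_⟩
  · unfold meetPart
    rw [hz.1 u v]
    by_cases h1 : u ∈ B <;> by_cases h2 : v ∈ B <;> simp [h1, h2]
  · unfold meetPart at h
    split_ifs at h with hB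
    · exact ⟨hz.2 u v h, hB⟩
    · exact absurd rfl h

lemma sub_meetPart_mem {G : SimpleGraph V} {B : Finset V} {z : V → V → ZMod 2}
    (hz : z ∈ chains G) : z - meetPart B z ∈ chains (avoidGraph G B) := by
  have hm := meetPart_mem (B := B) hz
  refine ⟨fun u v => by simp [hz.1 u v, hm.1 u v], fun u v h => ?_⟩
  simp only [Pi.sub_apply, meetPart] at h
  split_ifs at h with hB
  · simp at h
  · rw [sub_zero] at h
    exact ⟨hz.2 u v h, not_or.1 hB⟩

/-- A separation of order at most two, with separator `{a, b}` and sides `A` and `B`. -/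
structure Separation (G : SimpleGraph V) (U : Finset V) (a b : V) (A B : Finset V) : Prop where
  supp : ∀ u w, G.Adj u w → u ∈ U
  cover : ∀ u ∈ U, u ∈ A ∨ u ∈ B ∨ u = a ∨ u = b
  ne : a ≠ b
  disj : ∀ u ∈ A, u ∉ B
  aA : a ∉ A
  bA : b ∉ A
  aB : a ∉ B
  bB : b ∉ B
  no_edge : ∀ u ∈ A, ∀ w ∈ B, ¬ G.Adj u w

lemma Separation.symm {G : SimpleGraph V} {U : Finset V} {a b : V} {A B : Finset V}
    (h : Separation G U a b A B) : Separation G U a b B A where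
  supp := h.supp
  cover u hu := by have := h.cover u hu; tauto
  ne := h.ne
  disj u hu hu' := h.disj u hu' hu
  aA := h.aB
  bA := h.bB
  aB := h.aA
  bB := h.bA
  no_edge u hu w hw huw := h.no_edge w hw u hu huw.symm

/-- The boundary of the part of an even set on one side of a separation. -/
lemma Separation.boundary_meetPart [Fintype V] {G : SimpleGraph V} {U : Finset V} {a b : V}
    {A B : Finset V} (h : Separation G U a b A B) {z : V → V → ZMod 2}
    (hz : z ∈ cycleSpace G) :
    (∀ u, u ≠ a → u ≠ b → ∑ v, meetPart B z u v = 0) ∧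
      ∑ v, meetPart B z a v = ∑ v, meetPart B z b v := by
  classical
  have hz' := mem_cycleSpace.1 hz
  have hm := meetPart_mem (B := B) hz'.1
  have h1 : ∀ u, u ≠ a → u ≠ b → ∑ v, meetPart B z u v = 0 := by
    intro u hua hub
    by_cases huB : u ∈ B
    · simpa [meetPart, huB] using hz'.2 u
    · refine Finset.sum_eq_zero fun v _ => ?_
      by_contra hne
      have hadj := hm.2 u v hne
      have hvB : v ∈ B := hadj.2.resolve_left huB
      have huA : u ∈ A := by
        have := h.cover u (h.supp u v hadj.1)
        tauto
      exact h.no_edge u huA v hvB hadj.1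
  refine ⟨h1, ?_⟩
  have htot := sum_symm_eq_zero hm.1 (chain_diag hm) Finset.univ
  rw [← Finset.add_sum_erase _ _ (Finset.mem_univ a),
    ← Finset.add_sum_erase _ _ (Finset.mem_erase.2 ⟨h.ne.symm, Finset.mem_univ b⟩),
    Finset.sum_eq_zero (fun u hu => h1 u (by simp at hu; tauto) (by simp at hu; tauto)),
    add_zero] at htot
  generalize ∑ v, meetPart B z a v = x at htot ⊢
  generalize ∑ v, meetPart B z b v = y at htot ⊢
  revert x y; decide

/-- Either the sides can be linked through `B`, or even sets split along the separation. -/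
lemma Separation.linked_or [Fintype V] {G : SimpleGraph V} {U : Finset V} {a b : V}
    {A B : Finset V} (h : Separation G U a b A B) :
    (∃ T : Set V, a ∈ T ∧ (∀ t ∈ T, t = a ∨ t ∈ B) ∧ (G.induce T).Connected ∧
      ∃ t ∈ T, G.Adj t b) ∨
    ∀ z ∈ cycleSpace G, meetPart B z ∈ cycleSpace (meetGraph G B) := by
  classical
  let T : Set V := {t | ∀ P : V → Prop, P a → (∀ u w, (u = a ∨ u ∈ B) → w ∈ B → P u →
    G.Adj u w → P w) → P t}
  have haT : a ∈ T := fun P hP _ => hP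
  have hTB : ∀ t ∈ T, t = a ∨ t ∈ B := fun t ht =>
    ht (fun w => w = a ∨ w ∈ B) (Or.inl rfl) fun u w _ hw _ _ => Or.inr hw
  have hTcl : ∀ u ∈ T, ∀ w ∈ B, G.Adj u w → w ∈ T := fun u hu w hw huw P hPa hP =>
    hP u w (hTB u hu) hw (hu P hPa hP) huw
  have hTconn : (G.induce T).Connected := by
    rw [induce_connected_iff_closed haT]
    intro P hPa hP u hu
    refine (hu (fun u => u ∈ T ∧ P u) ⟨haT, hPa⟩ fun x w _ hw hx hxw => ?_).2
    have hwT := hTcl x hx.1 w hw hxw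
    exact ⟨hwT, hP x hx.1 w hwT hx.2 hxw⟩
  by_cases hlink : ∃ t ∈ T, t ≠ a ∧ G.Adj t b
  · obtain ⟨t, ht, _, htb⟩ := hlink
    exact Or.inl ⟨T, haT, hTB, hTconn, t, ht, htb⟩
  push Not at hlink
  refine Or.inr fun z hz => ?_
  have hz' := mem_cycleSpace.1 hz
  have hm := meetPart_mem (B := B) hz'.1
  obtain ⟨h1, h2⟩ := h.boundary_meetPart hz
  have ha0 : ∑ v, meetPart B z a v = 0 := by
    have e1 : ∑ u ∈ Finset.univ.filter (· ∈ T), ∑ v, meetPart B z u v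
        = ∑ v, meetPart B z a v := by
      refine Finset.sum_eq_single a (fun u hu hua => h1 u hua fun hub => ?_) (by simp [haT])
      have := hTB u (by simpa using hu)
      rw [hub] at this
      exact this.elim h.ne.symm h.bB
    rw [← e1, ← sum_symm_eq_zero hm.1 (chain_diag hm) (Finset.univ.filter (· ∈ T))]
    refine Finset.sum_congr rfl fun u hu => (Finset.sum_subset (Finset.subset_univ _) ?_).symm
    intro v _ hv
    simp only [Finset.mem_filter, Finset.mem_univ, true_and] at hu hv
    by_contra hne
    obtain ⟨huv, hB⟩ := hm.2 u v hne
    have hvB : v ∉ B := fun hvB => hv (hTcl u hu v hvB huv)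
    have huB : u ∈ B := hB.resolve_right hvB
    rcases h.cover v (h.supp v u huv.symm) with hvA | hvB' | rfl | rfl
    · exact h.no_edge v hvA u huB huv.symm
    · exact hvB hvB'
    · exact hv haT
    · exact hlink u hu (fun e => h.aB (e ▸ huB)) huv
  refine mem_cycleSpace.2 ⟨hm, fun u => ?_⟩
  by_cases hua : u = a
  · exact hua ▸ ha0
  by_cases hub : u = b
  · exact hub ▸ (h2 ▸ ha0)
  · exact h1 u hua hub

/-- Even sets split along the separation. -/
lemma Separation.hasTwoFold_of_split [Fintype V] {G : SimpleGraph V} {U : Finset V} {a b : V}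
    {A B : Finset V} (h : Separation G U a b A B) (hA : ∃ u ∈ A, u ∈ U) (hB : ∃ u ∈ B, u ∈ U)
    (hG : IsPlanar G)
    (ih : ∀ (U' : Finset V) (G' : SimpleGraph V), U' ⊂ U → (∀ u w, G'.Adj u w → u ∈ U') →
      IsPlanar G' → HasTwoFold G')
    (hsplit : ∀ z ∈ cycleSpace G, meetPart B z ∈ cycleSpace (meetGraph G B)) :
    HasTwoFold G := by
  classical
  have h1 : avoidGraph G B ≤ G := fun _ _ h => h.1
  have h2 : meetGraph G B ≤ G := fun _ _ h => h.1
  obtain ⟨ι, _, f, hf⟩ := ih (U \ B) (avoidGraph G B)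
    (Finset.sdiff_subset.ssubset_of_ne fun e => by
      obtain ⟨u, hu, huU⟩ := hB
      rw [← e] at huU
      exact (Finset.mem_sdiff.1 huU).2 hu)
    (fun u w huw => Finset.mem_sdiff.2 ⟨h.supp u w huw.1, huw.2.1⟩) (hG.mono h1)
  obtain ⟨κ, _, g, hg⟩ := ih (U \ A) (meetGraph G B)
    (Finset.sdiff_subset.ssubset_of_ne fun e => by
      obtain ⟨u, hu, huU⟩ := hA
      rw [← e] at huU
      exact (Finset.mem_sdiff.1 huU).2 hu)
    (fun u w huw => Finset.mem_sdiff.2 ⟨h.supp u w huw.1, fun hu =>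
      huw.2.elim (h.disj u hu) fun hw => h.no_edge u hu w hw huw.1⟩) (hG.mono h2)
  refine hf.sum_of_decomp hg h1 h2 (fun z hz => ⟨meetPart B z, hsplit z hz, ?_⟩) fun u v => ?_
  · have hz' := mem_cycleSpace.1 (sub_mem hz (cycleSpace_mono h2 (hsplit z hz)))
    exact mem_cycleSpace.2 ⟨sub_meetPart_mem (mem_cycleSpace.1 hz).1, hz'.2⟩
  · by_cases huv : u ∈ B ∨ v ∈ B
    · rw [hf.card_eq_zero (u := u) (v := v) fun hadj => huv.elim hadj.2.1 hadj.2.2, zero_add]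
      exact hg.le_two u v
    · rw [hg.card_eq_zero (u := u) (v := v) fun hadj => huv hadj.2, add_zero]
      exact hf.le_two u v

/-- Replacing one side of a separation by an edge is a contraction. -/
lemma IsPlanar.of_linked {G : SimpleGraph V} (hG : IsPlanar G) {a b : V} {B : Finset V}
    (haB : a ∉ B) (hT : ∃ T : Set V, a ∈ T ∧ (∀ t ∈ T, t = a ∨ t ∈ B) ∧
      (G.induce T).Connected ∧ ∃ t ∈ T, G.Adj t b) :
    IsPlanar (avoidGraph (G ⊔ edge a b) B) := by
  obtain ⟨T, haT, hTB, hTc, t, ht, htb⟩ := hT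
  refine hG.of_contract T a haT hTc (fun u w huw hu => (hTB u hu).resolve_right huw.2.1) ?_ ?_
  · rintro u w ⟨huw | huw, _⟩ hu hw
    · exact huw
    · rw [edge_adj] at huw
      tauto
  · rintro w ⟨haw | haw, _⟩
    · exact ⟨a, haT, haw⟩
    · rw [edge_adj] at haw
      rcases haw with ⟨⟨_, rfl⟩ | ⟨_, rfl⟩, hne⟩
      · exact ⟨t, ht, htb⟩
      · exact absurd rfl hne

lemma Separation.sup_edge {G : SimpleGraph V} {U : Finset V} {a b : V} {A B : Finset V}
    (h : Separation G U a b A B) (ha : a ∈ U) (hb : b ∈ U) :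
    Separation (G ⊔ edge a b) U a b A B where
  supp u w huw := by
    rcases huw with huw | huw
    · exact h.supp u w huw
    · rw [edge_adj] at huw
      rcases huw with ⟨⟨rfl, _⟩ | ⟨rfl, _⟩, _⟩ <;> assumption
  cover := h.cover
  ne := h.ne
  disj := h.disj
  aA := h.aA
  bA := h.bA
  aB := h.aB
  bB := h.bB
  no_edge u hu w hw huw := by
    rcases huw with huw | huw
    · exact h.no_edge u hu w hw huw
    · rw [edge_adj] at huw
      rcases huw with ⟨⟨rfl, _⟩ | ⟨rfl, _⟩, _⟩
      exacts [h.aA hu, h.bA hu]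

/-- Generating families of the two sides of a separation whose separator is an edge can be
combined. -/
lemma Separation.hasTwoFold_of_adj [Fintype V] {G : SimpleGraph V} {U : Finset V} {a b : V}
    {A B : Finset V} (h : Separation G U a b A B) (hab : G.Adj a b)
    (hA : HasTwoFold (avoidGraph G A)) (hB : HasTwoFold (avoidGraph G B)) : HasTwoFold G := by
  classical
  have h1 : avoidGraph G B ≤ G := fun _ _ h => h.1
  have h2 : avoidGraph G A ≤ G := fun _ _ h => h.1
  obtain ⟨ι, _, f, hf, hf1⟩ := hB.exists_le_one a b
  obtain ⟨κ, _, g, hg, hg1⟩ := hA.exists_le_one a b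
  have hsymm : ∀ {ι : Type} [Fintype ι] {H : SimpleGraph V} {f : ι → V → V → ZMod 2},
      TwoFold H f → #{i | f i b a ≠ 0} = #{i | f i a b ≠ 0} := by
    intro ι _ H f hf
    congr 1
    ext i
    rw [Finset.mem_filter, Finset.mem_filter, (mem_cycleSpace.1 (hf.mem i)).1.1 b a]
  refine hf.sum_of_decomp hg h1 h2 (fun z hz => ?_) fun u v => ?_
  · set ε := ∑ v, meetPart B z a v with hε
    obtain ⟨hz1, hz2⟩ := h.boundary_meetPart hz
    have hzc := (mem_cycleSpace.1 hz).1
    have hmem : meetPart B z + ε • edgeChain a b ∈ cycleSpace (avoidGraph G A) := by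
      refine ⟨add_mem (chains_mono ?_ (meetPart_mem hzc)) (Submodule.smul_mem _ _
        (edgeChain_mem_chains ⟨hab, h.aA, h.bA⟩)), ?_⟩
      · rintro u w ⟨huw, hu | hw⟩
        · exact ⟨huw, fun hu' => h.disj u hu' hu, fun hw => h.no_edge w hw u hu huw.symm⟩
        · exact ⟨huw, fun hu => h.no_edge u hu w hw huw, fun hw' => h.disj w hw' hw⟩
      · simp only [SetLike.mem_coe, LinearMap.mem_ker, map_add, map_smul,
          boundary_edgeChain h.ne]
        ext u
        simp only [Pi.add_apply, boundary_apply, Pi.smul_apply, smul_eq_mul, Pi.zero_apply]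
        by_cases hua : u = a
        · subst hua
          simp [h.ne, ← hε, zmod2_add_self]
        by_cases hub : u = b
        · subst hub
          simp [h.ne.symm, ← hz2, ← hε, zmod2_add_self]
        · simp [hua, hub, hz1 u hua hub]
    refine ⟨_, hmem, mem_cycleSpace.2 ⟨?_, (mem_cycleSpace.1
      (sub_mem hz (cycleSpace_mono h2 hmem))).2⟩⟩
    rw [← sub_sub]
    exact sub_mem (sub_meetPart_mem hzc) (Submodule.smul_mem _ _
        (edgeChain_mem_chains ⟨hab, h.aB, h.bB⟩))
  · by_cases huv1 : (avoidGraph G B).Adj u v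
    · by_cases huv2 : (avoidGraph G A).Adj u v
      · have hu := h.cover u (h.supp u v huv1.1)
        have hv := h.cover v (h.supp v u huv1.1.symm)
        have hne := huv1.1.ne
        have hpair : u = a ∧ v = b ∨ u = b ∧ v = a := by
          have h3 := huv1.2
          have h4 := huv2.2
          grind
        rcases hpair with ⟨rfl, rfl⟩ | ⟨rfl, rfl⟩
        · omega
        · rw [hsymm hf, hsymm hg]
          omega
      · rw [hg.card_eq_zero huv2, add_zero]
        exact hf.le_two u v
    · rw [hf.card_eq_zero huv1, zero_add]
      exact hg.le_two u v

/-- The inductive step at a separation of order two. -/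
lemma Separation.hasTwoFold [Fintype V] {G : SimpleGraph V} {U : Finset V} {a b : V}
    {A B : Finset V} (h : Separation G U a b A B) (ha : a ∈ U) (hb : b ∈ U)
    (hA : ∃ u ∈ A, u ∈ U) (hB : ∃ u ∈ B, u ∈ U) (hG : IsPlanar G)
    (ih : ∀ (U' : Finset V) (G' : SimpleGraph V), U' ⊂ U → (∀ u w, G'.Adj u w → u ∈ U') →
      IsPlanar G' → HasTwoFold G') :
    HasTwoFold G := by
  classical
  rcases h.linked_or with hTB | hTB
  swap
  · exact h.hasTwoFold_of_split hA hB hG ih hTB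
  rcases h.symm.linked_or with hTA | hTA
  swap
  · exact h.symm.hasTwoFold_of_split hB hA hG ih hTA
  have h' := h.sup_edge ha hb
  have key : ∀ A : Finset V, (∃ u ∈ A, u ∈ U) → IsPlanar (avoidGraph (G ⊔ edge a b) A) →
      HasTwoFold (avoidGraph (G ⊔ edge a b) A) := fun A ⟨u, hu, huU⟩ hp =>
    ih (U \ A) _ (Finset.sdiff_subset.ssubset_of_ne fun e => by
      rw [← e] at huU
      exact (Finset.mem_sdiff.1 huU).2 hu)
    (fun u w huw => Finset.mem_sdiff.2 ⟨h'.supp u w huw.1, huw.2.1⟩) hp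
  exact (h'.hasTwoFold_of_adj (Or.inr ((edge_adj ..).2 ⟨Or.inl ⟨rfl, rfl⟩, h.ne⟩))
    (key A hA (hG.of_linked h.aA hTA)) (key B hB (hG.of_linked h.aB hTB))).mono le_sup_left

/-- Either the induction step applies, or removing two vertices does not disconnect. -/
lemma cutConn_or_hasTwoFold [Fintype V] [DecidableEq V] {G : SimpleGraph V} {U : Finset V}
    (hU : ∀ u w, G.Adj u w → u ∈ U) (hG : IsPlanar G)
    (ih : ∀ (U' : Finset V) (G' : SimpleGraph V), U' ⊂ U → (∀ u w, G'.Adj u w → u ∈ U') →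
      IsPlanar G' → HasTwoFold G') :
    HasTwoFold G ∨ ∀ a ∈ U, ∀ b ∈ U, a ≠ b → CutConn G (U \ {a, b}) := by
  refine or_iff_not_imp_left.2 fun hno a ha b hb hab A hA hA0 hB0 => ?_
  by_contra! hcut
  refine hno (Separation.hasTwoFold (a := a) (b := b) (A := A) (B := (U \ {a, b}) \ A)
    ⟨hU, ?_, hab, ?_, ?_, ?_, ?_, ?_, ?_⟩ ha hb ?_ ?_ hG ih)
  · intro u hu
    simp only [Finset.mem_sdiff, Finset.mem_insert, Finset.mem_singleton]
    tauto
  · simp +contextual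
  · exact fun h => by simpa using hA h
  · exact fun h => by simpa using hA h
  · simp
  · simp
  · intro u hu w hw
    exact hcut u hu w (by convert hw)
  · obtain ⟨u, hu⟩ := hA0
    exact ⟨u, hu, (Finset.mem_sdiff.1 (hA hu)).1⟩
  · obtain ⟨u, hu⟩ := hB0
    refine ⟨u, by convert hu, ?_⟩
    simp only [Finset.mem_sdiff] at hu
    exact hu.1.1

/-! ### Graphs on at most four vertices -/

lemma chain_symm_ne {G : SimpleGraph V} {z : V → V → ZMod 2} (hz : z ∈ chains G) {u v : V}
    (h : z u v ≠ 0) : z v u ≠ 0 := by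
  rwa [hz.1 v u]

/-- An even set all of whose edges contain `a` is empty. -/
lemma eq_zero_of_apex [Fintype V] {G : SimpleGraph V} {z : V → V → ZMod 2} (hz : z ∈ cycleSpace G)
    (a : V) (h : ∀ u v, u ≠ a → v ≠ a → z u v = 0) : z = 0 := by
  obtain ⟨hc, hb⟩ := mem_cycleSpace.1 hz
  have key : ∀ u, u ≠ a → z u a = 0 := fun u hu => by
    rw [← hb u, Finset.sum_eq_single a (fun v _ hv => h u v hu hv) (by simp)]
  ext u v
  by_cases hu : u = a
  · by_cases hv : v = a
    · rw [hu, hv]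
      exact chain_diag hc a
    · rw [hu, hc.1 a v]
      exact key v hv
  · by_cases hv : v = a
    · exact hv ▸ key u hu
    · exact h u v hu hv

lemma HasTwoFold.of_card_le_two [Fintype V] {G : SimpleGraph V} {U : Finset V}
    (hU : ∀ u w, G.Adj u w → u ∈ U) (hc : #U ≤ 2) : HasTwoFold G := by
  classical
  refine ⟨Empty, inferInstance, fun i => i.elim, ⟨fun i => i.elim, fun z hz => ?_, by simp⟩⟩
  obtain ⟨hzc, hb⟩ := mem_cycleSpace.1 hz
  suffices z = 0 by simp [this]
  ext u v
  by_contra hne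
  obtain ⟨w, hw, hne'⟩ := exists_ne_of_sum_eq_zero (hb u) hne
  have h1 := hzc.2 u v hne
  have h2 := hzc.2 u w hne'
  have h3 : #{u, v, w} = 3 := Finset.card_eq_three.2 ⟨u, v, w, h1.ne, h2.ne, hw.symm, rfl⟩
  have : ({u, v, w} : Finset V) ⊆ U := by
    intro x hx
    simp only [Finset.mem_insert, Finset.mem_singleton] at hx
    rcases hx with rfl | rfl | rfl
    exacts [hU _ _ h1, hU _ _ h1.symm, hU _ _ h2.symm]
  have := Finset.card_le_card this
  omega

/-- The complete graph on a set of vertices. -/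
def cliqueOn (U : Finset V) : SimpleGraph V where
  Adj u v := u ≠ v ∧ u ∈ U ∧ v ∈ U
  symm := ⟨fun _ _ h => ⟨h.1.symm, h.2.2, h.2.1⟩⟩
  loopless := ⟨fun _ h => h.1 rfl⟩

lemma HasTwoFold.of_card_eq_three [Fintype V] {G : SimpleGraph V} {U : Finset V}
    (hU : ∀ u w, G.Adj u w → u ∈ U) (hc : #U = 3) : HasTwoFold G := by
  classical
  obtain ⟨a, b, c, hab, hac, hbc, rfl⟩ := Finset.card_eq_three.1 hc
  refine HasTwoFold.mono (G := cliqueOn {a, b, c}) ?_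
    fun u v huv => ⟨huv.ne, hU u v huv, hU v u huv.symm⟩
  have ht : triChain a b c ∈ cycleSpace (cliqueOn {a, b, c}) :=
    triChain_mem ⟨hab, by simp⟩ ⟨hbc, by simp⟩ ⟨hac.symm, by simp⟩
  refine ⟨Unit, inferInstance, fun _ => triChain a b c, ⟨fun _ => ht, fun z hz => ?_, ?_⟩⟩
  · have h0 : z - z b c • triChain a b c = 0 := by
      refine eq_zero_of_apex (sub_mem hz (Submodule.smul_mem _ _ ht)) a fun u v hu hv => ?_
      obtain ⟨hzc, -⟩ := mem_cycleSpace.1 hz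
      by_cases huv : u ∈ ({a, b, c} : Finset V) ∧ v ∈ ({a, b, c} : Finset V) ∧ u ≠ v
      · simp only [Finset.mem_insert, Finset.mem_singleton] at huv
        obtain ⟨rfl | rfl | rfl, rfl | rfl | rfl, hne⟩ := huv <;> try contradiction
        · simp [triChain, edgeChain, hu, hv, hne, hne.symm]
        · simp [triChain, edgeChain, hu, hv, hne, hne.symm, hzc.1 u v]
      · refine not_not.1 fun hne => huv ?_
        have := (mem_cycleSpace.1 (sub_mem hz (Submodule.smul_mem _ _ ht))).1.2 u v hne
        exact ⟨this.2.1, this.2.2, this.1⟩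
    rw [sub_eq_zero.1 h0]
    exact Submodule.smul_mem _ _ (Submodule.subset_span ⟨(), rfl⟩)
  · intro u v
    exact (Finset.card_le_univ _).trans (by simp)

lemma HasTwoFold.of_card_eq_four [Fintype V] {G : SimpleGraph V} {U : Finset V}
    (hU : ∀ u w, G.Adj u w → u ∈ U) (hc : #U = 4) : HasTwoFold G := by
  classical
  obtain ⟨a, b, c, d, hab, hac, had, hbc, hbd, hcd, rfl⟩ := Finset.card_eq_four.1 hc
  refine HasTwoFold.mono (G := cliqueOn {a, b, c, d}) ?_
    fun u v huv => ⟨huv.ne, hU u v huv, hU v u huv.symm⟩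
  let f : Fin 3 → V → V → ZMod 2 := ![triChain a b c, triChain a c d, triChain a b d]
  have ht : ∀ i, f i ∈ cycleSpace (cliqueOn {a, b, c, d}) := by
    intro i
    fin_cases i
    · exact triChain_mem ⟨hab, by simp⟩ ⟨hbc, by simp⟩ ⟨hac.symm, by simp⟩
    · exact triChain_mem ⟨hac, by simp⟩ ⟨hcd, by simp⟩ ⟨had.symm, by simp⟩
    · exact triChain_mem ⟨hab, by simp⟩ ⟨hbd, by simp⟩ ⟨had.symm, by simp⟩
  refine ⟨Fin 3, inferInstance, f, ⟨ht, fun z hz => ?_, ?_⟩⟩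
  · have hsum : ∑ i, (![z b c, z c d, z b d] i) • f i ∈ cycleSpace (cliqueOn {a, b, c, d}) :=
      Submodule.sum_mem _ fun i _ => Submodule.smul_mem _ _ (ht i)
    have h0 : z - ∑ i, (![z b c, z c d, z b d] i) • f i = 0 := by
      refine eq_zero_of_apex (sub_mem hz hsum) a fun u v hu hv => ?_
      obtain ⟨hzc, -⟩ := mem_cycleSpace.1 hz
      by_cases huv : u ∈ ({a, b, c, d} : Finset V) ∧ v ∈ ({a, b, c, d} : Finset V) ∧ u ≠ v
      · simp only [Finset.mem_insert, Finset.mem_singleton] at huv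
        obtain ⟨rfl | rfl | rfl | rfl, rfl | rfl | rfl | rfl, hne⟩ := huv <;>
          first
          | contradiction
          | simp [f, Fin.sum_univ_three, triChain, edgeChain, *, Ne.symm, hab.symm, hac.symm,
              had.symm, hbc.symm, hbd.symm, hcd.symm]
        all_goals exact sub_eq_zero.2 (hzc.1 u v)
      · refine not_not.1 fun hne => huv ?_
        have := (mem_cycleSpace.1 (sub_mem hz hsum)).1.2 u v hne
        exact ⟨this.2.1, this.2.2, this.1⟩
    rw [sub_eq_zero.1 h0]
    exact Submodule.sum_mem _ fun i _ => Submodule.smul_mem _ _ (Submodule.subset_span ⟨i, rfl⟩)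
  · intro u v
    by_contra! h3
    have h4 : ∀ i, f i u v ≠ 0 := by
      have : ({i | f i u v ≠ 0} : Finset (Fin 3)) = Finset.univ :=
        Finset.eq_univ_of_card _ (le_antisymm (Finset.card_le_univ _)
          (by simpa [Nat.succ_le_iff] using h3))
      intro i
      have := this ▸ Finset.mem_univ i
      simpa using this
    have e0 := triChain_ne_zero (h4 0)
    have e1 := triChain_ne_zero (h4 1)
    have e2 := triChain_ne_zero (h4 2)
    simp only [edgeChain_ne_zero] at e0 e1 e2
    grind

/-! ### Contractible edges -/

lemma mem_sdiff_pair [DecidableEq V] {U : Finset V} {a b u : V} :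
    u ∈ U \ {a, b} ↔ u ∈ U ∧ u ≠ a ∧ u ≠ b := by
  simp

lemma mem_sdiff_triple [DecidableEq V] {U : Finset V} {a b c u : V} :
    u ∈ U \ {a, b, c} ↔ u ∈ U ∧ u ≠ a ∧ u ≠ b ∧ u ≠ c := by
  simp

open scoped Classical in
lemma false_of_minimal_fragment {G : SimpleGraph V} {U : Finset V}
    (hU : ∀ u w, G.Adj u w → u ∈ U)
    (hsep : ∀ a ∈ U, ∀ b ∈ U, a ≠ b → CutConn G (U \ {a, b}))
    (hbad : ∀ x y, G.Adj x y → ∃ z ∈ U, z ≠ x ∧ z ≠ y ∧ ¬ CutConn G (U \ {x, y, z})) (n : ℕ) :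
    ∀ x y z : V, ∀ A : Finset V, #A = n → G.Adj x y → z ∈ U → z ≠ x → z ≠ y →
      A ⊆ U \ {x, y, z} → A.Nonempty →
      (∀ u ∈ A, ∀ w ∈ U, w ≠ x → w ≠ y → w ≠ z → w ∉ A → ¬ G.Adj u w) → False := by
  induction n using Nat.strong_induction_on with
  | _ n ih =>
  intro x y z A hn hxy hz hzx hzy hA hA0 hcut
  have mem_U : ∀ {a b c : V} {S : Finset V}, S ⊆ U \ {a, b, c} → ∀ {u}, u ∈ S →
      u ∈ U ∧ u ≠ a ∧ u ≠ b ∧ u ≠ c := fun hS _ hu => mem_sdiff_triple.1 (hS hu)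
  by_cases hrest : ((U \ {x, y}) \ A).Nonempty
  swap
  · apply hrest
    exact ⟨z, Finset.mem_sdiff.2 ⟨mem_sdiff_pair.2 ⟨hz, hzx, hzy⟩,
      fun h => (mem_U hA h).2.2.2 rfl⟩⟩
  obtain ⟨w, hwA, w', hw', hww'⟩ := hsep x (hU _ _ hxy) y (hU _ _ hxy.symm) hxy.ne A
    (fun u hu => by
      obtain ⟨h1, h2, h3, -⟩ := mem_U hA hu
      exact mem_sdiff_pair.2 ⟨h1, h2, h3⟩) hA0 hrest
  rw [Finset.mem_sdiff, mem_sdiff_pair] at hw'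
  obtain rfl : w' = z := by
    by_contra hne
    exact hcut w hwA w' hw'.1.1 hw'.1.2.1 hw'.1.2.2 hne hw'.2 hww'
  obtain ⟨t, ht, htz, htw, hbadt⟩ := hbad w' w hww'.symm
  have hwz := mem_U hA hwA
  have main : ∀ C : Finset V, C ⊆ U \ {w', w, t} → C.Nonempty → x ∉ C → y ∉ C →
      (∀ u ∈ C, ∀ v ∈ U, v ≠ w' → v ≠ w → v ≠ t → v ∉ C → ¬ G.Adj u v) → False := by
    intro C hC hC0 hxC hyC hCcut
    have hwC : w ∉ C := fun h => (mem_U hC h).2.2.1 rfl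
    obtain ⟨u, huC, v, hv, huv⟩ := hsep w' hz t ht htz.symm C
      (fun u hu => by
        obtain ⟨h1, h2, -, h3⟩ := mem_U hC hu
        exact mem_sdiff_pair.2 ⟨h1, h2, h3⟩) hC0
      ⟨w, Finset.mem_sdiff.2 ⟨mem_sdiff_pair.2 ⟨hwz.1, hwz.2.2.2, htw.symm⟩, hwC⟩⟩
    rw [Finset.mem_sdiff, mem_sdiff_pair] at hv
    obtain rfl : v = w := by
      by_contra hne
      exact hCcut u huC v hv.1.1 hv.1.2.1 hne hv.1.2.2 hv.2 huv
    have inA : ∀ p ∈ A, ∀ q ∈ C, G.Adj p q → q ∈ A := by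
      intro p hp q hq hpq
      by_contra hqA
      exact hcut p hp q (mem_U hC hq).1 (fun h => hxC (h ▸ hq)) (fun h => hyC (h ▸ hq))
        (mem_U hC hq).2.1 hqA hpq
    refine ih #(C ∩ A) ?_ w' v t (C ∩ A) rfl hww'.symm ht htz htw
      (Finset.inter_subset_left.trans hC) ⟨u, Finset.mem_inter.2 ⟨huC, inA v hwA u huC huv.symm⟩⟩ ?_
    · rw [← hn]
      refine Finset.card_lt_card (Finset.ssubset_iff_of_subset Finset.inter_subset_right |>.2
        ⟨v, hwA, fun h => hwC (Finset.mem_inter.1 h).1⟩)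
    · intro p hp q hq hq1 hq2 hq3 hqn hpq
      rw [Finset.mem_inter] at hp
      by_cases hqC : q ∈ C
      · exact hqn (Finset.mem_inter.2 ⟨hqC, inA p hp.2 q hqC hpq⟩)
      · exact hCcut p hp.1 q hq hq1 hq2 hq3 hqC hpq
  unfold CutConn at hbadt
  push Not at hbadt
  obtain ⟨C, hC, hC0, hD0, hCD⟩ := hbadt
  by_cases hxy' : x ∉ C ∧ y ∉ C
  · refine main C hC hC0 hxy'.1 hxy'.2 fun u hu v hv h1 h2 h3 h4 =>
      hCD u hu v (Finset.mem_sdiff.2 ⟨mem_sdiff_triple.2 ⟨hv, h1, h2, h3⟩, h4⟩)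
  · refine main ((U \ {w', w, t}) \ C) Finset.sdiff_subset hD0 ?_ ?_ ?_
    · intro hx
      have hxC := (Finset.mem_sdiff.1 hx).2
      exact hCD y (by tauto) x hx hxy.symm
    · intro hy
      have hyC := (Finset.mem_sdiff.1 hy).2
      exact hCD x (by tauto) y hy hxy
    · intro u hu v hv h1 h2 h3 h4 huv
      refine hCD v ?_ u hu huv.symm
      by_contra hvC
      exact h4 (Finset.mem_sdiff.2 ⟨mem_sdiff_triple.2 ⟨hv, h1, h2, h3⟩, hvC⟩)

open scoped Classical in
/-- A graph on at least four vertices in which no two vertices separate has an edge whose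
contraction leaves no separating pair through the contracted vertex. -/
lemma exists_contractible {G : SimpleGraph V} {U : Finset V} (hU : ∀ u w, G.Adj u w → u ∈ U)
    (hsep : ∀ a ∈ U, ∀ b ∈ U, a ≠ b → CutConn G (U \ {a, b})) (hc : 4 ≤ #U) :
    ∃ x y, G.Adj x y ∧ ∀ z ∈ U, z ≠ x → z ≠ y → CutConn G (U \ {x, y, z}) := by
  by_contra! hbad
  obtain ⟨a, ha, b, hb, hab⟩ := Finset.one_lt_card.1 (show 1 < #U by omega)
  have hc2 : 2 ≤ #(U \ {a, b}) := by
    have := Finset.le_card_sdiff {a, b} U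
    have := Finset.card_le_two (a := a) (b := b)
    omega
  obtain ⟨c, hc', d, hd', hcd⟩ := Finset.one_lt_card.1 hc2
  obtain ⟨x, -, y, -, hxy⟩ := hsep a ha b hb hab {c} (by simpa using hc') (by simp)
    ⟨d, Finset.mem_sdiff.2 ⟨hd', by simpa using hcd.symm⟩⟩
  obtain ⟨z, hz, hzx, hzy, hcut⟩ := hbad x y hxy
  unfold CutConn at hcut
  push Not at hcut
  obtain ⟨A, hA, hA0, -, hAB⟩ := hcut
  refine false_of_minimal_fragment hU hsep hbad _ x y z A rfl hxy hz hzx hzy hA hA0 ?_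
  intro u hu w hw h1 h2 h3 h4
  exact hAB u hu w (Finset.mem_sdiff.2 ⟨mem_sdiff_triple.2 ⟨hw, h1, h2, h3⟩, h4⟩)

/-! ### The link of a vertex in a two-fold family -/

lemma CutConn.mono {G H : SimpleGraph V} {S : Finset V} (h : CutConn G S) (hGH : G ≤ H) :
    CutConn H S := fun A hA hA0 hB0 =>
  let ⟨u, hu, w, hw, huw⟩ := h A hA hA0 hB0
  ⟨u, hu, w, hw, hGH huw⟩

/-- An even set having exactly two prescribed edges at a vertex. -/
lemma CutConn.exists_cycle [Fintype V] {G : SimpleGraph V} {T : Finset V} (h : CutConn G T)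
    {p q₁ q₂ : V} (hp : p ∉ T) (h₁ : q₁ ∈ T) (h₂ : q₂ ∈ T) (hq : q₁ ≠ q₂) (hpq₁ : G.Adj p q₁)
    (hpq₂ : G.Adj p q₂) : ∃ z ∈ cycleSpace G, ∀ u, z p u ≠ 0 ↔ u = q₁ ∨ u = q₂ := by
  classical
  obtain ⟨c, hc, hcT, hcb⟩ := h.exists_chain h₁ h₂
  refine ⟨c + edgeChain p q₁ + edgeChain p q₂, ⟨add_mem (add_mem hc (edgeChain_mem_chains hpq₁))
    (edgeChain_mem_chains hpq₂), ?_⟩, fun u => ?_⟩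
  · rw [SetLike.mem_coe, LinearMap.mem_ker, map_add, map_add, hcb, boundary_edgeChain hpq₁.ne,
      boundary_edgeChain hpq₂.ne]
    have key : ∀ a b c : ZMod 2, a + b + (c + a) + (c + b) = 0 := by decide
    ext u
    exact key _ _ _
  · have h0 : c p u = 0 := by
      by_contra hne
      exact hp (hcT p u hne).1
    simp only [Pi.add_apply, h0, zero_add, edgeChain]
    have := hpq₁.ne
    have := hpq₂.ne
    by_cases hu1 : u = q₁
    · subst hu1
      simp [hq, hpq₁.ne, hpq₂.ne]
    · by_cases hu2 : u = q₂ <;> simp [hu1, hu2, hq.symm, hpq₁.ne, hpq₂.ne]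

lemma chain_sum_apply {ι : Type*} {I : Finset ι} {f : ι → V → V → ZMod 2} {u w : V} :
    (∑ i ∈ I, f i) u w = ∑ i ∈ I, f i u w := by
  simp [Finset.sum_apply]

open scoped Classical in
/-- The sum of the members of a family that have an edge at `v`. -/
noncomputable def link {ι : Type} [Fintype ι] (v : V) (f : ι → V → V → ZMod 2) :
    V → V → ZMod 2 :=
  ∑ i with ∃ u, f i v u ≠ 0, f i

lemma exists_of_link {ι : Type} [Fintype ι] {v : V} {f : ι → V → V → ZMod 2} {u w : V}
    (hne : link v f u w ≠ 0) : ∃ i, (∃ q, f i v q ≠ 0) ∧ f i u w ≠ 0 := by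
  classical
  rw [link, chain_sum_apply] at hne
  obtain ⟨i, hi, hi'⟩ := Finset.exists_ne_zero_of_sum_ne_zero hne
  exact ⟨i, (Finset.mem_filter.1 hi).2, hi'⟩

/-- A two-fold family of `G` with sum zero, together with a vertex `v` such that `G - v` is
two-connected with vertex set `S` and edges those of `H`. -/
structure Hub [Fintype V] [DecidableEq V] (G H : SimpleGraph V) (S : Finset V) (v : V) {ι : Type}
    [Fintype ι] (f : ι → V → V → ZMod 2) : Prop where
  fam : TwoFold G f
  sum : ∑ i, f i = 0
  le : H ≤ G
  adj : ∀ u w, G.Adj u w → u ≠ v → w ≠ v → H.Adj u w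
  supp : ∀ u w, H.Adj u w → u ∈ S
  nbr : ∀ u, G.Adj v u → u ∈ S
  notMem : v ∉ S
  two : ∃ q₁ q₂, q₁ ≠ q₂ ∧ G.Adj v q₁ ∧ G.Adj v q₂
  card : 3 ≤ #S
  conn : CutConn H S
  conn_erase : ∀ p ∈ S, CutConn H (S \ {p})

namespace Hub

variable [Fintype V] [DecidableEq V] {G H : SimpleGraph V} {S : Finset V} {v : V} {ι : Type}
  [Fintype ι] {f : ι → V → V → ZMod 2}

lemma exists_sum (h : Hub G H S v f) {z : V → V → ZMod 2} (hz : z ∈ cycleSpace G) :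
    ∃ I : Finset ι, ∑ i ∈ I, f i = z := by
  classical
  obtain ⟨c, rfl⟩ := h.fam.exists_coeff hz
  refine ⟨Finset.univ.filter (fun i => c i ≠ 0), ?_⟩
  rw [Finset.sum_filter]
  refine Finset.sum_congr rfl fun i _ => ?_
  split_ifs with hi
  · rw [zmod2_ne_zero hi, one_smul]
  · rw [not_not.1 hi, zero_smul]

lemma sum_add_compl (h : Hub G H S v f) (I : Finset ι) [DecidableEq ι] :
    ∑ i ∈ Iᶜ, f i = ∑ i ∈ I, f i := by
  have := h.sum
  rw [← Finset.sum_add_sum_compl I] at this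
  calc ∑ i ∈ Iᶜ, f i = ∑ i ∈ I, f i + (∑ i ∈ I, f i + ∑ i ∈ Iᶜ, f i) := by
        rw [← add_assoc, chain_add_self, zero_add]
    _ = _ := by rw [this, add_zero]

/-- No pair is covered both from `I` and from its complement unless the sum over `I` contains
it. -/
lemma not_both (h : Hub G H S v f) {I : Finset ι} {u w : V} (h0 : ∑ i ∈ I, f i u w = 0) {i j : ι}
    (hi : i ∈ I) (hj : j ∉ I) (hiu : f i u w ≠ 0) (hju : f j u w ≠ 0) : False := by
  classical
  have : ∃ k ∈ I, k ≠ i ∧ f k u w ≠ 0 := by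
    by_contra! hn
    rw [Finset.sum_eq_single_of_mem i hi fun k hk hki => hn k hk hki] at h0
    exact hiu h0
  obtain ⟨k, hk, hki, hku⟩ := this
  have h3 : #{i, j, k} = 3 := Finset.card_eq_three.2 ⟨i, j, k, fun e => hj (e ▸ hi), hki.symm,
    fun e => hj (e ▸ hk), rfl⟩
  have hsub : ({i, j, k} : Finset ι) ⊆ ({i | f i u w ≠ 0} : Finset ι) := by
    intro x hx
    simp only [Finset.mem_insert, Finset.mem_singleton] at hx
    rcases hx with rfl | rfl | rfl <;> simpa using by assumption
  have := Finset.card_le_card hsub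
  have := h.fam.le_two u w
  omega

/-- A set of faces whose sum avoids `v` contains all or none of the faces at `v`. -/
lemma all_or_none (h : Hub G H S v f) {I : Finset ι} (h0 : ∀ u, ∑ i ∈ I, f i v u = 0) :
    (∀ i ∈ I, ∀ u, f i v u = 0) ∨ ∀ i, i ∉ I → ∀ u, f i v u = 0 := by
  classical
  by_contra! hn
  obtain ⟨⟨i, hi, u₁, hu₁⟩, j, hj, u₂, hu₂⟩ := hn
  have hadj : ∀ {i u}, f i v u ≠ 0 → G.Adj v u := fun {i u} hne =>
    (mem_cycleSpace.1 (h.fam.mem i)).1.2 v u hne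
  have hne : u₁ ≠ u₂ := by
    rintro rfl
    exact h.not_both (h0 u₁) hi hj hu₁ hu₂
  obtain ⟨z, hz, hzv⟩ := (h.conn.mono h.le).exists_cycle h.notMem (h.nbr _ (hadj hu₁))
    (h.nbr _ (hadj hu₂)) hne (hadj hu₁) (hadj hu₂)
  obtain ⟨J, rfl⟩ := h.exists_sum hz
  have hIJ : ∑ i ∈ J ∩ I, f i ∈ cycleSpace G := Submodule.sum_mem _ fun i _ => h.fam.mem i
  have hs := (mem_cycleSpace.1 hIJ).2 v
  have hu₁' : (∑ i ∈ J, f i) v u₁ ≠ 0 := (hzv u₁).2 (Or.inl rfl)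
  rw [Finset.sum_eq_single u₁, chain_sum_apply] at hs
  · rw [chain_sum_apply] at hu₁'
    refine hu₁' ?_
    rw [← hs]
    refine (Finset.sum_subset Finset.inter_subset_left fun k hkJ hk => ?_).symm
    by_contra hne
    exact h.not_both (h0 u₁) hi (fun hkI => hk (Finset.mem_inter.2 ⟨hkJ, hkI⟩)) hu₁ hne
  · intro u _ hu
    rw [chain_sum_apply]
    by_cases hcov : ∃ k ∈ I, f k v u ≠ 0
    · obtain ⟨k, hk, hku⟩ := hcov
      have hzero : (∑ i ∈ J, f i) v u = 0 := by
        by_contra hne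
        rcases (hzv u).1 hne with e | e
        · exact hu e
        · rw [e] at hku
          exact h.not_both (h0 u₂) hk hj hku hu₂
      rw [← hzero, chain_sum_apply]
      refine Finset.sum_subset Finset.inter_subset_left fun l hlJ hl => ?_
      by_contra hne
      exact h.not_both (h0 u) hk (fun hlI => hl (Finset.mem_inter.2 ⟨hlJ, hlI⟩)) hku hne
    · push Not at hcov
      exact Finset.sum_eq_zero fun k hk => hcov k (Finset.mem_inter.1 hk).2
  · simp

lemma apply_eq_zero (h : Hub G H S v f) {z : V → V → ZMod 2} (hz : z ∈ cycleSpace H) (u : V) :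
    z v u = 0 := by
  by_contra hne
  exact h.notMem (h.supp v u ((mem_cycleSpace.1 hz).1.2 v u hne))

lemma mem_of_apply_eq_zero (h : Hub G H S v f) {z : V → V → ZMod 2} (hz : z ∈ cycleSpace G)
    (h0 : ∀ u, z v u = 0) : z ∈ cycleSpace H := by
  have hs := (mem_cycleSpace.1 hz).1
  refine mem_cycleSpace_of_supp hz fun u w huw => h.adj u w (hs.2 u w huw) ?_ ?_
  · rintro rfl
    exact huw (h0 w)
  · rintro rfl
    exact huw ((hs.1 u w).trans (h0 u))

/-- Even sets avoiding `v` are sums of faces avoiding `v`. -/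
lemma exists_sum_avoid (h : Hub G H S v f) {z : V → V → ZMod 2} (hz : z ∈ cycleSpace H) :
    ∃ I : Finset ι, (∀ i ∈ I, ∀ u, f i v u = 0) ∧ ∑ i ∈ I, f i = z := by
  classical
  obtain ⟨I, rfl⟩ := h.exists_sum (cycleSpace_mono h.le hz)
  rcases h.all_or_none (I := I) fun u => by rw [← chain_sum_apply]; exact h.apply_eq_zero hz u
    with hI | hI
  · exact ⟨I, hI, rfl⟩
  · exact ⟨Iᶜ, fun i hi => hI i (Finset.mem_compl.1 hi), h.sum_add_compl I⟩

/-- Every edge of `H` lies on a face avoiding `v`. -/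
lemma exists_face (h : Hub G H S v f) {u w : V} (huw : H.Adj u w) :
    ∃ i, (∀ q, f i v q = 0) ∧ f i u w ≠ 0 := by
  classical
  have hu := h.supp _ _ huw
  have hw := h.supp _ _ huw.symm
  have hc := h.card
  have hcard : 1 ≤ #(S \ {w, u}) := by
    have := Finset.le_card_sdiff {w, u} S
    have := Finset.card_le_two (a := w) (b := u)
    omega
  obtain ⟨t, ht⟩ := Finset.card_pos.1 hcard
  rw [mem_sdiff_pair] at ht
  obtain ⟨a, ha, w', hw', haw⟩ := h.conn_erase w hw {u} (by simpa using ⟨hu, huw.ne⟩) (by simp)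
    ⟨t, by simp [ht]⟩
  obtain rfl := Finset.mem_singleton.1 ha
  simp only [Finset.mem_sdiff, Finset.mem_singleton] at hw'
  obtain ⟨z, hz, hzu⟩ := (h.conn_erase a hu).exists_cycle (p := a) (q₁ := w) (q₂ := w') (by simp)
    (by simpa using ⟨hw, huw.ne'⟩) (by simpa using ⟨hw'.1.1, hw'.2⟩) (Ne.symm hw'.1.2)
    huw haw
  obtain ⟨I, hI, rfl⟩ := h.exists_sum_avoid hz
  have := (hzu w).2 (Or.inl rfl)
  rw [chain_sum_apply] at this
  obtain ⟨i, hi, hne⟩ := Finset.exists_ne_zero_of_sum_ne_zero this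
  exact ⟨i, hI i hi, hne⟩

open scoped Classical in
lemma sum_avoid (h : Hub G H S v f) : ∑ i with ∀ u, f i v u = 0, f i = link v f := by
  rw [link, ← h.sum_add_compl]
  refine Finset.sum_congr ?_ fun _ _ => rfl
  ext i
  simp

lemma link_mem (h : Hub G H S v f) : link v f ∈ cycleSpace H := by
  classical
  rw [← h.sum_avoid]
  refine h.mem_of_apply_eq_zero (Submodule.sum_mem _ fun i _ => h.fam.mem i) fun u => ?_
  rw [chain_sum_apply]
  exact Finset.sum_eq_zero fun i hi => (Finset.mem_filter.1 hi).2 u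

/-- An edge of `H` covered by a face at `v` belongs to the link. -/
lemma link_ne_zero (h : Hub G H S v f) {u w : V} (huw : H.Adj u w) {i : ι} (hi : ∃ q, f i v q ≠ 0)
    (hne : f i u w ≠ 0) : link v f u w ≠ 0 := by
  classical
  intro h0
  obtain ⟨j, hj, hju⟩ := h.exists_face huw
  rw [link, chain_sum_apply] at h0
  refine h.not_both h0 (i := i) (j := j) (by simpa using hi) (by simpa using hj) hne hju

/-- The neighbours of `v` lie on the link. -/
lemma exists_link_of_adj (h : Hub G H S v f) {u : V} (huv : G.Adj v u) :
    ∃ w, link v f u w ≠ 0 := by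
  classical
  obtain ⟨u', hu', hne⟩ : ∃ u', G.Adj v u' ∧ u ≠ u' := by
    obtain ⟨q₁, q₂, hq, h1, h2⟩ := h.two
    by_cases hq1 : u = q₁
    · exact ⟨q₂, h2, hq1 ▸ hq⟩
    · exact ⟨q₁, h1, hq1⟩
  obtain ⟨z, hz, hzv⟩ := (h.conn.mono h.le).exists_cycle h.notMem (h.nbr _ huv) (h.nbr _ hu') hne
    huv hu'
  obtain ⟨I, rfl⟩ := h.exists_sum hz
  have := (hzv u).2 (Or.inl rfl)
  rw [chain_sum_apply] at this
  obtain ⟨i, hi, hi'⟩ := Finset.exists_ne_zero_of_sum_ne_zero this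
  obtain ⟨hc, hb⟩ := mem_cycleSpace.1 (h.fam.mem i)
  obtain ⟨w, hw, hne'⟩ := exists_ne_of_sum_eq_zero (hb u) (chain_symm_ne hc hi')
  exact ⟨w, h.link_ne_zero (h.adj u w (hc.2 u w hne') huv.ne' hw) ⟨u, hi'⟩ hne'⟩

/-- The link is a minimal nonempty even set. -/
lemma link_minimal (h : Hub G H S v f) {D : V → V → ZMod 2} (hD : D ∈ cycleSpace H) (hD0 : D ≠ 0)
    (hDC : ∀ u w, D u w ≠ 0 → link v f u w ≠ 0) : D = link v f := by
  classical
  obtain ⟨A, hA, rfl⟩ := h.exists_sum_avoid hD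
  by_contra hne
  -- no pair is covered both by a face in `A` and by another face avoiding `v`
  have hsep : ∀ u w, H.Adj u w → ∀ i ∈ A, ∀ j, j ∉ A → (∀ q, f j v q = 0) → f i u w ≠ 0 →
      f j u w ≠ 0 → False := by
    intro u w huw i hi j hj hjv hiu hju
    by_cases h0 : (∑ i ∈ A, f i) u w = 0
    · exact h.not_both (chain_sum_apply ▸ h0) hi hj hiu hju
    · obtain ⟨k, ⟨q, hkq⟩, hk⟩ := exists_of_link (hDC u w h0)
      have h3 : #{i, j, k} = 3 := Finset.card_eq_three.2 ⟨i, j, k, fun e => hj (e ▸ hi),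
        fun e => hkq (e ▸ hA i hi q), fun e => hkq (e ▸ hjv q), rfl⟩
      have hsub : ({i, j, k} : Finset ι) ⊆ ({i | f i u w ≠ 0} : Finset ι) := by
        intro x hx
        simp only [Finset.mem_insert, Finset.mem_singleton] at hx
        rcases hx with rfl | rfl | rfl <;> simpa using by assumption
      have := Finset.card_le_card hsub
      have := h.fam.le_two u w
      omega
  have hHadj : ∀ {i u w}, (∀ q, f i v q = 0) → f i u w ≠ 0 → H.Adj u w := fun {i u w} hi hiu =>
    (mem_cycleSpace.1 (h.mem_of_apply_eq_zero (h.fam.mem i) hi)).1.2 u w hiu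
  -- a vertex meeting faces of both kinds
  obtain ⟨p, q₁, q₂, i, hi, j, hj, hjv, h1, h2⟩ : ∃ p q₁ q₂, ∃ i ∈ A, ∃ j, j ∉ A ∧
      (∀ q, f j v q = 0) ∧ f i p q₁ ≠ 0 ∧ f j p q₂ ≠ 0 := by
    by_contra! hno
    obtain ⟨u, w, huw⟩ : ∃ u w, (∑ i ∈ A, f i) u w ≠ 0 := by
      by_contra! h0
      exact hD0 (by ext u w; exact h0 u w)
    rw [chain_sum_apply] at huw
    obtain ⟨i, hi, hiu⟩ := Finset.exists_ne_zero_of_sum_ne_zero huw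
    have hall := h.conn.eq_of_closed (fun u => ∃ q, ∃ i ∈ A, f i u q ≠ 0)
      (h.supp u w (hHadj (hA i hi) hiu)) ⟨w, i, hi, hiu⟩ (by
        rintro u - w - ⟨q, i, hi, hiu⟩ huw
        obtain ⟨j, hj, hju⟩ := h.exists_face huw
        by_cases hjA : j ∈ A
        · exact ⟨u, j, hjA, chain_symm_ne (mem_cycleSpace.1 (h.fam.mem j)).1 hju⟩
        · exact absurd (hno u q w i hi j hjA hj hiu) hju)
    refine hne ?_
    rw [← h.sum_avoid]
    refine Finset.sum_subset (fun i hi => by simpa using hA i hi) fun j hj hjA => ?_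
    simp only [Finset.mem_filter, Finset.mem_univ, true_and] at hj
    ext u w
    by_contra hju
    obtain ⟨q, i, hi, hiu⟩ := hall u (h.supp u w (hHadj hj hju))
    exact hju (hno u q w i hi j hjA hj hiu)
  have hpq₁ := hHadj (hA i hi) h1
  have hpq₂ := hHadj hjv h2
  have hq : q₁ ≠ q₂ := by
    rintro rfl
    exact hsep p q₁ hpq₁ i hi j hj hjv h1 h2
  obtain ⟨z, hz, hzp⟩ := (h.conn_erase p (h.supp _ _ hpq₁)).exists_cycle (p := p) (q₁ := q₁)
    (q₂ := q₂) (by simp) (by simpa using ⟨h.supp _ _ hpq₁.symm, hpq₁.ne'⟩)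
    (by simpa using ⟨h.supp _ _ hpq₂.symm, hpq₂.ne'⟩) hq hpq₁ hpq₂
  obtain ⟨J, hJ, rfl⟩ := h.exists_sum_avoid hz
  have hJA : ∑ i ∈ J ∩ A, f i ∈ cycleSpace G := Submodule.sum_mem _ fun i _ => h.fam.mem i
  have hs := (mem_cycleSpace.1 hJA).2 p
  have key : ∀ u, (∃ k ∈ A, f k p u ≠ 0) → ∑ k ∈ J ∩ A, f k p u = ∑ k ∈ J, f k p u := by
    rintro u ⟨k, hk, hku⟩
    refine Finset.sum_subset Finset.inter_subset_left fun l hlJ hl => ?_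
    by_contra hlu
    exact hsep p u (hHadj (hA k hk) hku) k hk l (fun hlA => hl (Finset.mem_inter.2 ⟨hlJ, hlA⟩))
      (hJ l hlJ) hku hlu
  have h1' := (hzp q₁).2 (Or.inl rfl)
  rw [chain_sum_apply] at h1'
  rw [Finset.sum_eq_single q₁, chain_sum_apply, key q₁ ⟨i, hi, h1⟩] at hs
  · exact h1' hs
  · intro u _ hu
    rw [chain_sum_apply]
    by_cases hcov : ∃ k ∈ A, f k p u ≠ 0
    · rw [key u hcov, ← chain_sum_apply]
      by_contra hne
      rcases (hzp u).1 hne with e | e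
      · exact hu e
      · obtain ⟨k, hk, hku⟩ := hcov
        rw [e] at hku
        exact hsep p q₂ hpq₂ k hk j hj hjv hku h2
    · push Not at hcov
      exact Finset.sum_eq_zero fun k hk => hcov k (Finset.mem_inter.1 hk).2
  · simp

/-- The faces avoiding `v` form a two-fold family of `H`, and cover the edges of the link only
once. -/
lemma exists_family (h : Hub G H S v f) : ∃ (κ : Type) (_ : Fintype κ) (g : κ → V → V → ZMod 2),
    TwoFold H g ∧ ∀ u w, link v f u w ≠ 0 → #{i | g i u w ≠ 0} ≤ 1 := by
  classical
  have hcard : ∀ u w, #{i : {i // ∀ u, f i v u = 0} | f i u w ≠ 0} =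
      #{i | (∀ u, f i v u = 0) ∧ f i u w ≠ 0} := by
    intro u w
    rw [← Finset.card_map (Function.Embedding.subtype _)]
    congr 1
    ext i
    simp [and_comm]
  refine ⟨{i // ∀ u, f i v u = 0}, inferInstance, fun i => f i, ⟨fun i =>
    h.mem_of_apply_eq_zero (h.fam.mem i) i.2, fun z hz => ?_, fun u w => ?_⟩, fun u w huw => ?_⟩
  · obtain ⟨I, hI, rfl⟩ := h.exists_sum_avoid hz
    exact Submodule.sum_mem _ fun i hi => Submodule.subset_span ⟨⟨i, hI i hi⟩, rfl⟩
  · rw [hcard]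
    exact (Finset.card_le_card fun i hi => by simp at hi ⊢; exact hi.2).trans (h.fam.le_two u w)
  · obtain ⟨j, ⟨q, hjq⟩, hj⟩ := exists_of_link huw
    rw [hcard, ← Nat.lt_succ_iff]
    refine lt_of_lt_of_le (Finset.card_lt_card (t := ({i | f i u w ≠ 0} : Finset ι))
      (Finset.ssubset_iff_of_subset ?_ |>.2 ⟨j, by simpa using hj, ?_⟩)) (h.fam.le_two u w)
    · intro i hi
      simp only [Finset.mem_filter, Finset.mem_univ, true_and] at hi ⊢
      exact hi.2
    · simp only [Finset.mem_filter, Finset.mem_univ, true_and, not_and]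
      exact fun h0 => absurd (h0 q) hjq

end Hub

/-! ### Minimal even sets are cycles -/

/-- The chain `C` is the cycle of length `n` with consecutive vertices `c 0, c 1, …`. -/
structure IsRim (C : V → V → ZMod 2) (c : ℕ → V) (n : ℕ) : Prop where
  three : 3 ≤ n
  eq_iff : ∀ i j, c i = c j ↔ i % n = j % n
  edge : ∀ k, C (c k) (c (k + 1)) ≠ 0
  exists_edge : ∀ u w, C u w ≠ 0 →
    ∃ k, (u = c k ∧ w = c (k + 1)) ∨ (u = c (k + 1) ∧ w = c k)

/-- A closed walk without backtracking inside the support of an even set. -/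
lemma exists_nonbacktracking [Fintype V] {G : SimpleGraph V} {C : V → V → ZMod 2}
    (hC : C ∈ cycleSpace G) (h0 : C ≠ 0) :
    ∃ s : ℕ → V, (∀ k, C (s k) (s (k + 1)) ≠ 0) ∧ ∀ k, s (k + 2) ≠ s k := by
  obtain ⟨hc, hb⟩ := mem_cycleSpace.1 hC
  obtain ⟨u, w, huw⟩ : ∃ u w, C u w ≠ 0 := by
    by_contra! hn
    exact h0 (by ext u w; exact hn u w)
  have hstep : ∀ p : {p : V × V // C p.1 p.2 ≠ 0}, ∃ q : {p : V × V // C p.1 p.2 ≠ 0},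
      q.1.1 = p.1.2 ∧ q.1.2 ≠ p.1.1 := by
    rintro ⟨⟨u, w⟩, huw⟩
    obtain ⟨u', hu', hne⟩ := exists_ne_of_sum_eq_zero (hb w) (chain_symm_ne hc huw)
    exact ⟨⟨(w, u'), hne⟩, rfl, hu'⟩
  choose next hnext₁ hnext₂ using hstep
  let t : ℕ → {p : V × V // C p.1 p.2 ≠ 0} := fun k => next^[k] ⟨(u, w), huw⟩
  have ht : ∀ k, t (k + 1) = next (t k) := fun k => Function.iterate_succ_apply' _ _ _
  refine ⟨fun k => (t k).1.1, fun k => ?_, fun k => ?_⟩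
  · simp only [ht, hnext₁]
    exact (t k).2
  · simp only [ht, hnext₁]
    exact hnext₂ _

lemma exists_first_repetition [Finite V] (s : ℕ → V) :
    ∃ i j, i < j ∧ s i = s j ∧ ∀ k l, k < j → l < j → s k = s l → k = l := by
  classical
  have hex : ∃ j, ∃ i, i < j ∧ s i = s j := by
    obtain ⟨i, j, hne, he⟩ := Finite.exists_ne_map_eq_of_infinite s
    rcases lt_or_gt_of_ne hne with h | h
    exacts [⟨j, i, h, he⟩, ⟨i, j, h, he.symm⟩]
  obtain ⟨i, hij, he⟩ := Nat.find_spec hex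
  refine ⟨i, Nat.find hex, hij, he, fun k l hk hl hkl => ?_⟩
  by_contra hne
  rcases lt_or_gt_of_ne hne with h | h
  · exact Nat.find_min hex hl ⟨k, h, hkl⟩
  · exact Nat.find_min hex hk ⟨l, h, hkl.symm⟩

lemma exists_isRim [Fintype V] {G : SimpleGraph V} {C : V → V → ZMod 2} (hC : C ∈ cycleSpace G)
    (h0 : C ≠ 0)
    (hmin : ∀ D ∈ cycleSpace G, D ≠ 0 → (∀ u w, D u w ≠ 0 → C u w ≠ 0) → D = C) :
    ∃ c n, IsRim C c n := by
  classical
  obtain ⟨s, hs₁, hs₂⟩ := exists_nonbacktracking hC h0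
  obtain ⟨i, j, hij, he, hinj⟩ := exists_first_repetition s
  have hc := (mem_cycleSpace.1 hC).1
  obtain ⟨n, rfl⟩ := Nat.exists_eq_add_of_lt hij
  have hn3 : 3 ≤ n + 1 := by
    by_contra hlt
    have : n = 0 ∨ n = 1 := by omega
    rcases this with rfl | rfl
    · have := hs₁ i
      rw [show i + 1 = i + 0 + 1 by rfl, ← he] at this
      exact this (chain_diag hc _)
    · exact hs₂ i he.symm
  set c : ℕ → V := fun k => s (i + k % (n + 1)) with hcdef
  have hmod : ∀ k, k % (n + 1) < n + 1 := fun k => Nat.mod_lt _ (by omega)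
  have hceq : ∀ k l, c k = c l ↔ k % (n + 1) = l % (n + 1) := by
    intro k l
    refine ⟨fun h => ?_, fun h => by simp only [hcdef, h]⟩
    have := hinj _ _ (by have := hmod k; omega) (by have := hmod l; omega) h
    omega
  have hedge : ∀ k, C (c k) (c (k + 1)) ≠ 0 := by
    intro k
    have h1 := hs₁ (i + k % (n + 1))
    simp only [hcdef]
    rw [Nat.add_mod, Nat.mod_eq_of_lt (show 1 < n + 1 by omega)]
    by_cases hk : k % (n + 1) + 1 < n + 1
    · rwa [Nat.mod_eq_of_lt hk]
    · have hk' : k % (n + 1) + 1 = n + 1 := by have := hmod k; omega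
      rw [add_assoc, hk'] at h1
      rwa [hk', Nat.mod_self, add_zero, he]
  set D : V → V → ZMod 2 := ∑ k ∈ Finset.range (n + 1), edgeChain (c k) (c (k + 1)) with hD
  have hDsupp : ∀ u w, D u w ≠ 0 →
      ∃ k, (u = c k ∧ w = c (k + 1)) ∨ (u = c (k + 1) ∧ w = c k) := by
    intro u w huw
    rw [hD, chain_sum_apply] at huw
    obtain ⟨k, _, hk⟩ := Finset.exists_ne_zero_of_sum_ne_zero huw
    exact ⟨k, edgeChain_ne_zero.1 hk⟩
  have hDmem : D ∈ cycleSpace G := by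
    refine ⟨Submodule.sum_mem _ fun k _ => edgeChain_mem_chains (hc.2 _ _ (hedge k)), ?_⟩
    rw [SetLike.mem_coe, LinearMap.mem_ker, hD, map_sum, Finset.sum_congr rfl fun k _ =>
      boundary_edgeChain (hc.2 _ _ (hedge k)).ne, Finset.sum_add_distrib,
      Finset.sum_range_succ' _ n, Finset.sum_range_succ (fun k => Pi.single (c (k + 1)) 1) n,
      (hceq (n + 1) 0).2 (by simp)]
    ext u
    exact zmod2_add_self _
  have hD01 : D (c 0) (c 1) ≠ 0 := by
    rw [hD, chain_sum_apply, Finset.sum_eq_single 0]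
    · exact edgeChain_ne_zero.2 (Or.inl ⟨rfl, rfl⟩)
    · intro k hk hk0
      by_contra hne
      rw [Finset.mem_range] at hk
      have h2 := Nat.mod_eq_of_lt (show 1 < n + 1 by omega)
      rcases edgeChain_ne_zero.1 hne with ⟨h, -⟩ | ⟨h, h'⟩
      · rw [hceq, Nat.mod_eq_of_lt hk, Nat.zero_mod] at h
        exact hk0 h.symm
      · rw [hceq, Nat.mod_eq_of_lt hk, h2] at h'
        rw [← h', hceq, Nat.zero_mod, Nat.mod_eq_of_lt (by omega)] at h
        omega
    · simp
  have hDC := hmin D hDmem (fun h => hD01 (by rw [h]; rfl)) fun u w huw => by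
    obtain ⟨k, ⟨rfl, rfl⟩ | ⟨rfl, rfl⟩⟩ := hDsupp u w huw
    · exact hedge k
    · exact chain_symm_ne hc (hedge k)
  exact ⟨c, n + 1, hn3, hceq, hedge, fun u w huw => hDsupp u w (hDC ▸ huw)⟩

namespace IsRim

variable {C : V → V → ZMod 2} {c : ℕ → V} {n : ℕ}

lemma apply_add (h : IsRim C c n) (k : ℕ) : c (k + n) = c k :=
  (h.eq_iff _ _).2 (Nat.add_mod_right k n)

/-- Every vertex of the rim has an index in a prescribed window. -/
lemma exists_index (h : IsRim C c n) (p r : ℕ) : ∃ m, p ≤ m ∧ m < p + n ∧ c m = c r := by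
  have hn := h.three
  induction p with
  | zero => exact ⟨r % n, by omega, by simpa using Nat.mod_lt r (by omega),
      (h.eq_iff _ _).2 (Nat.mod_mod _ _)⟩
  | succ p ih =>
    obtain ⟨m, h1, h2, h3⟩ := ih
    by_cases hm : m = p
    · exact ⟨m + n, by omega, by omega, (h.apply_add m).trans h3⟩
    · exact ⟨m, by omega, by omega, h3⟩

lemma eq_of_window (h : IsRim C c n) {p i j : ℕ} (hi : p ≤ i) (hi' : i < p + n) (hj : p ≤ j)
    (hj' : j < p + n) (he : c i = c j) : i = j := by
  have := (h.eq_iff _ _).1 he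
  have hn := h.three
  rcases le_total i j with hij | hij
  · have := (Nat.modEq_iff_dvd' hij).1 this
    obtain ⟨k, hk⟩ := this
    rcases k with _ | k
    · omega
    · have : n ≤ n * (k + 1) := Nat.le_mul_of_pos_right n (by omega)
      omega
  · have := (Nat.modEq_iff_dvd' hij).1 this.symm
    obtain ⟨k, hk⟩ := this
    rcases k with _ | k
    · omega
    · have : n ≤ n * (k + 1) := Nat.le_mul_of_pos_right n (by omega)
      omega

end IsRim

/-- The vertices of `c` with index in `[p, q)`. -/
def arc (c : ℕ → V) (p q : ℕ) : Set V := {v | ∃ i, p ≤ i ∧ i < q ∧ c i = v}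

lemma IsRim.disjoint_arc {C : V → V → ZMod 2} {c : ℕ → V} {n : ℕ} (h : IsRim C c n)
    {p q r s : ℕ} (hqr : q ≤ r) (hs : s ≤ p + n) : Disjoint (arc c p q) (arc c r s) := by
  rw [Set.disjoint_left]
  rintro v ⟨i, h1, h2, rfl⟩ ⟨j, h3, h4, he⟩
  have := h.eq_of_window (p := p) (by omega) (by omega) (by omega) (by omega) he
  omega

lemma arc_connected {G : SimpleGraph V} {c : ℕ → V} (h : ∀ k, G.Adj (c k) (c (k + 1))) {p q : ℕ}
    (hpq : p < q) : (arc c p q).Nonempty ∧ (G.induce (arc c p q)).Connected := by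
  have hp : c p ∈ arc c p q := ⟨p, le_rfl, hpq, rfl⟩
  refine ⟨⟨_, hp⟩, ?_⟩
  rw [induce_connected_iff_closed hp]
  rintro P hPp hP _ ⟨i, hi, hiq, rfl⟩
  induction i, hi using Nat.le_induction with
  | base => exact hPp
  | succ k hk ih =>
    exact hP (c k) ⟨k, hk, by omega, rfl⟩ _ ⟨k + 1, by omega, hiq, rfl⟩ (ih (by omega)) (h k)

lemma induce_singleton_connected (G : SimpleGraph V) (x : V) :
    ({x} : Set V).Nonempty ∧ (G.induce {x}).Connected := by
  refine ⟨⟨x, rfl⟩, ?_⟩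
  rw [induce_connected_iff_closed (Set.mem_singleton x)]
  rintro P hP - u rfl
  exact hP

lemma disjoint_singleton_arc {c : ℕ → V} {x : V} (hx : ∀ i, c i ≠ x) (p q : ℕ) :
    Disjoint {x} (arc c p q) := by
  rw [Set.disjoint_singleton_left]
  rintro ⟨i, -, -, hi⟩
  exact hx i hi

/-- Four alternating spokes yield a `K₃,₃` minor. -/
lemma IsRim.hasMinor_bipartite {G : SimpleGraph V} {C : V → V → ZMod 2} {c : ℕ → V} {n : ℕ}
    (h : IsRim C c n) (hc : ∀ k, G.Adj (c k) (c (k + 1))) {x y : V} (hxy : G.Adj x y)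
    (hx : ∀ i, c i ≠ x) (hy : ∀ i, c i ≠ y) {i₀ i₁ i₂ i₃ : ℕ} (h01 : i₀ < i₁) (h12 : i₁ < i₂)
    (h23 : i₂ < i₃) (h3n : i₃ < i₀ + n) (h0 : G.Adj x (c i₀)) (h1 : G.Adj y (c i₁))
    (h2 : G.Adj x (c i₂)) (h3 : G.Adj y (c i₃)) :
    HasMinor G (completeBipartiteGraph (Fin 3) (Fin 3)) := by
  have hd : ∀ {p q r s}, q ≤ r → s ≤ p + n → Disjoint (arc c p q) (arc c r s) := h.disjoint_arc
  have hdx := fun p q => disjoint_singleton_arc hx p q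
  have hdy := fun p q => disjoint_singleton_arc hy p q
  have hdx' := fun p q => (hdx p q).symm
  have hdy' := fun p q => (hdy p q).symm
  have hxy' : Disjoint ({x} : Set V) {y} := by simpa using hxy.ne
  have d1 := hd (p := i₀) (q := i₁) (r := i₁) (s := i₂) (by omega) (by omega)
  have d2 := hd (p := i₀) (q := i₁) (r := i₂) (s := i₃) (by omega) (by omega)
  have d3 := hd (p := i₀) (q := i₁) (r := i₃) (s := i₀ + n) (by omega) (by omega)
  have d4 := hd (p := i₁) (q := i₂) (r := i₂) (s := i₃) (by omega) (by omega)
  have d5 := hd (p := i₁) (q := i₂) (r := i₃) (s := i₀ + n) (by omega) (by omega)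
  have d6 := hd (p := i₂) (q := i₃) (r := i₃) (s := i₀ + n) (by omega) (by omega)
  have mem : ∀ {p q}, p < q → c p ∈ arc c p q := fun {p q} hpq => ⟨p, le_rfl, hpq, rfl⟩
  have mem' : ∀ {p q}, p < q → c (q - 1) ∈ arc c p q := fun {p q} hpq =>
    ⟨q - 1, by omega, by omega, rfl⟩
  have hc' : ∀ {q}, 0 < q → G.Adj (c (q - 1)) (c q) := fun {q} hq => by
    have := hc (q - 1)
    rwa [Nat.sub_add_cancel hq] at this
  let L : Fin 3 → Set V := ![{x}, arc c i₁ i₂, arc c i₃ (i₀ + n)]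
  let R : Fin 3 → Set V := ![{y}, arc c i₀ i₁, arc c i₂ i₃]
  have hadj : ∀ i j, ∃ u ∈ L i, ∃ w ∈ R j, G.Adj u w := by
    intro i j
    fin_cases i <;> fin_cases j
    · exact ⟨x, rfl, y, rfl, hxy⟩
    · exact ⟨x, rfl, _, mem h01, h0⟩
    · exact ⟨x, rfl, _, mem h23, h2⟩
    · exact ⟨_, mem h12, y, rfl, h1.symm⟩
    · exact ⟨_, mem h12, _, mem' h01, (hc' (by omega)).symm⟩
    · exact ⟨_, mem' h12, _, mem h23, hc' (by omega)⟩
    · exact ⟨_, mem h3n, y, rfl, h3.symm⟩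
    · refine ⟨_, mem' h3n, _, mem h01, ?_⟩
      rw [← h.apply_add i₀]
      exact hc' (by omega)
    · exact ⟨_, mem h3n, _, mem' h23, (hc' (by omega)).symm⟩
  refine ⟨Sum.elim L R, ?_, ?_, ?_⟩
  · rintro (k | k) <;> fin_cases k
    exacts [induce_singleton_connected G x, arc_connected hc h12, arc_connected hc h3n,
      induce_singleton_connected G y, arc_connected hc h01, arc_connected hc h23]
  · rintro (k | k) (l | l) hkl <;> fin_cases k <;> fin_cases l <;>
      first
      | exact absurd rfl hkl
      | exact hdx _ _
      | exact hdy _ _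
      | exact hdx' _ _
      | exact hdy' _ _
      | assumption
      | (apply Disjoint.symm; assumption)
  · rintro (k | k) (l | l) hkl
    · simp at hkl
    · exact hadj k l
    · obtain ⟨u, hu, w, hw, huw⟩ := hadj l k
      exact ⟨w, hw, u, hu, huw.symm⟩
    · simp at hkl

/-- Three common spokes yield a `K₅` minor. -/
lemma IsRim.hasMinor_complete {G : SimpleGraph V} {C : V → V → ZMod 2} {c : ℕ → V} {n : ℕ}
    (h : IsRim C c n) (hc : ∀ k, G.Adj (c k) (c (k + 1))) {x y : V} (hxy : G.Adj x y)
    (hx : ∀ i, c i ≠ x) (hy : ∀ i, c i ≠ y) {i₀ i₁ i₂ : ℕ} (h01 : i₀ < i₁) (h12 : i₁ < i₂)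
    (h2n : i₂ < i₀ + n) (hX : ∀ i ∈ [i₀, i₁, i₂], G.Adj x (c i))
    (hY : ∀ i ∈ [i₀, i₁, i₂], G.Adj y (c i)) :
    HasMinor G (completeGraph (Fin 5)) := by
  simp only [List.mem_cons, List.not_mem_nil, or_false, forall_eq_or_imp, forall_eq] at hX hY
  obtain ⟨x0, x1, x2⟩ := hX
  obtain ⟨y0, y1, y2⟩ := hY
  have hd : ∀ {p q r s}, q ≤ r → s ≤ p + n → Disjoint (arc c p q) (arc c r s) := h.disjoint_arc
  have hdx := fun p q => disjoint_singleton_arc hx p q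
  have hdy := fun p q => disjoint_singleton_arc hy p q
  have hxy' : Disjoint ({x} : Set V) {y} := by simpa using hxy.ne
  have d1 := hd (p := i₀) (q := i₁) (r := i₁) (s := i₂) (by omega) (by omega)
  have d2 := hd (p := i₀) (q := i₁) (r := i₂) (s := i₀ + n) (by omega) (by omega)
  have d3 := hd (p := i₁) (q := i₂) (r := i₂) (s := i₀ + n) (by omega) (by omega)
  have mem : ∀ {p q}, p < q → c p ∈ arc c p q := fun {p q} hpq => ⟨p, le_rfl, hpq, rfl⟩
  have mem' : ∀ {p q}, p < q → c (q - 1) ∈ arc c p q := fun {p q} hpq =>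
    ⟨q - 1, by omega, by omega, rfl⟩
  have hc' : ∀ {q}, 0 < q → G.Adj (c (q - 1)) (c q) := fun {q} hq => by
    have := hc (q - 1)
    rwa [Nat.sub_add_cancel hq] at this
  let F : Fin 5 → Set V := ![{x}, {y}, arc c i₀ i₁, arc c i₁ i₂, arc c i₂ (i₀ + n)]
  have key : ∀ i j, i < j → Disjoint (F i) (F j) ∧ ∃ u ∈ F i, ∃ w ∈ F j, G.Adj u w := by
    intro i j hij
    fin_cases i <;> fin_cases j <;> first | exact absurd hij (by decide) | skip
    · exact ⟨hxy', x, rfl, y, rfl, hxy⟩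
    · exact ⟨hdx _ _, x, rfl, _, mem h01, x0⟩
    · exact ⟨hdx _ _, x, rfl, _, mem h12, x1⟩
    · exact ⟨hdx _ _, x, rfl, _, mem h2n, x2⟩
    · exact ⟨hdy _ _, y, rfl, _, mem h01, y0⟩
    · exact ⟨hdy _ _, y, rfl, _, mem h12, y1⟩
    · exact ⟨hdy _ _, y, rfl, _, mem h2n, y2⟩
    · exact ⟨d1, _, mem' h01, _, mem h12, hc' (by omega)⟩
    · refine ⟨d2, _, mem h01, _, mem' h2n, ?_⟩
      rw [← h.apply_add i₀]
      exact (hc' (by omega)).symm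
    · exact ⟨d3, _, mem' h12, _, mem h2n, hc' (by omega)⟩
  refine ⟨F, ?_, fun k l hkl => ?_, fun k l hkl => ?_⟩
  · intro k
    fin_cases k
    exacts [induce_singleton_connected G x, induce_singleton_connected G y,
      arc_connected hc h01, arc_connected hc h12, arc_connected hc h2n]
  · rcases lt_or_gt_of_ne hkl with hlt | hlt
    exacts [(key k l hlt).1, (key l k hlt).1.symm]
  · rcases lt_or_gt_of_ne hkl.ne with hlt | hlt
    · exact (key k l hlt).2
    · obtain ⟨u, hu, w, hw, huw⟩ := (key l k hlt).2
      exact ⟨w, hw, u, hu, huw.symm⟩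

/-! ### Separating the spokes of two adjacent hubs -/

namespace IsRim

variable {G : SimpleGraph V} {C : V → V → ZMod 2} {c : ℕ → V} {n : ℕ}

lemma exists_split_of_not_adj (h : IsRim C c n) (hc : ∀ k, G.Adj (c k) (c (k + 1)))
    (hG : IsPlanar G) {x y : V} (hxy : G.Adj x y) (hx : ∀ i, c i ≠ x) (hy : ∀ i, c i ≠ y)
    (hX : ∃ i j, c i ≠ c j ∧ G.Adj x (c i) ∧ G.Adj x (c j))
    {r : ℕ} (hYr : G.Adj y (c r)) (hXr : ¬ G.Adj x (c r)) :
    ∃ a b, a < b ∧ b < a + n ∧ (∀ i, a < i → i < b → ¬ G.Adj x (c i)) ∧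
      ∀ i, b < i → i < a + n → ¬ G.Adj y (c i) := by
  classical
  obtain ⟨i, j, hij, hi, hj⟩ := hX
  have hn := h.three
  obtain ⟨m₀, hm₀, hr⟩ : ∃ m₀, n ≤ m₀ ∧ c m₀ = c r := ⟨r + n, by omega, h.apply_add r⟩
  rw [← hr] at hYr hXr
  obtain ⟨m, hm₁, hm₂, hm⟩ := h.exists_index (m₀ - n) i
  have hXm : G.Adj x (c m) := hm ▸ hi
  set a := Nat.findGreatest (fun k => G.Adj x (c k)) m₀ with ha
  have hXa : G.Adj x (c a) :=
    Nat.findGreatest_spec (P := fun k => G.Adj x (c k)) (show m ≤ m₀ by omega) hXm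
  have ha₁ : a < m₀ := lt_of_le_of_ne (Nat.findGreatest_le _) fun he => hXr (he ▸ hXa)
  have ha₂ : ∀ k, a < k → k ≤ m₀ → ¬ G.Adj x (c k) := fun k hk hk' =>
    Nat.findGreatest_is_greatest hk hk'
  obtain ⟨p, hp₁, hp₂, hXp⟩ : ∃ p, a < p ∧ p < a + n ∧ G.Adj x (c p) := by
    obtain ⟨p, hp₁, hp₂, hp⟩ := h.exists_index a i
    obtain ⟨q, hq₁, hq₂, hq⟩ := h.exists_index a j
    by_cases hpa : p = a
    · refine ⟨q, lt_of_le_of_ne hq₁ ?_, hq₂, hq ▸ hj⟩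
      rintro rfl
      exact hij (by rw [← hp, ← hq, hpa])
    · exact ⟨p, by omega, hp₂, hp ▸ hi⟩
  have hp₃ : m₀ < p := by
    by_contra hle
    exact ha₂ p hp₁ (by omega) hXp
  have hex : ∃ k, m₀ < k ∧ G.Adj x (c k) := ⟨p, hp₃, hXp⟩
  obtain ⟨hb₁, hXb⟩ := Nat.find_spec hex
  have hb₂ : Nat.find hex ≤ p := Nat.find_min' hex ⟨hp₃, hXp⟩
  refine ⟨a, Nat.find hex, by omega, by omega, fun k hk₁ hk₂ hk => ?_, fun k hk₁ hk₂ hk => ?_⟩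
  · rcases le_or_gt k m₀ with hle | hlt
    · exact ha₂ k hk₁ hle hk
    · exact Nat.find_min hex hk₂ ⟨hlt, hk⟩
  · exact hG.2 (h.hasMinor_bipartite hc hxy hx hy ha₁ hb₁ hk₁ hk₂ hXa hYr hXb hk)

/-- In a planar graph, the spokes of two adjacent hubs of a cycle do not interleave. -/
lemma exists_split (h : IsRim C c n) (hc : ∀ k, G.Adj (c k) (c (k + 1)))
    (hG : IsPlanar G) {x y : V} (hxy : G.Adj x y) (hx : ∀ i, c i ≠ x) (hy : ∀ i, c i ≠ y)
    (hX : ∃ i j, c i ≠ c j ∧ G.Adj x (c i) ∧ G.Adj x (c j))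
    (hY : ∃ i j, c i ≠ c j ∧ G.Adj y (c i) ∧ G.Adj y (c j)) :
    ∃ a b, a < b ∧ b < a + n ∧ (∀ i, a < i → i < b → ¬ G.Adj x (c i)) ∧
      ∀ i, b < i → i < a + n → ¬ G.Adj y (c i) := by
  by_cases h₁ : ∃ r, G.Adj y (c r) ∧ ¬ G.Adj x (c r)
  · obtain ⟨r, hYr, hXr⟩ := h₁
    exact h.exists_split_of_not_adj hc hG hxy hx hy hX hYr hXr
  by_cases h₂ : ∃ r, G.Adj x (c r) ∧ ¬ G.Adj y (c r)
  · obtain ⟨r, hXr, hYr⟩ := h₂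
    obtain ⟨a, b, hab, hba, hY', hX'⟩ :=
      h.exists_split_of_not_adj hc hG hxy.symm hy hx hY hXr hYr
    refine ⟨b, a + n, hba, by omega, hX', fun i hi₁ hi₂ hi => ?_⟩
    refine hY' (i - n) (by omega) (by omega) ?_
    rwa [← h.apply_add, Nat.sub_add_cancel (by omega)]
  push Not at h₁ h₂
  obtain ⟨a, b, hab, hba, hXa, hXb⟩ :
      ∃ a b, a < b ∧ b < a + n ∧ G.Adj x (c a) ∧ G.Adj x (c b) := by
    obtain ⟨i, j, hij, hi, hj⟩ := hX
    obtain ⟨p, hp₁, hp₂, hp⟩ := h.exists_index 0 i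
    obtain ⟨q, hq₁, hq₂, hq⟩ := h.exists_index 0 j
    rcases lt_trichotomy p q with hpq | rfl | hpq
    · exact ⟨p, q, hpq, by omega, hp ▸ hi, hq ▸ hj⟩
    · exact absurd (hp.symm.trans hq) hij
    · exact ⟨q, p, hpq, by omega, hq ▸ hj, hp ▸ hi⟩
  refine ⟨a, b, hab, hba, fun i hi₁ hi₂ hi => ?_, fun i hi₁ hi₂ hi => ?_⟩
  · exact hG.1 (h.hasMinor_complete hc hxy hx hy hi₁ hi₂ hba
      (by simp [hXa, hi, hXb]) (by simp [h₂ _ hXa, h₂ _ hi, h₂ _ hXb]))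
  · exact hG.1 (h.hasMinor_complete hc hxy hx hy hab hi₁ hi₂
      (by simp [hXa, h₁ _ hi, hXb]) (by simp [h₂ _ hXa, hi, h₂ _ hXb]))

end IsRim

/-! ### Gluing two fans along a cycle -/

lemma triChain_hub {h u w v : V} (hu : u ≠ h) (hw : w ≠ h) (hne : triChain h u w h v ≠ 0) :
    v = u ∨ v = w := by
  rcases triChain_ne_zero hne with h' | h' | h' <;> rw [edgeChain_ne_zero] at h' <;> grind

lemma triChain_hub_self {h u w : V} (hu : u ≠ h) (hw : w ≠ h) (huw : u ≠ w) :
    triChain h u w h u = 1 := by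
  simp [triChain, edgeChain, hu, hu.symm, hw.symm, huw]

lemma triChain_rim {h u w p q : V} (hp : p ≠ h) (hq : q ≠ h) (hne : triChain h u w p q ≠ 0) :
    (p = u ∧ q = w) ∨ (p = w ∧ q = u) := by
  rcases triChain_ne_zero hne with h' | h' | h' <;> rw [edgeChain_ne_zero] at h' <;> grind

lemma triChain_off {h u w p q : V} (h₁ : p ≠ h) (h₂ : p ≠ u) (h₃ : p ≠ w) :
    triChain h u w p q = 0 := by
  by_contra hne
  rcases triChain_ne_zero hne with h' | h' | h' <;> rw [edgeChain_ne_zero] at h' <;> grind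

/-- Subtracting fan triangles, the spokes of an arc except the last one can be removed. -/
lemma IsRim.exists_clear {C : V → V → ZMod 2} {c : ℕ → V} {n : ℕ} (hc : IsRim C c n) {h : V}
    (hh : ∀ i, c i ≠ h) (z : V → V → ZMod 2) {p q : ℕ} (hpq : p ≤ q) (hq : q < p + n) :
    ∃ s ∈ Submodule.span (ZMod 2) {t | ∃ k, p ≤ k ∧ k < q ∧ t = triChain h (c k) (c (k + 1))},
      (∀ k, p ≤ k → k < q → (z - s) h (c k) = 0) ∧
      ∀ u w, u ≠ h → (∀ i, c i ≠ u) → s u w = 0 := by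
  induction q, hpq using Nat.le_induction with
  | base => exact ⟨0, zero_mem _, fun k h₁ h₂ => by omega, fun _ _ _ _ => rfl⟩
  | succ q hpq ih =>
    obtain ⟨s, hs, hs₁, hs₂⟩ := ih (by omega)
    have hne : c q ≠ c (q + 1) := fun he => by
      have := hc.eq_of_window (p := p) hpq (by omega) (by omega) hq he
      omega
    refine ⟨s + (z - s) h (c q) • triChain h (c q) (c (q + 1)), add_mem ?_ ?_, ?_, ?_⟩
    · exact Submodule.span_mono (by rintro t ⟨k, h₁, h₂, h₃⟩; exact ⟨k, h₁, by omega, h₃⟩) hs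
    · exact Submodule.smul_mem _ _ (Submodule.subset_span ⟨q, hpq, by omega, rfl⟩)
    · intro k hk₁ hk₂
      rw [← sub_sub]
      change (z - s) h (c k) - (z - s) h (c q) * triChain h (c q) (c (q + 1)) h (c k) = 0
      rcases Nat.lt_succ_iff_lt_or_eq.1 hk₂ with hlt | rfl
      · have h0 : triChain h (c q) (c (q + 1)) h (c k) = 0 := by
          by_contra hne
          rcases triChain_hub (hh _) (hh _) hne with he | he
          · have := hc.eq_of_window (p := p) hk₁ (by omega) hpq (by omega) he
            omega
          · have := hc.eq_of_window (p := p) hk₁ (by omega) (by omega) hq he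
            omega
        rw [hs₁ k hk₁ hlt, h0, mul_zero, sub_zero]
      · rw [triChain_hub_self (hh _) (hh _) hne, mul_one, sub_self]
    · intro u w hu₁ hu₂
      have h0 := triChain_off (q := w) hu₁ (hu₂ q).symm (hu₂ (q + 1)).symm
      change s u w + (z - s) h (c q) * triChain h (c q) (c (q + 1)) u w = 0
      rw [hs₂ u w hu₁ hu₂, h0, mul_zero, add_zero]

/-- `K` arises from `H` by adding two adjacent hubs `x` and `y`, joined to complementary arcs of
a cycle of `H`. -/
structure BiFan (H K : SimpleGraph V) (C : V → V → ZMod 2) (c : ℕ → V) (n : ℕ) (x y : V)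
    (a b : ℕ) : Prop where
  rim : IsRim C c n
  rim_adj : ∀ k, H.Adj (c k) (c (k + 1))
  lt : a < b
  lt_add : b < a + n
  le : H ≤ K
  adj : K.Adj x y
  spoke_left : ∀ k, b ≤ k → k ≤ a + n → K.Adj x (c k)
  spoke_right : ∀ k, a ≤ k → k ≤ b → K.Adj y (c k)
  nbr_left : ∀ w, K.Adj x w → w = y ∨ ∃ k, b ≤ k ∧ k ≤ a + n ∧ w = c k
  nbr_right : ∀ w, K.Adj y w → w = x ∨ ∃ k, a ≤ k ∧ k ≤ b ∧ w = c k
  off : ∀ u w, K.Adj u w → u ≠ x → u ≠ y → w ≠ x → w ≠ y → H.Adj u w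
  not_left : ∀ w, ¬ H.Adj x w
  not_right : ∀ w, ¬ H.Adj y w

open scoped Classical in
/-- The triangles of the two fans. -/
noncomputable def fan (c : ℕ → V) (x y : V) (b m : ℕ) : V → V → ZMod 2 :=
  triChain (if m < b then y else x) (c m) (c (m + 1))

namespace BiFan

variable {H K : SimpleGraph V} {C : V → V → ZMod 2} {c : ℕ → V} {n : ℕ} {x y : V} {a b : ℕ}

lemma ne_left (h : BiFan H K C c n x y a b) (i : ℕ) : c i ≠ x :=
  fun he => h.not_left _ (he ▸ h.rim_adj i)

lemma ne_right (h : BiFan H K C c n x y a b) (i : ℕ) : c i ≠ y :=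
  fun he => h.not_right _ (he ▸ h.rim_adj i)

lemma fan_mem [Fintype V] (h : BiFan H K C c n x y a b) {m : ℕ} (h₁ : a ≤ m) (h₂ : m < a + n) :
    fan c x y b m ∈ cycleSpace K := by
  unfold fan
  split_ifs with hm
  · exact triChain_mem (h.spoke_right m h₁ hm.le) (h.le (h.rim_adj m))
      (h.spoke_right (m + 1) (by omega) hm).symm
  · exact triChain_mem (h.spoke_left m (by omega) h₂.le) (h.le (h.rim_adj m))
      (h.spoke_left (m + 1) (by omega) h₂).symm

lemma fan_right (h : BiFan H K C c n x y a b) {m : ℕ} {w : V} (hne : fan c x y b m y w ≠ 0) :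
    m < b ∧ (w = c m ∨ w = c (m + 1)) := by
  unfold fan at hne
  split_ifs at hne with hm
  · exact ⟨hm, triChain_hub (h.ne_right _) (h.ne_right _) hne⟩
  · exact absurd (triChain_off h.adj.ne' (h.ne_right _).symm (h.ne_right _).symm) hne

lemma fan_left (h : BiFan H K C c n x y a b) {m : ℕ} {w : V} (hne : fan c x y b m x w ≠ 0) :
    b ≤ m ∧ (w = c m ∨ w = c (m + 1)) := by
  unfold fan at hne
  split_ifs at hne with hm
  · exact absurd (triChain_off h.adj.ne (h.ne_left _).symm (h.ne_left _).symm) hne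
  · exact ⟨by omega, triChain_hub (h.ne_left _) (h.ne_left _) hne⟩

lemma fan_rim {m : ℕ} {u w : V} (hux : u ≠ x) (huy : u ≠ y) (hwx : w ≠ x) (hwy : w ≠ y)
    (hne : fan c x y b m u w ≠ 0) : (u = c m ∧ w = c (m + 1)) ∨ (u = c (m + 1) ∧ w = c m) := by
  unfold fan at hne
  split_ifs at hne
  exacts [triChain_rim huy hwy hne, triChain_rim hux hwx hne]

lemma exists_clear [Fintype V] (h : BiFan H K C c n x y a b) {z : V → V → ZMod 2}
    (hz : z ∈ cycleSpace K) (P : Submodule (ZMod 2) (V → V → ZMod 2))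
    (hP : ∀ m, a ≤ m → m < a + n → fan c x y b m ∈ P) (hP' : triChain x y (c b) ∈ P)
    (hH : cycleSpace H ≤ P) : z ∈ P := by
  obtain ⟨s₁, hs₁, hc₁, -⟩ := h.rim.exists_clear h.ne_right z h.lt.le h.lt_add
  obtain ⟨s₂, hs₂, hc₂, hr₂⟩ := h.rim.exists_clear h.ne_left
    (z - s₁ - (z - s₁) y x • triChain x y (c b)) h.lt_add.le (by have := h.lt; omega)
  have hlt := h.lt
  have hlt' := h.lt_add
  have hs₁' : s₁ ∈ P ⊓ cycleSpace K := by
    refine Submodule.span_le.2 ?_ hs₁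
    rintro _ ⟨k, hk₁, hk₂, rfl⟩
    have : triChain y (c k) (c (k + 1)) = fan c x y b k := by simp [fan, hk₂]
    rw [this]
    exact ⟨hP k hk₁ (by omega), h.fan_mem hk₁ (by omega)⟩
  have hs₂' : s₂ ∈ P ⊓ cycleSpace K := by
    refine Submodule.span_le.2 ?_ hs₂
    rintro _ ⟨k, hk₁, hk₂, rfl⟩
    have : triChain x (c k) (c (k + 1)) = fan c x y b k := by
      simp [fan, hk₁.not_gt]
    rw [this]
    exact ⟨hP k (by omega) (by omega), h.fan_mem (by omega) (by omega)⟩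
  have ht : triChain x y (c b) ∈ P ⊓ cycleSpace K :=
    ⟨hP', triChain_mem h.adj (h.spoke_right b hlt.le le_rfl) (h.spoke_left b le_rfl hlt'.le).symm⟩
  set z₂ := z - s₁ - (z - s₁) y x • triChain x y (c b) with hz₂
  have hz₂K : z₂ ∈ cycleSpace K :=
    sub_mem (sub_mem hz hs₁'.2) (Submodule.smul_mem _ _ ht.2)
  have hz₃K : z₂ - s₂ ∈ cycleSpace K := sub_mem hz₂K hs₂'.2
  have htyx : triChain x y (c b) y x = 1 := by
    simp [triChain, edgeChain, h.adj.ne, h.adj.ne', (h.ne_left b).symm, (h.ne_right b).symm]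
  have hyx : z₂ y x = 0 := by
    change (z - s₁) y x - (z - s₁) y x * triChain x y (c b) y x = 0
    rw [htyx, mul_one, sub_self]
  have hrow : ∀ (z' : V → V → ZMod 2) (u w : V), z' ∈ cycleSpace K →
      (∀ v, v ≠ w → z' u v = 0) → ∀ v, z' u v = 0 := by
    intro z' u w hz' hv v
    by_cases hvw : v = w
    · by_contra hne
      obtain ⟨v', hv', hne'⟩ := exists_ne_of_sum_eq_zero ((mem_cycleSpace.1 hz').2 u) hne
      exact hne' (hv v' (hvw ▸ hv'))
    · exact hv v hvw
  have hy₂ : ∀ w, z₂ y w = 0 := by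
    refine hrow z₂ y (c b) hz₂K fun v hv => ?_
    by_contra hne
    rcases h.nbr_right v ((mem_cycleSpace.1 hz₂K).1.2 _ _ hne) with rfl | ⟨k, hk₁, hk₂, rfl⟩
    · exact hne hyx
    · have hkb : k < b := lt_of_le_of_ne hk₂ fun he => hv (he ▸ rfl)
      have h0 : triChain x y (c b) y (c k) = 0 := by
        simp [triChain, edgeChain, h.adj.ne', (h.ne_right _).symm, h.ne_left, hv]
      refine hne ?_
      change (z - s₁) y (c k) - (z - s₁) y x * triChain x y (c b) y (c k) = 0
      rw [hc₁ k hk₁ hkb, h0, mul_zero, sub_zero]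
  have hy₃ : ∀ w, (z₂ - s₂) y w = 0 := fun w => by
    change z₂ y w - s₂ y w = 0
    rw [hy₂, hr₂ y w h.adj.ne' h.ne_right, sub_zero]
  have hx₃ : ∀ w, (z₂ - s₂) x w = 0 := by
    refine hrow (z₂ - s₂) x (c (a + n)) hz₃K fun v hv => ?_
    by_contra hne
    rcases h.nbr_left v ((mem_cycleSpace.1 hz₃K).1.2 _ _ hne) with rfl | ⟨k, hk₁, hk₂, rfl⟩
    · exact hne (by rw [(mem_cycleSpace.1 hz₃K).1.1]; exact hy₃ x)
    · exact hne (hc₂ k hk₁ (lt_of_le_of_ne hk₂ fun he => hv (he ▸ rfl)))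
  have hz₃H : z₂ - s₂ ∈ cycleSpace H := by
    refine mem_cycleSpace_of_supp hz₃K fun u w huw => ?_
    have hsymm := (mem_cycleSpace.1 hz₃K).1.1
    refine h.off u w ((mem_cycleSpace.1 hz₃K).1.2 _ _ huw) ?_ ?_ ?_ ?_ <;> rintro rfl
    · exact huw (hx₃ _)
    · exact huw (hy₃ _)
    · exact huw (hsymm _ _ ▸ hx₃ _)
    · exact huw (hsymm _ _ ▸ hy₃ _)
  have hfin : z = (z₂ - s₂) + s₂ + (z - s₁) y x • triChain x y (c b) + s₁ := by
    rw [hz₂]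
    abel
  rw [hfin]
  exact add_mem (add_mem (add_mem (hH hz₃H) hs₂'.1) (Submodule.smul_mem _ _ ht.1)) hs₁'.1

open scoped Classical in
lemma card_fan_rim (h : BiFan H K C c n x y a b) {u w : V} (hux : u ≠ x) (huy : u ≠ y)
    (hwx : w ≠ x) (hwy : w ≠ y) : #{i : Fin n | fan c x y b (a + i) u w ≠ 0} ≤ 1 := by
  rw [Finset.card_le_one]
  intro i hi j hj
  simp only [Finset.mem_filter, Finset.mem_univ, true_and] at hi hj
  have hn := h.rim.three
  have hi' := i.2
  have hj' := j.2
  have hwin : ∀ p q : ℕ, a ≤ p → p < a + n → a ≤ q → q < a + n → c p = c q → p = q :=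
    fun p q h₁ h₂ h₃ h₄ => h.rim.eq_of_window h₁ h₂ h₃ h₄
  have hwin' : ∀ p q : ℕ, a + 1 ≤ p → p < a + 1 + n → a + 1 ≤ q → q < a + 1 + n → c p = c q →
      p = q := fun p q h₁ h₂ h₃ h₄ => h.rim.eq_of_window h₁ h₂ h₃ h₄
  have hi2 := fan_rim hux huy hwx hwy hi
  have hj2 := fan_rim hux huy hwx hwy hj
  have hcases : (c (a + i) = c (a + j)) ∨
      (c (a + i) = c (a + j + 1) ∧ c (a + i + 1) = c (a + j)) := by
    rcases hi2 with ⟨e₁, e₂⟩ | ⟨e₁, e₂⟩ <;> rcases hj2 with ⟨e₃, e₄⟩ | ⟨e₃, e₄⟩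
    · exact Or.inl (e₁ ▸ e₃)
    · exact Or.inr ⟨e₁ ▸ e₃, e₂ ▸ e₄⟩
    · exact Or.inr ⟨e₂ ▸ e₄, e₁ ▸ e₃⟩
    · exact Or.inl (e₂ ▸ e₄)
  rcases hcases with he | ⟨he, he'⟩
  · have := hwin _ _ (by omega) (by omega) (by omega) (by omega) he
    exact Fin.ext (by omega)
  · exfalso
    by_cases hj0 : (j : ℕ) + 1 < n
    · have h1 := hwin _ _ (by omega) (by omega) (by omega) (by omega) he
      by_cases hi0 : (i : ℕ) + 1 < n
      · have h2 := hwin _ _ (by omega) (by omega) (by omega) (by omega) he'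
        omega
      · rw [show a + (i : ℕ) + 1 = a + n by omega, h.rim.apply_add] at he'
        have h2 := hwin _ _ (by omega) (by omega) (by omega) (by omega) he'
        omega
    · rw [show a + (j : ℕ) + 1 = a + n by omega, h.rim.apply_add] at he
      have h1 := hwin _ _ (by omega) (by omega) (by omega) (by omega) he
      have h2 := hwin _ _ (by omega) (by omega) (by omega) (by omega) he'
      omega

open scoped Classical in
lemma card_eq_le_one (h : BiFan H K C c n x y a b) (e : ℕ) (w : V) :
    #{i : Fin n | w = c (a + i + e)} ≤ 1 := by
  rw [Finset.card_le_one]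
  intro i hi j hj
  simp only [Finset.mem_filter, Finset.mem_univ, true_and] at hi hj
  have := h.rim.eq_of_window (p := a + e) (by omega) (by omega) (by omega) (by omega)
    (hi.symm.trans hj)
  exact Fin.ext (by omega)

open scoped Classical in
lemma card_right (h : BiFan H K C c n x y a b) (w : V) :
    #{i : Fin n | fan c x y b (a + i) y w ≠ 0} + (if w = c b then 1 else 0) ≤ 2 := by
  have hlt := h.lt_add
  split_ifs with hw
  · have hsub : ({i : Fin n | fan c x y b (a + i) y w ≠ 0} : Finset (Fin n)) ⊆
        ({i : Fin n | w = c (a + i + 1)} : Finset (Fin n)) := by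
      intro i hi
      simp only [Finset.mem_filter, Finset.mem_univ, true_and] at hi ⊢
      obtain ⟨h₁, h₂⟩ := h.fan_right hi
      refine h₂.resolve_left fun he => ?_
      have := h.rim.eq_of_window (p := a) (by omega) (by omega) h.lt.le hlt (he.symm.trans hw)
      omega
    have := (Finset.card_le_card hsub).trans (h.card_eq_le_one 1 w)
    omega
  · have hsub : ({i : Fin n | fan c x y b (a + i) y w ≠ 0} : Finset (Fin n)) ⊆
        ({i : Fin n | w = c (a + i + 0)} : Finset (Fin n)) ∪
          ({i : Fin n | w = c (a + i + 1)} : Finset (Fin n)) := by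
      intro i hi
      simp only [Finset.mem_filter, Finset.mem_univ, true_and, Finset.mem_union] at hi ⊢
      exact (h.fan_right hi).2
    have := (Finset.card_le_card hsub).trans (Finset.card_union_le _ _)
    have h0 := h.card_eq_le_one 0 w
    have h1 := h.card_eq_le_one 1 w
    omega

open scoped Classical in
lemma card_left (h : BiFan H K C c n x y a b) (w : V) :
    #{i : Fin n | fan c x y b (a + i) x w ≠ 0} + (if w = c b then 1 else 0) ≤ 2 := by
  have hlt := h.lt
  split_ifs with hw
  · have hsub : ({i : Fin n | fan c x y b (a + i) x w ≠ 0} : Finset (Fin n)) ⊆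
        ({i : Fin n | w = c (a + i + 0)} : Finset (Fin n)) := by
      intro i hi
      simp only [Finset.mem_filter, Finset.mem_univ, true_and] at hi ⊢
      obtain ⟨h₁, h₂⟩ := h.fan_left hi
      refine h₂.resolve_right fun he => ?_
      have := h.rim.eq_of_window (p := b) (by omega) (by omega) le_rfl (by omega)
        (he.symm.trans hw)
      omega
    have := (Finset.card_le_card hsub).trans (h.card_eq_le_one 0 w)
    omega
  · have hsub : ({i : Fin n | fan c x y b (a + i) x w ≠ 0} : Finset (Fin n)) ⊆
        ({i : Fin n | w = c (a + i + 0)} : Finset (Fin n)) ∪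
          ({i : Fin n | w = c (a + i + 1)} : Finset (Fin n)) := by
      intro i hi
      simp only [Finset.mem_filter, Finset.mem_univ, true_and, Finset.mem_union] at hi ⊢
      exact (h.fan_left hi).2
    have := (Finset.card_le_card hsub).trans (Finset.card_union_le _ _)
    have h0 := h.card_eq_le_one 0 w
    have h1 := h.card_eq_le_one 1 w
    omega

lemma hasTwoFold [Fintype V] (h : BiFan H K C c n x y a b) {κ : Type} [Fintype κ]
    {g : κ → V → V → ZMod 2} (hg : TwoFold H g)
    (hg₁ : ∀ u w, C u w ≠ 0 → #{i | g i u w ≠ 0} ≤ 1) (hCs : ∀ u w, C u w = C w u) :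
    HasTwoFold K := by
  classical
  let f : (κ ⊕ Fin n) ⊕ Unit → V → V → ZMod 2 :=
    Sum.elim (Sum.elim g fun i => fan c x y b (a + i)) fun _ => triChain x y (c b)
  have hmem : ∀ i, f i ∈ cycleSpace K := by
    rintro ((i | i) | i)
    · exact cycleSpace_mono h.le (hg.mem i)
    · exact h.fan_mem (by omega) (by omega)
    · exact triChain_mem h.adj (h.spoke_right b h.lt.le le_rfl)
        (h.spoke_left b le_rfl h.lt_add.le).symm
  have hcount : ∀ u w, #{i | f i u w ≠ 0} = #{i | g i u w ≠ 0} +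
      #{i : Fin n | fan c x y b (a + i) u w ≠ 0} +
      (if triChain x y (c b) u w ≠ 0 then 1 else 0) := by
    intro u w
    simp only [Finset.card_filter, Fintype.sum_sum_type, f, Sum.elim_inl, Sum.elim_inr,
      Finset.univ_unique, Finset.sum_singleton]
    congr!
  have hsymm : ∀ u w, #{i | f i u w ≠ 0} = #{i | f i w u ≠ 0} := fun u w => by
    congr 1
    ext i
    simp only [Finset.mem_filter, Finset.mem_univ, true_and]
    rw [(mem_cycleSpace.1 (hmem i)).1.1]
  have hgz : ∀ u w, ¬ H.Adj u w → #{i | g i u w ≠ 0} = 0 := fun u w huw => by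
    rw [Finset.card_eq_zero, Finset.filter_eq_empty_iff]
    exact fun i _ hi => huw ((mem_cycleSpace.1 (hg.mem i)).1.2 _ _ hi)
  have hright : ∀ w, w ≠ x → #{i | f i y w ≠ 0} ≤ 2 := by
    intro w hw
    have h1 := h.card_right w
    have ht : triChain x y (c b) y w ≠ 0 → w = c b := fun hne => by
      rcases triChain_ne_zero hne with h' | h' | h' <;> rw [edgeChain_ne_zero] at h' <;>
        grind [h.adj.ne, h.ne_right b]
    rw [hcount, hgz _ _ (h.not_right w)]
    split_ifs at h1 ⊢ <;> first | omega | simp_all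
  have hleft : ∀ w, w ≠ y → #{i | f i x w ≠ 0} ≤ 2 := by
    intro w hw
    have h1 := h.card_left w
    have ht : triChain x y (c b) x w ≠ 0 → w = c b := fun hne => by
      rcases triChain_ne_zero hne with h' | h' | h' <;> rw [edgeChain_ne_zero] at h' <;>
        grind [h.adj.ne, h.ne_left b]
    rw [hcount, hgz _ _ (h.not_left w)]
    split_ifs at h1 ⊢ <;> first | omega | simp_all
  have hxy : #{i | f i x y ≠ 0} ≤ 2 := by
    have h0 : #{i : Fin n | fan c x y b (a + i) x y ≠ 0} = 0 := by
      rw [Finset.card_eq_zero, Finset.filter_eq_empty_iff]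
      intro i _ hi
      rcases (h.fan_left hi).2 with he | he
      exacts [h.ne_right _ he.symm, h.ne_right _ he.symm]
    rw [hcount, hgz _ _ (h.not_left y), h0]
    split_ifs <;> omega
  refine ⟨_, inferInstance, f, hmem, fun z hz => ?_, fun u w => ?_⟩
  · have hsub : ∀ i, f i ∈ Submodule.span (ZMod 2) (Set.range f) := fun i =>
      Submodule.subset_span ⟨i, rfl⟩
    refine h.exists_clear hz _ (fun m h₁ h₂ => ?_) (hsub (Sum.inr ())) (hg.span.trans ?_)
    · have := hsub (Sum.inl (Sum.inr ⟨m - a, by omega⟩))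
      simpa only [f, Sum.elim_inl, Sum.elim_inr, Nat.add_sub_cancel' h₁] using this
    · rw [Submodule.span_le]
      rintro _ ⟨i, rfl⟩
      exact hsub (Sum.inl (Sum.inl i))
  · by_cases hux : u = x
    · by_cases hwy : w = y
      · rwa [hux, hwy]
      · rw [hux]; exact hleft w hwy
    by_cases huy : u = y
    · by_cases hwx : w = x
      · rwa [huy, hwx, hsymm]
      · rw [huy]; exact hright w hwx
    by_cases hwx : w = x
    · rw [hwx, hsymm]; exact hleft u huy
    by_cases hwy : w = y
    · rw [hwy, hsymm]; exact hright u hux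
    have ht : triChain x y (c b) u w = 0 := by
      by_contra hne
      rcases triChain_ne_zero hne with h' | h' | h' <;> rw [edgeChain_ne_zero] at h' <;> grind
    rw [hcount, ht, if_neg (by simp), add_zero]
    have h1 := h.card_fan_rim hux huy hwx hwy
    by_cases hC : C u w = 0
    · have h0 : #{i : Fin n | fan c x y b (a + i) u w ≠ 0} = 0 := by
        rw [Finset.card_eq_zero, Finset.filter_eq_empty_iff]
        intro i _ hi
        rcases fan_rim hux huy hwx hwy hi with ⟨rfl, rfl⟩ | ⟨rfl, rfl⟩
        · exact h.rim.edge _ hC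
        · exact h.rim.edge _ (hCs _ _ ▸ hC)
      have := hg.le_two u w
      omega
    · have := hg₁ u w hC
      omega

end BiFan

/-! ### Planar graphs have two-fold generating families -/

/-- Two adjacent hubs `x`, `y` joined to complementary arcs of a cycle of `H`. -/
def biFanGraph (H : SimpleGraph V) (c : ℕ → V) (n : ℕ) (x y : V) (a b : ℕ) : SimpleGraph V :=
  SimpleGraph.fromRel fun u w => H.Adj u w ∨ (u = x ∧ w = y) ∨
    (u = x ∧ ∃ k, b ≤ k ∧ k ≤ a + n ∧ w = c k) ∨ (u = y ∧ ∃ k, a ≤ k ∧ k ≤ b ∧ w = c k)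

lemma biFan_biFanGraph {H : SimpleGraph V} {C : V → V → ZMod 2} {c : ℕ → V} {n : ℕ} {x y : V}
    {a b : ℕ} (h : IsRim C c n) (hc : ∀ k, H.Adj (c k) (c (k + 1))) (hab : a < b)
    (hba : b < a + n) (hxy : x ≠ y) (hx : ∀ w, ¬ H.Adj x w) (hy : ∀ w, ¬ H.Adj y w) :
    BiFan H (biFanGraph H c n x y a b) C c n x y a b := by
  have hx' : ∀ w, ¬ H.Adj w x := fun w hw => hx w hw.symm
  have hy' : ∀ w, ¬ H.Adj w y := fun w hw => hy w hw.symm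
  have hcx : ∀ i, c i ≠ x := fun i he => hx _ (he ▸ hc i)
  have hcy : ∀ i, c i ≠ y := fun i he => hy _ (he ▸ hc i)
  refine ⟨h, hc, hab, hba, ?_, ?_, ?_, ?_, ?_, ?_, ?_, hx, hy⟩
  · exact fun u w huw => (SimpleGraph.fromRel_adj _ _ _).2 ⟨huw.ne, Or.inl (Or.inl huw)⟩
  · exact (SimpleGraph.fromRel_adj _ _ _).2 ⟨hxy, Or.inl (by simp)⟩
  · intro k h₁ h₂
    exact (SimpleGraph.fromRel_adj _ _ _).2 ⟨(hcx k).symm,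
      Or.inl (Or.inr (Or.inr (Or.inl ⟨rfl, k, h₁, h₂, rfl⟩)))⟩
  · intro k h₁ h₂
    exact (SimpleGraph.fromRel_adj _ _ _).2 ⟨(hcy k).symm,
      Or.inl (Or.inr (Or.inr (Or.inr ⟨rfl, k, h₁, h₂, rfl⟩)))⟩
  · intro w hw
    obtain ⟨-, (hw | ⟨-, hw⟩ | ⟨-, hw⟩ | ⟨hw, -⟩) | (hw | ⟨-, hw⟩ | ⟨-, k, -, -, hw⟩ |
      ⟨-, k, -, -, hw⟩)⟩ := (SimpleGraph.fromRel_adj _ _ _).1 hw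
    exacts [absurd hw (hx w), Or.inl hw, Or.inr hw, absurd hw hxy, absurd hw (hx' w),
      absurd hw hxy, absurd hw.symm (hcx k), absurd hw.symm (hcx k)]
  · intro w hw
    obtain ⟨-, (hw | ⟨hw, -⟩ | ⟨hw, -⟩ | ⟨-, hw⟩) | (hw | ⟨hw, -⟩ | ⟨-, k, -, -, hw⟩ |
      ⟨-, k, -, -, hw⟩)⟩ := (SimpleGraph.fromRel_adj _ _ _).1 hw
    exacts [absurd hw (hy w), absurd hw.symm hxy, absurd hw.symm hxy, Or.inr hw,
      absurd hw (hy' w), Or.inl hw, absurd hw.symm (hcy k), absurd hw.symm (hcy k)]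
  · intro u w huw h₁ h₂ h₃ h₄
    obtain ⟨-, (hw | ⟨hw, -⟩ | ⟨hw, -⟩ | ⟨hw, -⟩) | (hw | ⟨hw, -⟩ | ⟨hw, -⟩ |
      ⟨hw, -⟩)⟩ := (SimpleGraph.fromRel_adj _ _ _).1 huw
    exacts [hw, absurd hw h₁, absurd hw h₁, absurd hw h₂, hw.symm, absurd hw h₃, absurd hw h₃,
      absurd hw h₄]

/-- The contraction of the edge `xy` onto `x`. -/
def contractEdge (G : SimpleGraph V) (x y : V) : SimpleGraph V where
  Adj u w := u ≠ w ∧ u ≠ y ∧ w ≠ y ∧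
    (G.Adj u w ∨ (u = x ∧ G.Adj y w) ∨ (w = x ∧ G.Adj y u))
  symm := ⟨fun _ _ h => ⟨h.1.symm, h.2.2.1, h.2.1, h.2.2.2.imp (fun h => h.symm) Or.symm⟩⟩
  loopless := ⟨fun _ h => h.1 rfl⟩

lemma IsPlanar.contractEdge {G : SimpleGraph V} (hG : IsPlanar G) {x y : V} (hxy : G.Adj x y) :
    IsPlanar (contractEdge G x y) := by
  refine hG.of_contract {x, y} x (Or.inl rfl) ?_ ?_ ?_ ?_
  · rw [induce_connected_iff_closed (Set.mem_insert x {y})]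
    rintro P hPx hP u (rfl | rfl)
    · exact hPx
    · exact hP _ (Or.inl rfl) _ (Or.inr rfl) hPx hxy
  · rintro u w ⟨-, hu, -⟩ (rfl | rfl)
    · rfl
    · exact absurd rfl hu
  · rintro u w ⟨-, -, -, h | ⟨h, -⟩ | ⟨h, -⟩⟩ hu hw
    exacts [h, absurd h hu, absurd h hw]
  · rintro w ⟨h, -, -, h' | ⟨-, h'⟩ | ⟨h', -⟩⟩
    exacts [⟨x, Or.inl rfl, h'⟩, ⟨y, Or.inr rfl, h'⟩, absurd h'.symm h]

open scoped Classical in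
lemma CutConn.avoidGraph {G : SimpleGraph V} {S B : Finset V} (h : CutConn G S)
    (hB : ∀ u ∈ S, u ∉ B) : CutConn (avoidGraph G B) S := fun A hA hA0 hB0 =>
  let ⟨u, hu, w, hw, huw⟩ := h A hA hA0 hB0
  ⟨u, hu, w, hw, huw, hB u (hA hu), hB w (Finset.mem_sdiff.1 hw).1⟩

section Step

variable [DecidableEq V] {G : SimpleGraph V} {U : Finset V}

lemma exists_adj_of_cutConn_sdiff {x s t : V} (h : CutConn G (U \ {s, t})) (hx : x ∈ U)
    (hxs : x ≠ s) (hxt : x ≠ t) (hc : 4 ≤ #U) : ∃ q, G.Adj x q ∧ q ≠ s ∧ q ≠ t := by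
  have hne : ((U \ {s, t}) \ {x}).Nonempty := by
    rw [← Finset.card_pos]
    have h1 := Finset.le_card_sdiff {s, t} U
    have h2 := Finset.le_card_sdiff {x} (U \ {s, t})
    have h3 := Finset.card_le_two (a := s) (b := t)
    have h4 := Finset.card_singleton x
    omega
  obtain ⟨u, hu, w, hw, huw⟩ := h {x} (by simp [hx, hxs, hxt]) ⟨x, by simp⟩
    (by convert hne)
  have hw' : w ∈ (U \ {s, t}) \ {x} := by convert hw
  rw [Finset.mem_singleton] at hu
  subst hu
  exact ⟨w, huw, (mem_sdiff_pair.1 (Finset.mem_sdiff.1 hw').1).2⟩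

lemma exists_two_adj (hU : ∀ u w, G.Adj u w → u ∈ U)
    (hsep : ∀ a ∈ U, ∀ b ∈ U, a ≠ b → CutConn G (U \ {a, b})) (hc : 4 ≤ #U) {x y : V}
    (hx : x ∈ U) (hy : y ∈ U) (hxy : x ≠ y) :
    ∃ q₁ q₂, q₁ ≠ q₂ ∧ (G.Adj x q₁ ∧ q₁ ≠ y) ∧ G.Adj x q₂ ∧ q₂ ≠ y := by
  obtain ⟨t, ht⟩ : (U \ {x, y}).Nonempty := by
    rw [← Finset.card_pos]
    have h1 := Finset.le_card_sdiff {x, y} U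
    have h3 := Finset.card_le_two (a := x) (b := y)
    omega
  obtain ⟨htU, htx, hty⟩ := mem_sdiff_pair.1 ht
  obtain ⟨q₁, h₁, h₁y, -⟩ :=
    exists_adj_of_cutConn_sdiff (hsep y hy t htU hty.symm) hx hxy htx.symm hc
  obtain ⟨q₂, h₂, h₂y, h₂q⟩ :=
    exists_adj_of_cutConn_sdiff (hsep y hy q₁ (hU _ _ h₁.symm) h₁y.symm) hx hxy h₁.ne hc
  exact ⟨q₁, q₂, h₂q.symm, ⟨h₁, h₁y⟩, h₂, h₂y⟩

lemma hub_contractEdge [Fintype V] (hU : ∀ u w, G.Adj u w → u ∈ U)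
    (hsep : ∀ a ∈ U, ∀ b ∈ U, a ≠ b → CutConn G (U \ {a, b})) (hc : 5 ≤ #U) {x y : V}
    (hxy : G.Adj x y) (hcon : ∀ z ∈ U, z ≠ x → z ≠ y → CutConn G (U \ {x, y, z}))
    {ι : Type} [Fintype ι] {f : ι → V → V → ZMod 2} (hf : TwoFold (contractEdge G x y) f)
    (h0 : ∑ i, f i = 0) :
    Hub (contractEdge G x y) (avoidGraph G {x, y}) (U \ {x, y}) x f := by
  have hx := hU x y hxy
  have hy := hU y x hxy.symm
  refine ⟨hf, h0, ?_, ?_, ?_, ?_, ?_, ?_, ?_, ?_, ?_⟩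
  · rintro u w ⟨h, hu, hw⟩
    simp only [Finset.mem_insert, Finset.mem_singleton, not_or] at hu hw
    exact ⟨h.ne, hu.2, hw.2, Or.inl h⟩
  · rintro u w ⟨-, huy, hwy, h | ⟨h, -⟩ | ⟨h, -⟩⟩ hux hwx
    exacts [⟨h, by simp [hux, huy], by simp [hwx, hwy]⟩, absurd h hux, absurd h hwx]
  · rintro u w ⟨h, hu, -⟩
    exact Finset.mem_sdiff.2 ⟨hU _ _ h, hu⟩
  · rintro u ⟨hxu, -, huy, h | ⟨-, h⟩ | ⟨h, -⟩⟩
    exacts [mem_sdiff_pair.2 ⟨hU _ _ h.symm, hxu.symm, huy⟩,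
      mem_sdiff_pair.2 ⟨hU _ _ h.symm, hxu.symm, huy⟩, absurd h.symm hxu]
  · simp
  · obtain ⟨q₁, q₂, hq, ⟨h₁, h₁'⟩, h₂, h₂'⟩ :=
      exists_two_adj hU hsep (by omega) hx hy hxy.ne
    exact ⟨q₁, q₂, hq, ⟨h₁.ne, hxy.ne, h₁', Or.inl h₁⟩, h₂.ne, hxy.ne, h₂', Or.inl h₂⟩
  · have h1 := Finset.le_card_sdiff {x, y} U
    have h3 := Finset.card_le_two (a := x) (b := y)
    omega
  · exact (hsep x hx y hy hxy.ne).avoidGraph fun u hu => (Finset.mem_sdiff.1 hu).2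
  · intro p hp
    obtain ⟨hpU, hpx, hpy⟩ := mem_sdiff_pair.1 hp
    have heq : (U \ {x, y}) \ {p} = U \ {x, y, p} := by
      ext u
      simp only [Finset.mem_sdiff, Finset.mem_insert, Finset.mem_singleton]
      tauto
    rw [heq]
    refine CutConn.avoidGraph ?_ fun u hu => ?_
    · convert hcon p hpU hpx hpy
    · rw [← heq] at hu
      exact (Finset.mem_sdiff.1 (Finset.mem_sdiff.1 hu).1).2

lemma hasTwoFold_of_contractible [Fintype V] (hG : IsPlanar G) (hU : ∀ u w, G.Adj u w → u ∈ U)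
    (hsep : ∀ a ∈ U, ∀ b ∈ U, a ≠ b → CutConn G (U \ {a, b})) (hc : 5 ≤ #U) {x y : V}
    (hxy : G.Adj x y) (hcon : ∀ z ∈ U, z ≠ x → z ≠ y → CutConn G (U \ {x, y, z}))
    (ih : HasTwoFold (contractEdge G x y)) : HasTwoFold G := by
  obtain ⟨ι, _, f, hf, h0⟩ := ih.exists_sum_zero
  have hub := hub_contractEdge hU hsep hc hxy hcon hf h0
  set H := avoidGraph G {x, y} with hH
  set C := link x f with hC
  have hCH := (mem_cycleSpace.1 hub.link_mem).1
  have hC0 : C ≠ 0 := by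
    obtain ⟨q, -, -, hq, -⟩ := hub.two
    obtain ⟨w, hw⟩ := hub.exists_link_of_adj hq
    intro hn
    exact hw (by rw [← hC, hn]; rfl)
  obtain ⟨c, n, hrim⟩ := exists_isRim hub.link_mem hC0 fun D hD hD0 hDC =>
    hub.link_minimal hD hD0 hDC
  have hcH : ∀ k, H.Adj (c k) (c (k + 1)) := fun k => hCH.2 _ _ (hrim.edge k)
  have hcG : ∀ k, G.Adj (c k) (c (k + 1)) := fun k => (hcH k).1
  have hHx : ∀ w, ¬ H.Adj x w := fun w h => h.2.1 (by simp)
  have hHy : ∀ w, ¬ H.Adj y w := fun w h => h.2.1 (by simp)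
  have hcx : ∀ i, c i ≠ x := fun i he => hHx _ (he ▸ hcH i)
  have hcy : ∀ i, c i ≠ y := fun i he => hHy _ (he ▸ hcH i)
  have hrange : ∀ w, (contractEdge G x y).Adj x w → ∃ i, w = c i := by
    intro w hw
    obtain ⟨w', hw'⟩ := hub.exists_link_of_adj hw
    obtain ⟨k, ⟨h, -⟩ | ⟨h, -⟩⟩ := hrim.exists_edge _ _ hw'
    exacts [⟨k, h⟩, ⟨k + 1, h⟩]
  have hrx : ∀ w, G.Adj x w → w ≠ y → ∃ i, w = c i := fun w hw hwy =>
    hrange w ⟨hw.ne, hxy.ne, hwy, Or.inl hw⟩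
  have hry : ∀ w, G.Adj y w → w ≠ x → ∃ i, w = c i := fun w hw hwx =>
    hrange w ⟨hwx.symm, hxy.ne, hw.ne', Or.inr (Or.inl ⟨rfl, hw⟩)⟩
  have hX : ∃ i j, c i ≠ c j ∧ G.Adj x (c i) ∧ G.Adj x (c j) := by
    obtain ⟨q₁, q₂, hq, ⟨h₁, h₁'⟩, h₂, h₂'⟩ :=
      exists_two_adj hU hsep (by omega) (hU _ _ hxy) (hU _ _ hxy.symm) hxy.ne
    obtain ⟨i, rfl⟩ := hrx _ h₁ h₁'
    obtain ⟨j, rfl⟩ := hrx _ h₂ h₂'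
    exact ⟨i, j, hq, h₁, h₂⟩
  have hY : ∃ i j, c i ≠ c j ∧ G.Adj y (c i) ∧ G.Adj y (c j) := by
    obtain ⟨q₁, q₂, hq, ⟨h₁, h₁'⟩, h₂, h₂'⟩ :=
      exists_two_adj hU hsep (by omega) (hU _ _ hxy.symm) (hU _ _ hxy) hxy.ne'
    obtain ⟨i, rfl⟩ := hry _ h₁ h₁'
    obtain ⟨j, rfl⟩ := hry _ h₂ h₂'
    exact ⟨i, j, hq, h₁, h₂⟩
  obtain ⟨a, b, hab, hba, hXab, hYab⟩ := hrim.exists_split hcG hG hxy hcx hcy hX hY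
  have hfan := biFan_biFanGraph hrim hcH hab hba hxy.ne hHx hHy
  obtain ⟨κ, _, g, hg, hg₁⟩ := hub.exists_family
  refine (hfan.hasTwoFold hg hg₁ hCH.1).mono ?_
  have hKx : ∀ w, G.Adj x w → (biFanGraph H c n x y a b).Adj x w := by
    intro w hw
    by_cases hwy : w = y
    · exact hwy ▸ hfan.adj
    obtain ⟨i, rfl⟩ := hrx w hw hwy
    obtain ⟨m, hm₁, hm₂, hm⟩ := hrim.exists_index b i
    rw [← hm] at hw ⊢
    refine hfan.spoke_left m hm₁ ?_
    by_contra hlt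
    refine hXab (m - n) (by omega) (by omega) ?_
    rwa [← hrim.apply_add, Nat.sub_add_cancel (by omega)]
  have hKy : ∀ w, G.Adj y w → (biFanGraph H c n x y a b).Adj y w := by
    intro w hw
    by_cases hwx : w = x
    · exact hwx ▸ hfan.adj.symm
    obtain ⟨i, rfl⟩ := hry w hw hwx
    obtain ⟨m, hm₁, hm₂, hm⟩ := hrim.exists_index a i
    rw [← hm] at hw ⊢
    refine hfan.spoke_right m hm₁ ?_
    by_contra hlt
    exact hYab m (by omega) hm₂ hw
  intro u w huw
  by_cases hux : u = x
  · exact hux ▸ hKx w (hux ▸ huw)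
  by_cases huy : u = y
  · exact huy ▸ hKy w (huy ▸ huw)
  by_cases hwx : w = x
  · subst hwx
    exact (hKx u huw.symm).symm
  by_cases hwy : w = y
  · subst hwy
    exact (hKy u huw.symm).symm
  exact hfan.le ⟨huw, by simp [hux, huy], by simp [hwx, hwy]⟩

end Step

theorem IsPlanar.hasTwoFold_of_supp [Fintype V] (U : Finset V) :
    ∀ G : SimpleGraph V, (∀ u w, G.Adj u w → u ∈ U) → IsPlanar G → HasTwoFold G := by
  classical
  induction U using Finset.strongInduction with
  | H U ih =>
    intro G hU hG
    rcases (by omega : #U ≤ 2 ∨ #U = 3 ∨ #U = 4 ∨ 5 ≤ #U) with hc | hc | hc | hc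
    · exact .of_card_le_two hU hc
    · exact .of_card_eq_three hU hc
    · exact .of_card_eq_four hU hc
    rcases cutConn_or_hasTwoFold hU hG fun U' G' h₁ h₂ h₃ => ih U' h₁ G' h₂ h₃ with h | hsep
    · exact h
    obtain ⟨x, y, hxy, hcon⟩ := exists_contractible hU
      (fun a ha b hb hab => by convert hsep a ha b hb hab) (by omega)
    refine hasTwoFold_of_contractible hG hU hsep hc hxy
      (fun z hz h₁ h₂ => by convert hcon z hz h₁ h₂) ?_
    have hx := hU _ _ hxy
    have hy := hU _ _ hxy.symm
    refine ih (U.erase y) (Finset.erase_ssubset hy) _ ?_ (hG.contractEdge hxy)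
    rintro u w ⟨-, huy, -, h | ⟨rfl, -⟩ | ⟨-, h⟩⟩
    exacts [Finset.mem_erase.2 ⟨huy, hU _ _ h⟩, Finset.mem_erase.2 ⟨huy, hx⟩,
      Finset.mem_erase.2 ⟨huy, hU _ _ h.symm⟩]

/-- Every planar graph satisfies the easy direction of Mac Lane's criterion. -/
theorem IsPlanar.hasTwoFold [Fintype V] {G : SimpleGraph V} (hG : IsPlanar G) : HasTwoFold G :=
  IsPlanar.hasTwoFold_of_supp Finset.univ G (fun _ _ _ => Finset.mem_univ _) hG

/-! ### Euler's inequality -/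

open scoped Classical in
/-- The even set with prescribed values on edges. -/
noncomputable def edgeFun (G : SimpleGraph V) :
    (G.edgeSet → ZMod 2) →ₗ[ZMod 2] (V → V → ZMod 2) where
  toFun φ u w := if h : G.Adj u w then φ ⟨s(u, w), h⟩ else 0
  map_add' φ ψ := by
    ext u w
    by_cases h : G.Adj u w <;> simp [h]
  map_smul' r φ := by
    ext u w
    by_cases h : G.Adj u w <;> simp [h]

lemma edgeFun_mem (G : SimpleGraph V) (φ : G.edgeSet → ZMod 2) : edgeFun G φ ∈ chains G := by
  refine ⟨fun u w => ?_, fun u w h => ?_⟩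
  · by_cases h : G.Adj u w
    · simp only [edgeFun, LinearMap.coe_mk, AddHom.coe_mk, h, h.symm, dite_true, Sym2.eq_swap]
    · have h' : ¬ G.Adj w u := fun h' => h h'.symm
      simp [edgeFun, h, h']
  · by_contra hn
    exact h (by simp [edgeFun, hn])

lemma edgeFun_injective (G : SimpleGraph V) : Function.Injective (edgeFun G) := by
  intro φ ψ h
  ext ⟨e, he⟩
  induction e with
  | _ u w =>
    have := congrFun (congrFun h u) w
    have h' : G.Adj u w := he
    simpa [edgeFun, h'] using this

lemma sum_boundary_eq_zero [Fintype V] {G : SimpleGraph V} {z : V → V → ZMod 2}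
    (hz : z ∈ chains G) : ∑ u, boundary z u = 0 := by
  simp only [boundary_apply]
  exact sum_symm_eq_zero hz.1 (chain_diag hz) Finset.univ

lemma card_edge_add_one_le_finrank [Fintype V] [Nonempty V] (G : SimpleGraph V)
    [Fintype G.edgeSet] :
    Fintype.card G.edgeSet + 1 ≤ Fintype.card V + Module.finrank (ZMod 2) (cycleSpace G) := by
  classical
  let B := (boundary (V := V)).comp (edgeFun G)
  let σ : (V → ZMod 2) →ₗ[ZMod 2] ZMod 2 := ∑ u, LinearMap.proj u
  have hσ : ∀ φ, σ φ = ∑ u, φ u := fun φ => by simp [σ]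
  have hlt : Module.finrank (ZMod 2) (LinearMap.range B) < Fintype.card V := by
    rw [← Module.finrank_fintype_fun_eq_card (ZMod 2)]
    refine Submodule.finrank_lt fun htop => ?_
    obtain ⟨u⟩ := ‹Nonempty V›
    have hu : Pi.single u 1 ∈ LinearMap.range B := htop ▸ Submodule.mem_top
    obtain ⟨φ, hφ⟩ := hu
    have h0 := sum_boundary_eq_zero (edgeFun_mem G φ)
    have : σ (B φ) = 0 := (hσ _).trans h0
    rw [hφ, hσ] at this
    simp at this
  have hrn := LinearMap.finrank_range_add_finrank_ker B
  rw [Module.finrank_fintype_fun_eq_card] at hrn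
  have hle : Module.finrank (ZMod 2) (LinearMap.ker B) ≤
      Module.finrank (ZMod 2) (cycleSpace G) := by
    rw [(Submodule.equivMapOfInjective (edgeFun G) (edgeFun_injective G) _).finrank_eq]
    refine Submodule.finrank_mono ?_
    rintro _ ⟨φ, hφ, rfl⟩
    exact ⟨edgeFun_mem G φ, hφ⟩
  omega

open scoped Classical in
lemma TwoFold.card_edge_add_one_le [Fintype V] [Nonempty V] {G : SimpleGraph V}
    [Fintype G.edgeSet] {ι : Type} [Fintype ι] {f : ι → V → V → ZMod 2} (h : TwoFold G f) :
    Fintype.card G.edgeSet + 1 ≤ Fintype.card V + #{i | f i ≠ 0} := by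
  refine (card_edge_add_one_le_finrank G).trans (Nat.add_le_add_left ?_ _)
  let s : Finset (V → V → ZMod 2) := ({i | f i ≠ 0} : Finset ι).image f
  have hspan : cycleSpace G ≤ Submodule.span (ZMod 2) (s : Set (V → V → ZMod 2)) := by
    refine h.span.trans (Submodule.span_le.2 ?_)
    rintro _ ⟨i, rfl⟩
    by_cases hi : f i = 0
    · rw [hi]; exact zero_mem _
    · exact Submodule.subset_span (Finset.mem_coe.2 (Finset.mem_image.2 ⟨i, by simp [hi], rfl⟩))
  exact (Submodule.finrank_mono hspan).trans
    ((finrank_span_finset_le_card s).trans Finset.card_image_le)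

/-! ### Short faces -/

open scoped Classical in
/-- The number of darts of an edge set. -/
noncomputable def numDarts [Fintype V] (z : V → V → ZMod 2) : ℕ :=
  #{p : V × V | z p.1 p.2 ≠ 0}

section Darts

variable [Fintype V] {G : SimpleGraph V} {z : V → V → ZMod 2}

lemma length_le_numDarts {l : List (V × V)} (hl : l.Nodup) (h : ∀ p ∈ l, z p.1 p.2 ≠ 0) :
    l.length ≤ numDarts z := by
  classical
  rw [← List.toFinset_card_of_nodup hl]
  exact Finset.card_le_card fun p hp => by simpa using h p (List.mem_toFinset.1 hp)

lemma exists_triangle_of_numDarts_lt (hz : z ∈ cycleSpace G) (hN : numDarts z < 8) {u v : V}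
    (huv : z u v ≠ 0) : ∃ y, z v y ≠ 0 ∧ z y u ≠ 0 := by
  obtain ⟨hc, hb⟩ := mem_cycleSpace.1 hz
  have hs : ∀ {p q}, z p q ≠ 0 → z q p ≠ 0 := fun h => chain_symm_ne hc h
  have hne : ∀ {p q}, z p q ≠ 0 → p ≠ q := fun h => (hc.2 _ _ h).ne
  obtain ⟨y, hyv, hy⟩ := exists_ne_of_sum_eq_zero (hb u) huv
  obtain ⟨w, hwu, hw⟩ := exists_ne_of_sum_eq_zero (hb v) (hs huv)
  by_cases hyw : y = w
  · exact ⟨y, hyw ▸ hw, hs hy⟩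
  obtain ⟨q, hqu, hq⟩ := exists_ne_of_sum_eq_zero (hb y) (hs hy)
  exfalso
  have huv' := hne huv
  have hyu' := hne hy
  have hwv' := hne hw
  have hyq' := hne hq
  have := length_le_numDarts (z := z)
    (l := [(u, v), (v, u), (u, y), (y, u), (v, w), (w, v), (y, q), (q, y)])
    (by simp; grind) (by simp [huv, hs huv, hy, hs hy, hw, hs hw, hq, hs hq])
  simp at this
  omega

lemma six_le_numDarts (hz : z ∈ cycleSpace G) (h0 : z ≠ 0) : 6 ≤ numDarts z := by
  by_contra! hN
  obtain ⟨hc, hb⟩ := mem_cycleSpace.1 hz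
  have hs : ∀ {p q}, z p q ≠ 0 → z q p ≠ 0 := fun h => chain_symm_ne hc h
  have hne : ∀ {p q}, z p q ≠ 0 → p ≠ q := fun h => (hc.2 _ _ h).ne
  obtain ⟨u, v, huv⟩ : ∃ u v, z u v ≠ 0 := by
    by_contra! hn
    exact h0 (by ext u v; exact hn u v)
  obtain ⟨y, hvy, hyu⟩ := exists_triangle_of_numDarts_lt hz (by omega) huv
  have h1 := hne huv
  have h2 := hne hvy
  have h3 := hne hyu
  have := length_le_numDarts (z := z) (l := [(u, v), (v, u), (v, y), (y, v), (y, u), (u, y)])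
    (by simp; grind) (by simp [huv, hs huv, hvy, hs hvy, hyu, hs hyu])
  simp at this
  omega

lemma triangle_unique_of_numDarts_lt (hz : z ∈ cycleSpace G) (hN : numDarts z < 8) {u v y y' : V}
    (huv : z u v ≠ 0) (hvy : z v y ≠ 0) (hyu : z y u ≠ 0) (hvy' : z v y' ≠ 0) (hyu' : z y' u ≠ 0) :
    y = y' := by
  by_contra hyy
  obtain ⟨hc, hb⟩ := mem_cycleSpace.1 hz
  have hs : ∀ {p q}, z p q ≠ 0 → z q p ≠ 0 := fun h => chain_symm_ne hc h
  have hne : ∀ {p q}, z p q ≠ 0 → p ≠ q := fun h => (hc.2 _ _ h).ne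
  have h1 := hne huv
  have h2 := hne hvy
  have h3 := hne hyu
  have h4 := hne hvy'
  have h5 := hne hyu'
  have := length_le_numDarts (z := z)
    (l := [(u, v), (v, u), (v, y), (y, v), (y, u), (u, y), (v, y'), (y', v)])
    (by simp; grind) (by simp [huv, hs huv, hvy, hs hvy, hyu, hs hyu, hvy', hs hvy'])
  simp at this
  omega

end Darts

/-! ### Triangle systems -/

/-- A weighting of triples of vertices, modelling the number of triangular faces with these
vertices. -/
structure TriangleSystem [Fintype V] (G : SimpleGraph V) (τ : V → V → V → ℕ) : Prop where
  swap : ∀ u v w, τ u v w = τ v u w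
  rotate : ∀ u v w, τ u v w = τ v w u
  adj : ∀ u v w, τ u v w ≠ 0 → G.Adj u v
  sum_le : ∀ u v, ∑ w, τ u v w ≤ 2

open scoped Classical in
/-- The number of triangular members of `f` with vertices `u`, `v`, `w`. -/
noncomputable def triCount [Fintype V] {ι : Type} [Fintype ι] (f : ι → V → V → ZMod 2)
    (u v w : V) : ℕ :=
  #{i | numDarts (f i) < 8 ∧ f i u v ≠ 0 ∧ f i v w ≠ 0 ∧ f i w u ≠ 0}

namespace TwoFold

variable [Fintype V] {G : SimpleGraph V} {ι : Type} [Fintype ι] {f : ι → V → V → ZMod 2}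

open scoped Classical in
lemma sum_triCount (h : TwoFold G f) (u v : V) :
    ∑ w, triCount f u v w = #{i | numDarts (f i) < 8 ∧ f i u v ≠ 0} := by
  simp only [triCount, Finset.card_filter]
  rw [Finset.sum_comm]
  refine Finset.sum_congr rfl fun i _ => ?_
  split_ifs with hi
  · obtain ⟨y, hy, hy'⟩ := exists_triangle_of_numDarts_lt (h.mem i) hi.1 hi.2
    rw [Finset.sum_eq_single y, if_pos ⟨hi.1, hi.2, hy, hy'⟩]
    · intro w _ hw
      refine if_neg fun hn => hw ?_
      exact triangle_unique_of_numDarts_lt (h.mem i) hi.1 hi.2 hn.2.2.1 hn.2.2.2 hy hy'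
    · simp
  · exact Finset.sum_eq_zero fun w _ => if_neg fun hn => hi ⟨hn.1, hn.2.1⟩

lemma triangleSystem (h : TwoFold G f) : TriangleSystem G (triCount f) := by
  classical
  have hs : ∀ i u v, f i u v ≠ 0 ↔ f i v u ≠ 0 := fun i u v => by
    rw [(mem_cycleSpace.1 (h.mem i)).1.1]
  refine ⟨fun u v w => ?_, fun u v w => ?_, fun u v w hne => ?_, fun u v => ?_⟩
  · unfold triCount
    congr 1
    ext i
    simp only [Finset.mem_filter, Finset.mem_univ, true_and]
    rw [hs i u v, hs i v w, hs i w u]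
    tauto
  · unfold triCount
    congr 1
    ext i
    simp only [Finset.mem_filter, Finset.mem_univ, true_and]
    tauto
  · obtain ⟨i, hi⟩ := Finset.card_ne_zero.1 hne
    exact (mem_cycleSpace.1 (h.mem i)).1.2 _ _ (Finset.mem_filter.1 hi).2.2.1
  · rw [h.sum_triCount]
    refine (Finset.card_le_card fun i hi => ?_).trans (h.le_two u v)
    simp only [Finset.mem_filter, Finset.mem_univ, true_and] at hi ⊢
    exact hi.2

lemma charge_le [Nonempty V] [DecidableRel G.Adj] (h : TwoFold G f) :
    ∑ v, (((G.degree v : ℚ) - 6) +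
      ∑ u ∈ G.neighborFinset v, (1 / 4 : ℚ) * (2 - ∑ w, (triCount f v u w : ℚ))) ≤ -6 := by
  classical
  have hE := h.card_edge_add_one_le
  have hdeg : ∑ v, (G.degree v : ℚ) = 2 * Fintype.card G.edgeSet := by
    have := G.sum_degrees_eq_twice_card_edges
    rw [← SimpleGraph.edgeFinset_card]
    exact_mod_cast this
  have hnum : ∀ i, (numDarts (f i) : ℚ) =
      ∑ v, ∑ u ∈ G.neighborFinset v, if f i v u ≠ 0 then 1 else 0 := by
    intro i
    rw [numDarts, Finset.card_filter, Fintype.sum_prod_type]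
    push_cast
    refine Finset.sum_congr rfl fun v _ => ?_
    symm
    refine Finset.sum_subset (Finset.subset_univ _) fun u _ hu => if_neg fun hne => hu ?_
    rw [SimpleGraph.mem_neighborFinset]
    exact (mem_cycleSpace.1 (h.mem i)).1.2 _ _ hne
  have hface : ∀ i, (if f i ≠ 0 then (6 : ℚ) else 0) ≤
      ∑ v, ∑ u ∈ G.neighborFinset v, if f i v u ≠ 0 then
        (if numDarts (f i) < 8 then (1 : ℚ) else 3 / 4) else 0 := by
    intro i
    have hmul : (∑ v, ∑ u ∈ G.neighborFinset v, if f i v u ≠ 0 then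
        (if numDarts (f i) < 8 then (1 : ℚ) else 3 / 4) else 0) =
        (if numDarts (f i) < 8 then (1 : ℚ) else 3 / 4) * numDarts (f i) := by
      rw [hnum, Finset.mul_sum]
      refine Finset.sum_congr rfl fun v _ => ?_
      rw [Finset.mul_sum]
      exact Finset.sum_congr rfl fun u _ => by simp
    rw [hmul]
    split_ifs with h1 h2 h2
    · have : (6 : ℚ) ≤ numDarts (f i) := by exact_mod_cast six_le_numDarts (h.mem i) h1
      linarith
    · have : (8 : ℚ) ≤ numDarts (f i) := by exact_mod_cast not_lt.1 h2
      linarith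
    · positivity
    · positivity
  have hdart : ∀ v u, (∑ i, if f i v u ≠ 0 then
        (if numDarts (f i) < 8 then (1 : ℚ) else 3 / 4) else 0) ≤
      3 / 2 + (1 / 4) * ∑ w, (triCount f v u w : ℚ) := by
    intro v u
    have h1 : (∑ w, (triCount f v u w : ℚ)) =
        ∑ i, if numDarts (f i) < 8 ∧ f i v u ≠ 0 then (1 : ℚ) else 0 := by
      have := h.sum_triCount v u
      rw [Finset.card_filter] at this
      exact_mod_cast this
    have h2 : (∑ i, if f i v u ≠ 0 then (1 : ℚ) else 0) ≤ 2 := by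
      have := h.le_two v u
      rw [Finset.card_filter] at this
      exact_mod_cast this
    have h3 : (∑ i, if f i v u ≠ 0 then
        (if numDarts (f i) < 8 then (1 : ℚ) else 3 / 4) else 0) =
        3 / 4 * (∑ i, if f i v u ≠ 0 then (1 : ℚ) else 0) +
        1 / 4 * ∑ i, if numDarts (f i) < 8 ∧ f i v u ≠ 0 then (1 : ℚ) else 0 := by
      rw [Finset.mul_sum, Finset.mul_sum, ← Finset.sum_add_distrib]
      refine Finset.sum_congr rfl fun i _ => ?_
      by_cases ha : f i v u ≠ 0 <;> by_cases hb : numDarts (f i) < 8 <;> simp [ha, hb]; norm_num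
    rw [h1, h3]
    linarith
  have hF : (6 : ℚ) * #{i | f i ≠ 0} ≤ ∑ v, ∑ u ∈ G.neighborFinset v,
      (3 / 2 + (1 / 4) * ∑ w, (triCount f v u w : ℚ)) := by
    calc (6 : ℚ) * #{i | f i ≠ 0} = ∑ i, if f i ≠ 0 then (6 : ℚ) else 0 := by
          rw [← Finset.sum_filter, Finset.sum_const, nsmul_eq_mul, mul_comm]
      _ ≤ ∑ i, ∑ v, ∑ u ∈ G.neighborFinset v, if f i v u ≠ 0 then
            (if numDarts (f i) < 8 then (1 : ℚ) else 3 / 4) else 0 :=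
          Finset.sum_le_sum fun i _ => hface i
      _ = ∑ v, ∑ u ∈ G.neighborFinset v, ∑ i, if f i v u ≠ 0 then
            (if numDarts (f i) < 8 then (1 : ℚ) else 3 / 4) else 0 := by
          rw [Finset.sum_comm]
          exact Finset.sum_congr rfl fun v _ => Finset.sum_comm
      _ ≤ _ := Finset.sum_le_sum fun v _ => Finset.sum_le_sum fun u _ => hdart v u
  have hE' : (Fintype.card G.edgeSet : ℚ) + 1 ≤ Fintype.card V + #{i | f i ≠ 0} := by
    exact_mod_cast hE
  have htot : ∑ v, (((G.degree v : ℚ) - 6) +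
      ∑ u ∈ G.neighborFinset v, (1 / 4 : ℚ) * (2 - ∑ w, (triCount f v u w : ℚ))) =
      3 * (∑ v, (G.degree v : ℚ)) - 6 * Fintype.card V - ∑ v, ∑ u ∈ G.neighborFinset v,
      (3 / 2 + (1 / 4) * ∑ w, (triCount f v u w : ℚ)) := by
    have hc : (6 : ℚ) * Fintype.card V = ∑ _v : V, (6 : ℚ) := by
      simp [mul_comm]
    rw [hc, Finset.mul_sum, ← Finset.sum_sub_distrib, ← Finset.sum_sub_distrib]
    refine Finset.sum_congr rfl fun v _ => ?_
    have hd : (G.degree v : ℚ) = ∑ u ∈ G.neighborFinset v, (1 : ℚ) := by simp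
    have : ∑ u ∈ G.neighborFinset v, (1 / 4 : ℚ) * (2 - ∑ w, (triCount f v u w : ℚ)) =
        2 * (G.degree v : ℚ) - ∑ u ∈ G.neighborFinset v,
          (3 / 2 + (1 / 4) * ∑ w, (triCount f v u w : ℚ)) := by
      rw [hd, Finset.mul_sum, ← Finset.sum_sub_distrib]
      exact Finset.sum_congr rfl fun u _ => by ring
    rw [this]
    ring
  rw [htot, hdeg]
  linarith

end TwoFold

/-- A nonempty planar graph has a system of triangular faces for which the total charge is
negative. -/
theorem IsPlanar.exists_triangleSystem [Fintype V] [Nonempty V] {G : SimpleGraph V}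
    [DecidableRel G.Adj] (hG : IsPlanar G) : ∃ τ, TriangleSystem G τ ∧
    ∑ v, (((G.degree v : ℚ) - 6) +
      ∑ u ∈ G.neighborFinset v, (1 / 4 : ℚ) * (2 - ∑ w, (τ v u w : ℚ))) < 0 := by
  obtain ⟨ι, _, f, hf⟩ := hG.hasTwoFold
  exact ⟨_, hf.triangleSystem, hf.charge_le.trans_lt (by norm_num)⟩

/-! ### Discharging -/

section Discharging

variable [Fintype V] (G : SimpleGraph V) [DecidableRel G.Adj]

/-- The charge which a vertex sends along each of its edges. -/
def sent (x : V) : ℚ :=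
  if G.degree x ≤ 5 then 0 else min (1 / 2) (1 - 6 / G.degree x)

/-- The indicator of the vertices of degree at most five. -/
def small (x : V) : ℚ :=
  if G.degree x ≤ 5 then 1 else 0

/-- The charge which `v` obtains through its neighbor `u`. -/
def received (τ : V → V → V → ℕ) (v u : V) : ℚ :=
  sent G u + sent G u / 2 * ∑ y, (1 - small G y) * τ v u y + (1 / 4) * (2 - ∑ y, (τ v u y : ℚ))

variable {G}

lemma sent_le (x : V) : sent G x ≤ 1 / 2 := by
  unfold sent
  split_ifs
  · norm_num
  · exact min_le_left _ _

lemma le_sent {x : V} {d : ℕ} (hd : 6 ≤ d) (h : d ≤ G.degree x) {c : ℚ} (hc : c ≤ 1 / 2)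
    (hcd : c ≤ 1 - 6 / d) : c ≤ sent G x := by
  have h5 : ¬ G.degree x ≤ 5 := by omega
  rw [sent, if_neg h5]
  refine le_min hc (hcd.trans ?_)
  have : (0 : ℚ) < d := by exact_mod_cast (by omega : 0 < d)
  gcongr

lemma sent_nonneg (x : V) : 0 ≤ sent G x := by
  by_cases h : G.degree x ≤ 5
  · simp [sent, h]
  · exact le_sent le_rfl (by omega) (by norm_num) (by norm_num)

lemma small_nonneg (x : V) : 0 ≤ small G x := by
  unfold small
  split_ifs <;> norm_num

lemma small_le_one (x : V) : small G x ≤ 1 := by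
  unfold small
  split_ifs <;> norm_num

lemma degree_mul_sent_le (x : V) :
    G.degree x * sent G x ≤ (1 - small G x) * ((G.degree x : ℚ) - 6) := by
  unfold sent small
  split_ifs with h
  · simp
  · have hd : (0 : ℚ) < G.degree x := by exact_mod_cast (by omega : 0 < G.degree x)
    calc (G.degree x : ℚ) * min (1 / 2) (1 - 6 / (G.degree x : ℚ))
        ≤ G.degree x * (1 - 6 / G.degree x) := by gcongr; exact min_le_right _ _
      _ = (1 - 0) * ((G.degree x : ℚ) - 6) := by field_simp; ring

namespace TriangleSystem

variable {τ : V → V → V → ℕ}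

lemma adj_third {G : SimpleGraph V} (h : TriangleSystem G τ) {u v w : V} (hne : τ u v w ≠ 0) :
    G.Adj u w :=
  h.adj u w v (by rwa [← h.rotate, h.swap])

lemma sum_le_two {G : SimpleGraph V} (h : TriangleSystem G τ) (u v : V) :
    ∑ w, (τ u v w : ℚ) ≤ 2 := by
  exact_mod_cast h.sum_le u v

lemma sent_le_received (h : TriangleSystem G τ) (v u : V) : sent G u ≤ received G τ v u := by
  have h1 : 0 ≤ sent G u * ∑ y, (1 - small G y) * (τ v u y : ℚ) :=
    mul_nonneg (sent_nonneg u) (Finset.sum_nonneg fun y _ =>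
      mul_nonneg (by linarith [small_le_one (G := G) y]) (by positivity))
  have h2 := h.sum_le_two v u
  unfold received
  linarith

lemma received_nonneg (h : TriangleSystem G τ) (v u : V) : 0 ≤ received G τ v u :=
  (sent_nonneg u).trans (h.sent_le_received v u)

/-- A lower bound for the charge received through a neighbor `u` of `v` when all but `t` of the
triangles on the edge have a third vertex of degree at least six. -/
lemma le_received (h : TriangleSystem G τ) {v u : V} {t : ℚ}
    (ht : ∑ y, (τ v u y : ℚ) - t ≤ ∑ y, (1 - small G y) * (τ v u y : ℚ)) :
    sent G u * (2 - t / 2) ≤ received G τ v u := by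
  have h1 := mul_le_mul_of_nonneg_left ht (sent_nonneg (G := G) u)
  have h2 := h.sum_le_two v u
  have h3 := sent_le (G := G) u
  have h4 := mul_nonneg (sub_nonneg.2 h2) (sub_nonneg.2 h3)
  unfold received
  nlinarith

lemma one_sub_small_mul (h : TriangleSystem G τ) {v u y : V} (hy : G.Adj v y → 6 ≤ G.degree y) :
    (1 - small G y) * (τ v u y : ℚ) = τ v u y := by
  by_cases h0 : τ v u y = 0
  · simp [h0]
  · have h6 := hy (h.adj_third h0)
    have h5 : ¬ G.degree y ≤ 5 := by omega
    simp [small, h5]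

lemma le_received_of_big (h : TriangleSystem G τ) {v u : V}
    (hv : ∀ y, G.Adj v y → 6 ≤ G.degree y) : 2 * sent G u ≤ received G τ v u := by
  have := h.le_received (v := v) (u := u) (t := 0) (by
    rw [sub_zero]
    exact Finset.sum_le_sum fun y _ => (h.one_sub_small_mul (hv y)).ge)
  linarith

lemma le_received_of_big_of_ne (h : TriangleSystem G τ) {v u a : V}
    (hv : ∀ y, G.Adj v y → y ≠ a → 6 ≤ G.degree y) :
    sent G u * (2 - τ v u a / 2) ≤ received G τ v u := by
  classical
  refine h.le_received ?_
  rw [← Finset.add_sum_erase _ _ (Finset.mem_univ a),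
    ← Finset.add_sum_erase _ (fun y => (1 - small G y) * (τ v u y : ℚ)) (Finset.mem_univ a)]
  have h1 : 0 ≤ (1 - small G a) * (τ v u a : ℚ) :=
    mul_nonneg (by linarith [small_le_one (G := G) a]) (by positivity)
  have h2 : ∑ y ∈ Finset.univ.erase a, (τ v u y : ℚ) ≤
      ∑ y ∈ Finset.univ.erase a, (1 - small G y) * (τ v u y : ℚ) :=
    Finset.sum_le_sum fun y hy => (h.one_sub_small_mul fun hvy => hv y hvy
      (Finset.ne_of_mem_erase hy)).ge
  linarith

/-- A vertex all of whose neighbors send at least `c` receives at least `2 * c` along each edge. -/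
lemma le_sum_received_of_big (h : TriangleSystem G τ) {v : V} {c : ℚ}
    (hv : ∀ y, G.Adj v y → 6 ≤ G.degree y) (hc : ∀ u, G.Adj v u → c ≤ sent G u) :
    G.degree v * (2 * c) ≤ ∑ u ∈ G.neighborFinset v, received G τ v u := by
  rw [← SimpleGraph.card_neighborFinset_eq_degree, ← nsmul_eq_mul]
  refine Finset.card_nsmul_le_sum _ _ _ fun u hu => ?_
  have := hc u ((G.mem_neighborFinset _ _).1 hu)
  have := h.le_received_of_big (u := u) hv
  linarith

/-- The charge received when all neighbors other than `a` send at least `c`. -/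
lemma le_sum_received_of_big_of_ne (h : TriangleSystem G τ) {v a : V} {c : ℚ} (hc0 : 0 ≤ c)
    (ha : G.Adj v a) (hv : ∀ y, G.Adj v y → y ≠ a → 6 ≤ G.degree y)
    (hc : ∀ u, G.Adj v u → u ≠ a → c ≤ sent G u) :
    ((G.degree v : ℚ) - 1) * (2 * c) - c ≤ ∑ u ∈ G.neighborFinset v, received G τ v u := by
  classical
  have ha' : a ∈ G.neighborFinset v := (G.mem_neighborFinset _ _).2 ha
  have hcard : (((G.neighborFinset v).erase a).card : ℚ) = (G.degree v : ℚ) - 1 := by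
    rw [Finset.card_erase_of_mem ha', SimpleGraph.card_neighborFinset_eq_degree, Nat.cast_sub]
    · simp
    · exact (G.degree_pos_iff_exists_adj v).2 ⟨a, ha⟩
  have hsum : ∑ u ∈ (G.neighborFinset v).erase a, (τ v u a : ℚ) ≤ 2 := by
    refine le_trans ?_ (h.sum_le_two v a)
    calc ∑ u ∈ (G.neighborFinset v).erase a, (τ v u a : ℚ)
        ≤ ∑ u, (τ v u a : ℚ) :=
          Finset.sum_le_sum_of_subset_of_nonneg (Finset.subset_univ _) fun _ _ _ => by positivity
      _ = ∑ u, (τ v a u : ℚ) := Finset.sum_congr rfl fun u _ => by rw [h.swap, h.rotate]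
  have hterm : ∀ u ∈ (G.neighborFinset v).erase a,
      2 * c - c / 2 * (τ v u a : ℚ) ≤ received G τ v u := by
    intro u hu
    obtain ⟨hua, hu⟩ := Finset.mem_erase.1 hu
    have hcu := hc u ((G.mem_neighborFinset _ _).1 hu) hua
    have h2 : (τ v u a : ℚ) ≤ 2 :=
      (Finset.single_le_sum (f := fun y => (τ v u y : ℚ)) (fun _ _ => by positivity)
        (Finset.mem_univ a)).trans (h.sum_le_two v u)
    have := h.le_received_of_big_of_ne (u := u) hv
    nlinarith
  have h1 := Finset.sum_le_sum hterm
  rw [Finset.sum_sub_distrib, Finset.sum_const, nsmul_eq_mul, hcard, ← Finset.mul_sum] at h1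
  rw [← Finset.add_sum_erase _ _ ha']
  have h2 := h.received_nonneg (G := G) v a
  have h3 := mul_le_mul_of_nonneg_left hsum (by linarith : 0 ≤ c / 2)
  linarith

lemma card_mul_le_sum_received (h : TriangleSystem G τ) {v : V} {c : ℚ} {s : Finset V}
    (hs : s ⊆ G.neighborFinset v) (hc : ∀ u ∈ s, c ≤ sent G u) :
    s.card * c ≤ ∑ u ∈ G.neighborFinset v, received G τ v u := by
  calc (s.card : ℚ) * c ≤ ∑ u ∈ s, received G τ v u := by
        rw [← nsmul_eq_mul]
        exact Finset.card_nsmul_le_sum _ _ _ fun u hu => (hc u hu).trans (h.sent_le_received v u)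
    _ ≤ _ := Finset.sum_le_sum_of_subset_of_nonneg hs fun u _ _ => h.received_nonneg v u

lemma six_sub_degree_le_of_degree_eq_three (h : TriangleSystem G τ) {v : V} (hv : G.degree v = 3)
    (h12 : ∀ u, G.Adj v u → 12 ≤ G.degree u) :
    6 - (G.degree v : ℚ) ≤ ∑ u ∈ G.neighborFinset v, received G τ v u := by
  have := h.le_sum_received_of_big (c := 1 / 2) (fun y hy => by have := h12 y hy; omega)
    fun u hu => le_sent (d := 12) (by norm_num) (h12 u hu) le_rfl (by norm_num)
  rw [hv] at this ⊢
  norm_num at this ⊢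
  linarith

lemma six_sub_degree_le_of_degree_eq_four (h : TriangleSystem G τ) {v : V} (hv : G.degree v = 4)
    (hA : ∀ v₁ v₂, G.Adj v v₁ → G.Adj v v₂ → v₁ ≠ v₂ → G.degree v₁ ≤ 7 → 10 ≤ G.degree v₂) :
    6 - (G.degree v : ℚ) ≤ ∑ u ∈ G.neighborFinset v, received G τ v u := by
  by_cases ha : ∃ a, G.Adj v a ∧ G.degree a ≤ 7
  · obtain ⟨a, ha, ha7⟩ := ha
    have := h.le_sum_received_of_big_of_ne (c := 2 / 5) (by norm_num) ha
      (fun y hy hya => by have := hA a y ha hy hya.symm ha7; omega)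
      fun u hu hua => le_sent (d := 10) (by norm_num) (hA a u ha hu hua.symm ha7) (by norm_num)
        (by norm_num)
    rw [hv] at this ⊢
    norm_num at this ⊢
    linarith
  · push Not at ha
    have := h.le_sum_received_of_big (c := 1 / 4) (fun y hy => by have := ha y hy; omega)
      fun u hu => le_sent (d := 8) (by norm_num) (ha u hu) (by norm_num) (by norm_num)
    rw [hv] at this ⊢
    norm_num at this ⊢
    linarith

lemma six_sub_degree_le_of_degree_eq_five (h : TriangleSystem G τ) {v : V} (hv : G.degree v = 5)
    (hA : ∀ v₁ v₂ v₃, G.Adj v v₁ → G.Adj v v₂ → G.Adj v v₃ → v₁ ≠ v₂ → v₁ ≠ v₃ → v₂ ≠ v₃ →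
      G.degree v₁ ≤ 6 → G.degree v₂ ≤ 7 → 9 ≤ G.degree v₃) :
    6 - (G.degree v : ℚ) ≤ ∑ u ∈ G.neighborFinset v, received G τ v u := by
  classical
  by_cases ha : ∃ a, G.Adj v a ∧ G.degree a ≤ 6
  · obtain ⟨a, ha, ha6⟩ := ha
    by_cases hb : ∃ b, G.Adj v b ∧ a ≠ b ∧ G.degree b ≤ 7
    · obtain ⟨b, hb, hab, hb7⟩ := hb
      have hcard : (((G.neighborFinset v).erase a).erase b).card = 3 := by
        rw [Finset.card_erase_of_mem, Finset.card_erase_of_mem,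
          SimpleGraph.card_neighborFinset_eq_degree, hv]
        · simpa using ha
        · simpa [hab.symm] using hb
      have := h.card_mul_le_sum_received (v := v) (c := 1 / 3)
        (s := ((G.neighborFinset v).erase a).erase b)
        ((Finset.erase_subset _ _).trans (Finset.erase_subset _ _)) (fun u hu => by
          simp only [Finset.mem_erase, SimpleGraph.mem_neighborFinset] at hu
          exact le_sent (d := 9) (by norm_num) (hA a b u ha hb hu.2.2 hab (Ne.symm hu.2.1)
            (Ne.symm hu.1) ha6 hb7) (by norm_num) (by norm_num))
      rw [hcard] at this
      rw [hv]
      norm_num at this ⊢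
      linarith
    · push Not at hb
      have hcard : ((G.neighborFinset v).erase a).card = 4 := by
        rw [Finset.card_erase_of_mem, SimpleGraph.card_neighborFinset_eq_degree, hv]
        simpa using ha
      have := h.card_mul_le_sum_received (v := v) (c := 1 / 4) (s := (G.neighborFinset v).erase a)
        (Finset.erase_subset _ _) (fun u hu => by
          simp only [Finset.mem_erase, SimpleGraph.mem_neighborFinset] at hu
          exact le_sent (d := 8) (by norm_num) (hb u hu.2 (Ne.symm hu.1)) (by norm_num)
            (by norm_num))
      rw [hcard] at this
      rw [hv]
      norm_num at this ⊢
      linarith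
  · push Not at ha
    have := h.le_sum_received_of_big (c := 1 / 7) (fun y hy => by have := ha y hy; omega)
      fun u hu => le_sent (d := 7) (by norm_num) (ha u hu) (by norm_num) (by norm_num)
    rw [hv] at this ⊢
    norm_num at this ⊢
    linarith

/-- The charge sent by the vertices of degree at least six pays for what the others receive
from them. -/
lemma sum_sent_le (h : TriangleSystem G τ) :
    ∑ v, small G v * ∑ u ∈ G.neighborFinset v,
      (sent G u + sent G u / 2 * ∑ y, (1 - small G y) * (τ v u y : ℚ)) ≤
    ∑ x, (1 - small G x) * ((G.degree x : ℚ) - 6) := by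
  have hadj : ∀ (v : V) (F : V → ℚ), ∑ u ∈ G.neighborFinset v, F u =
      ∑ u, if G.Adj v u then F u else 0 := fun v F => by
    rw [← Finset.sum_filter, SimpleGraph.neighborFinset_eq_filter]
  have hdart : ∀ u x, small G x * (if G.Adj u x then sent G u else 0) +
      ∑ y, small G y * (sent G u / 2 * ((1 - small G x) * (τ u x y : ℚ))) ≤
      if G.Adj u x then sent G u else 0 := by
    intro u x
    have hle : ∑ y, small G y * (τ u x y : ℚ) ≤ if G.Adj u x then 2 else 0 := by
      split_ifs with hux
      · exact (Finset.sum_le_sum fun y _ => mul_le_of_le_one_left (by positivity)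
          (small_le_one y)).trans (h.sum_le_two u x)
      · refine (Finset.sum_eq_zero fun y _ => ?_).le
        have : τ u x y = 0 := by
          by_contra hne
          exact hux (h.adj _ _ _ hne)
        simp [this]
    have heq : ∑ y, small G y * (sent G u / 2 * ((1 - small G x) * (τ u x y : ℚ))) =
        sent G u / 2 * (1 - small G x) * ∑ y, small G y * (τ u x y : ℚ) := by
      rw [Finset.mul_sum]
      exact Finset.sum_congr rfl fun y _ => by ring
    have h0 : 0 ≤ sent G u / 2 * (1 - small G x) :=
      mul_nonneg (by linarith [sent_nonneg (G := G) u]) (by linarith [small_le_one (G := G) x])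
    have hmul := mul_le_mul_of_nonneg_left hle h0
    rw [heq]
    split_ifs at hmul ⊢ <;> linarith
  calc ∑ v, small G v * ∑ u ∈ G.neighborFinset v,
        (sent G u + sent G u / 2 * ∑ y, (1 - small G y) * (τ v u y : ℚ))
      ≤ ∑ v, ∑ u, (small G v * (if G.Adj u v then sent G u else 0) +
          small G v * ∑ y, sent G u / 2 * ((1 - small G y) * (τ u y v : ℚ))) := by
        refine Finset.sum_le_sum fun v _ => ?_
        rw [hadj, Finset.mul_sum]
        refine Finset.sum_le_sum fun u _ => ?_
        rw [← mul_add]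
        refine mul_le_mul_of_nonneg_left ?_ (small_nonneg v)
        have heq : ∑ y, sent G u / 2 * ((1 - small G y) * (τ u y v : ℚ)) =
            sent G u / 2 * ∑ y, (1 - small G y) * (τ v u y : ℚ) := by
          rw [Finset.mul_sum]
          exact Finset.sum_congr rfl fun y _ => by rw [h.rotate v u y]
        rw [heq]
        simp only [G.adj_comm v u]
        split_ifs
        · rfl
        · rw [zero_add]
          exact mul_nonneg (by linarith [sent_nonneg (G := G) u]) (Finset.sum_nonneg fun y _ =>
            mul_nonneg (by linarith [small_le_one (G := G) y]) (by positivity))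
    _ = ∑ u, ∑ x, (small G x * (if G.Adj u x then sent G u else 0) +
          ∑ y, small G y * (sent G u / 2 * ((1 - small G x) * (τ u x y : ℚ)))) := by
        rw [Finset.sum_comm]
        refine Finset.sum_congr rfl fun u _ => ?_
        rw [Finset.sum_add_distrib, Finset.sum_add_distrib]
        congr 1
        simp only [Finset.mul_sum]
        exact Finset.sum_comm
    _ ≤ ∑ u, ∑ x, if G.Adj u x then sent G u else 0 :=
        Finset.sum_le_sum fun u _ => Finset.sum_le_sum fun x _ => hdart u x
    _ ≤ _ := by
        refine Finset.sum_le_sum fun u _ => ?_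
        rw [← hadj, Finset.sum_const, nsmul_eq_mul, SimpleGraph.card_neighborFinset_eq_degree]
        exact degree_mul_sent_le u

/-- If every vertex of small degree receives enough charge, the total charge is nonnegative. -/
lemma sum_charge_nonneg (h : TriangleSystem G τ) (hs : ∀ v, G.degree v ≤ 5 →
      6 - (G.degree v : ℚ) ≤ ∑ u ∈ G.neighborFinset v, received G τ v u) :
    0 ≤ ∑ v, (((G.degree v : ℚ) - 6) +
      ∑ u ∈ G.neighborFinset v, (1 / 4 : ℚ) * (2 - ∑ w, (τ v u w : ℚ))) := by
  have key : ∀ v, small G v * ∑ u ∈ G.neighborFinset v,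
        (sent G u + sent G u / 2 * ∑ y, (1 - small G y) * (τ v u y : ℚ)) +
      ((G.degree v : ℚ) - 6 +
        ∑ u ∈ G.neighborFinset v, (1 / 4 : ℚ) * (2 - ∑ w, (τ v u w : ℚ))) ≥
      (1 - small G v) * ((G.degree v : ℚ) - 6) := by
    intro v
    by_cases hv : G.degree v ≤ 5
    · have := hs v hv
      simp only [received, Finset.sum_add_distrib] at this ⊢
      have h1 : small G v = 1 := if_pos hv
      rw [h1]
      linarith
    · have : 0 ≤ ∑ u ∈ G.neighborFinset v, (1 / 4 : ℚ) * (2 - ∑ w, (τ v u w : ℚ)) :=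
        Finset.sum_nonneg fun u _ => by linarith [h.sum_le_two v u]
      have h0 : small G v = 0 := if_neg hv
      rw [h0]
      linarith
  have h1 := Finset.sum_le_sum fun v (_ : v ∈ Finset.univ) => key v
  rw [Finset.sum_add_distrib] at h1
  have h2 := h.sum_sent_le
  linarith

end TriangleSystem
end Discharging

/-- If every vertex of a connected planar graph `G` has degree at least 3 and
every vertex of degree 3 has all neighbors of degree at least 12, then `G`
contains configuration (A3) or (A4). -/
theorem planar_structural_A3_or_A4
    {V : Type u} [Fintype V] (G : SimpleGraph V) [DecidableRel G.Adj]
    (hplanar : IsPlanar G) (hconn : G.Connected)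
    (hmin : ∀ v : V, 3 ≤ G.degree v)
    (h3 : ∀ v : V, G.degree v = 3 → ∀ u, G.Adj v u → 12 ≤ G.degree u) :
    ∃ v : V,
      (G.degree v = 4 ∧ ∃ v₁ v₂, G.Adj v v₁ ∧ G.Adj v v₂ ∧ v₁ ≠ v₂ ∧
        G.degree v₁ ≤ 7 ∧ G.degree v₂ ≤ 9) ∨
      (G.degree v = 5 ∧ ∃ v₁ v₂ v₃, G.Adj v v₁ ∧ G.Adj v v₂ ∧ G.Adj v v₃ ∧
        v₁ ≠ v₂ ∧ v₁ ≠ v₃ ∧ v₂ ≠ v₃ ∧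
        G.degree v₁ ≤ 6 ∧ G.degree v₂ ≤ 7 ∧ G.degree v₃ ≤ 8) := by
  classical
  have : Nonempty V := hconn.nonempty
  obtain ⟨τ, hτ, hneg⟩ := hplanar.exists_triangleSystem
  by_contra! hno
  refine hneg.not_ge (hτ.sum_charge_nonneg fun v hv => ?_)
  obtain h | h | h : G.degree v = 3 ∨ G.degree v = 4 ∨ G.degree v = 5 := by
    have := hmin v
    omega
  · exact hτ.six_sub_degree_le_of_degree_eq_three h (h3 v h)
  · exact hτ.six_sub_degree_le_of_degree_eq_four h fun v₁ v₂ h1 h2 h12 h7 =>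
      (hno v).1 h v₁ v₂ h1 h2 h12 h7
  · exact hτ.six_sub_degree_le_of_degree_eq_five h fun v₁ v₂ v₃ h1 h2 h3 h12 h13 h23 h6 h7 =>
      (hno v).2 h v₁ v₂ v₃ h1 h2 h3 h12 h13 h23 h6 h7
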